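/- Let d ≥ 5, and adopt the shell setup: Q_{4N} ⊆ D ⊆ Z^d, 16 ≤ n < n+m ≤ N with m ≤ n/8, L the loop erasure of simple random walk from 0 stopped at its first exit from D, α the initial segment of L up to its first hit of ∂_i Q_n with endpoint x₀, β the segment of L from x₀ up to its first hit of ∂_i Q(x₀,m), and A the box Q(x₀ + (m/2)e₁, m/4) (suitably rotated if x₀ is not on the face H_n). Then there is a constant c = c(d) > 0 such that P( z ∈ β | α ) ≥ c m^{2-d} for every z ∈ A, and consequently E( H_A(β) | α ) ≥ c m². -/

import Mathlib

open MeasureTheory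
open scoped ENNReal Classical

namespace USFPaper

/-- Vertices of the nearest-neighbour integer lattice `ℤ^d`. -/
abbrev V (d : ℕ) := Fin d → ℤ

variable {d : ℕ}

/-- Nearest-neighbour adjacency in `ℤ^d`. -/
def adj (x y : V d) : Prop := (∑ i, |x i - y i|) = 1

/-- The cube `Q(x,r) = { y : ‖x - y‖_∞ ≤ r }`. -/
def cube (x : V d) (r : ℕ) : Set (V d) := { y | ∀ i, |y i - x i| ≤ (r : ℤ) }

/-- Inner boundary `∂ᵢA` of a set `A`. -/
def innerBdry (A : Set (V d)) : Set (V d) := { x | x ∈ A ∧ ∃ y, adj x y ∧ y ∉ A }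

/-- Euclidean distance on `ℤ^d`. -/
noncomputable def eudist (x y : V d) : ℝ := Real.sqrt (∑ i, ((x i : ℝ) - (y i : ℝ)) ^ 2)

/-- The `k`-th coordinate unit vector. -/
def unitVec (k : ℕ) : V d := fun i => if (i : ℕ) = k then 1 else 0

/-- `μ` is the law of simple random walk on `ℤ^d` started at `x`, as a probability
measure on path space: every nearest-neighbour cylinder of length `n` starting at `x`
has probability `(2d)⁻ⁿ`. -/
def IsSRWLaw (μ : Measure (ℕ → V d)) (x : V d) : Prop :=
  IsProbabilityMeasure μ ∧
  ∀ (n : ℕ) (γ : ℕ → V d), γ 0 = x → (∀ i < n, adj (γ i) (γ (i + 1))) →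
    μ { ω | ∀ i ≤ n, ω i = γ i } = (2 * (d : ℝ≥0∞))⁻¹ ^ n

/-- First exit time `τ_A` from `A`, valued in `ℕ∞` (`⊤` if the path never leaves `A`). -/
noncomputable def exitTimeE (A : Set (V d)) (ω : ℕ → V d) : ENat :=
  if h : ∃ j, ω j ∉ A then (Nat.find h : ENat) else ⊤

/-- First hitting time `T_A` of `A`, valued in `ℕ∞`. -/
noncomputable def hitTimeE (A : Set (V d)) (ω : ℕ → V d) : ENat :=
  if h : ∃ j, ω j ∈ A then (Nat.find h : ENat) else ⊤

/-- First positive hitting time `T⁺_A` of `A`, valued in `ℕ∞`. -/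
noncomputable def hitTimePosE (A : Set (V d)) (ω : ℕ → V d) : ENat :=
  if h : ∃ j, 1 ≤ j ∧ ω j ∈ A then (Nat.find h : ENat) else ⊤

/-- First exit time from `A` as a natural number (junk value `0` if the path never exits). -/
noncomputable def exitTime (A : Set (V d)) (ω : ℕ → V d) : ℕ := (exitTimeE A ω).toNat

/-- Index of the first hit of `A` (junk value `0` if `A` is never hit). -/
noncomputable def hitIdx (A : Set (V d)) (γ : ℕ → V d) : ℕ := (hitTimeE A γ).toNat

/-- First index `≥ t` at which the path lies in `A` (junk value `t`). -/
noncomputable def hitIdxFrom (A : Set (V d)) (t : ℕ) (γ : ℕ → V d) : ℕ :=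
  if h : ∃ j, t ≤ j ∧ γ j ∈ A then Nat.find h else t

/-- The path frozen at its first exit from `D`. -/
noncomputable def stopAt (D : Set (V d)) (ω : ℕ → V d) : ℕ → V d :=
  fun j => if (j : ENat) ≤ exitTimeE D ω then ω j else ω (exitTime D ω)

/-- Time of the last visit of the path to the point `ω t`, at or after time `t`
(junk value if there are infinitely many such visits). -/
noncomputable def lastVisit (ω : ℕ → V d) (t : ℕ) : ℕ := sSup { j | t ≤ j ∧ ω j = ω t }

/-- The times of the chronological loop erasure (last-exit decomposition). -/
noncomputable def leTime (ω : ℕ → V d) : ℕ → ℕ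
  | 0 => lastVisit ω 0
  | k + 1 => lastVisit ω (leTime ω k + 1)

/-- Chronological loop erasure of an (infinite, transient) path. -/
noncomputable def infLoopErase (ω : ℕ → V d) : ℕ → V d := fun k => ω (leTime ω k)

/-- The loop erasure `L` of the walk stopped at its first exit from `D`. -/
noncomputable def lerw (D : Set (V d)) (ω : ℕ → V d) : ℕ → V d := infLoopErase (stopAt D ω)

/-- The event `T_A > τ_D`: the walk does not visit `A` at any time up to (and
including) its first exit from `D`; if it never exits `D`, it never visits `A`. -/
def avoidBeforeExit (D A : Set (V d)) (ω : ℕ → V d) : Prop :=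
  ∀ j : ℕ, (j : ENat) ≤ exitTimeE D ω → ω j ∉ A

/-- The event `T⁺_A > τ_D` (visits of `A` at positive times only). -/
def avoidBeforeExitPos (D A : Set (V d)) (ω : ℕ → V d) : Prop :=
  ∀ j : ℕ, 1 ≤ j → (j : ENat) ≤ exitTimeE D ω → ω j ∉ A

/-- The right-hand face (in the first coordinate direction) of the cube `Q(x₀,m)`. -/
def rightFace (x₀ : V d) (m : ℕ) : Set (V d) :=
  { y | y ∈ cube x₀ m ∧ ∀ i : Fin d, (i : ℕ) = 0 → y i = x₀ i + (m : ℤ) }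


/-- The unit vector pointing towards the face of the cube `Q(0,n)` on which `x₀`
lies (the first coordinate realising `|x₀ i| = n`; junk value `0` if there is none). -/
noncomputable def faceDir (x₀ : V d) (n : ℕ) : V d :=
  if h : ∃ i : Fin d, |x₀ i| = (n : ℤ) then
    fun j => if j = Classical.choose h then (if 0 ≤ x₀ (Classical.choose h) then 1 else -1) else 0
  else 0

/-- The point `x₁ = x₀ + (m/2) e₁` (with `e₁` replaced by the unit vector pointing
towards the face of `Q(0,n)` containing `x₀`). -/
noncomputable def x1pt (x₀ : V d) (n m : ℕ) : V d := x₀ + ((m / 2 : ℕ) : ℤ) • faceDir x₀ n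

/-- The box `A = Q(x₁, m/4)`. -/
noncomputable def boxA (x₀ : V d) (n m : ℕ) : Set (V d) := cube (x1pt x₀ n m) (m / 4)

/-- A second unit direction, orthogonal to `faceDir x₀ n`, reflected according to the
sign of the corresponding coordinate of `x₀` (junk value `0` in degenerate cases). -/
noncomputable def sideDir (x₀ : V d) (n : ℕ) : V d :=
  if h : ∃ i : Fin d, |x₀ i| = (n : ℤ) then
    (if h2 : ∃ j : Fin d, j ≠ Classical.choose h then
      fun t => if t = Classical.choose h2 then (if x₀ (Classical.choose h2) ≤ 0 then 1 else -1) else 0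
    else 0)
  else 0

/-- The point `x₂ = x₁ + m e₂` (suitably rotated/reflected). -/
noncomputable def x2pt (x₀ : V d) (n m : ℕ) : V d := x1pt x₀ n m + (m : ℤ) • sideDir x₀ n

/-- `α`: the initial segment of the loop erasure `L = lerw D ω` up to its first hit
of `∂ᵢ Q(0,n)`, as a list. -/
noncomputable def alphaList (D : Set (V d)) (n : ℕ) (ω : ℕ → V d) : List (V d) :=
  (List.range (hitIdx (innerBdry (cube 0 n)) (lerw D ω) + 1)).map (lerw D ω)

/-- The endpoint `x₀` of a finite path (junk value `0` for the empty path). -/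
def endPt (a : List (V d)) : V d := (a.getLast?).getD 0

/-- `β`: the segment of the loop erasure `L = lerw D ω` from its first hit `x₀` of
`∂ᵢ Q(0,n)` up to its first subsequent hit of `∂ᵢ Q(x₀,m)`, as a list. -/
noncomputable def betaList (D : Set (V d)) (n m : ℕ) (ω : ℕ → V d) : List (V d) :=
  let γ := lerw D ω
  let k₁ := hitIdx (innerBdry (cube 0 n)) γ
  let k₂ := hitIdxFrom (innerBdry (cube (γ k₁) m)) k₁ γ
  (List.range (k₂ - k₁ + 1)).map fun i => γ (k₁ + i)

/-- `H_A(γ)`: the number of points of the path `γ` lying in the set `A`. -/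
noncomputable def hitCount (A : Set (V d)) (l : List (V d)) : ℕ :=
  (l.map fun v => if v ∈ A then 1 else 0).sum


section

section Analysis

lemma le_of_hasDerivAt_le {f f' g g' : ℝ → ℝ} {b : ℝ}
    (hf : ∀ t ∈ Set.Icc 0 b, HasDerivAt f (f' t) t) (hg : ∀ t ∈ Set.Icc 0 b, HasDerivAt g (g' t) t)
    (h0 : f 0 ≤ g 0) (h : ∀ t ∈ Set.Icc 0 b, f' t ≤ g' t) :
    ∀ t ∈ Set.Icc 0 b, f t ≤ g t := by
  intro t ht
  have hmono : MonotoneOn (fun t => g t - f t) (Set.Icc 0 b) := by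
    apply monotoneOn_of_deriv_nonneg (convex_Icc 0 b)
    · intro s hs
      exact ((hg s hs).sub (hf s hs)).continuousAt.continuousWithinAt
    · intro s hs
      rw [interior_Icc] at hs
      exact ((hg s (Set.Ioo_subset_Icc_self hs)).sub
        (hf s (Set.Ioo_subset_Icc_self hs))).differentiableAt.differentiableWithinAt
    · intro s hs
      rw [interior_Icc] at hs
      have hs' := Set.Ioo_subset_Icc_self hs
      have := ((hg s hs').sub (hf s hs')).deriv
      have h2 : deriv (fun t => g t - f t) s = g' s - f' s := this
      rw [h2]
      linarith [h s hs']
  have hb : (0:ℝ) ≤ b := ht.1.trans ht.2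
  have := hmono (Set.left_mem_Icc.2 hb) ht ht.1
  simp only at this
  linarith

noncomputable def Aq (q t : ℝ) : ℝ := (1 + t) ^ (-q) + (1 - t) ^ (-q)
noncomputable def Bq (q t : ℝ) : ℝ := (1 - t) ^ (-q) - (1 + t) ^ (-q)

lemma hasDerivAt_plus (q t : ℝ) (ht : t ∈ Set.Icc (0:ℝ) (1/2)) :
    HasDerivAt (fun t : ℝ => (1 + t) ^ (-q)) (-q * (1 + t) ^ (-(q+1))) t := by
  have h1 : HasDerivAt (fun t : ℝ => 1 + t) 1 t := by
    simpa using (hasDerivAt_id t).const_add (1:ℝ)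
  have := h1.rpow_const (p := -q) (Or.inl (by linarith [ht.1]))
  convert this using 1
  rw [show -(q+1) = -q - 1 by ring]; ring

lemma hasDerivAt_minus (q t : ℝ) (ht : t ∈ Set.Icc (0:ℝ) (1/2)) :
    HasDerivAt (fun t : ℝ => (1 - t) ^ (-q)) (q * (1 - t) ^ (-(q+1))) t := by
  have h1 : HasDerivAt (fun t : ℝ => 1 - t) (-1) t := by
    simpa using (hasDerivAt_id t).const_sub (1:ℝ)
  have := h1.rpow_const (p := -q) (Or.inl (by linarith [ht.2]))
  convert this using 1
  rw [show -(q+1) = -q - 1 by ring]; ring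

lemma hasDerivAt_Aq (q t : ℝ) (ht : t ∈ Set.Icc (0:ℝ) (1/2)) :
    HasDerivAt (Aq q) (q * Bq (q+1) t) t := by
  have := (hasDerivAt_plus q t ht).add (hasDerivAt_minus q t ht)
  exact this.congr_deriv (by unfold Bq; ring)

lemma hasDerivAt_Bq (q t : ℝ) (ht : t ∈ Set.Icc (0:ℝ) (1/2)) :
    HasDerivAt (Bq q) (q * Aq (q+1) t) t := by
  have := (hasDerivAt_minus q t ht).sub (hasDerivAt_plus q t ht)
  exact this.congr_deriv (by unfold Aq; ring)

lemma Aq_zero (q : ℝ) : Aq q 0 = 2 := by simp [Aq]; norm_num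
lemma Bq_zero (q : ℝ) : Bq q 0 = 0 := by simp [Bq]

lemma hasDerivAt_pow_aux (c : ℝ) (n : ℕ) (t : ℝ) :
    HasDerivAt (fun t : ℝ => c * t ^ (n+1)) (c * ((n+1 : ℝ) * t ^ n)) t := by
  have := (hasDerivAt_pow (n+1) t).const_mul c
  simpa using this

lemma Aq_upper0 {q : ℝ} (hq : 0 < q) : ∃ C, 0 ≤ C ∧ ∀ t ∈ Set.Icc (0:ℝ) (1/2), Aq q t ≤ C := by
  refine ⟨1 + 2 ^ q, by positivity, fun t ht => ?_⟩
  have h1 : (1 + t) ^ (-q) ≤ 1 := Real.rpow_le_one_of_one_le_of_nonpos (by linarith [ht.1]) (by linarith)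
  have h2 : (1 - t) ^ (-q) ≤ (1/2) ^ (-q) :=
    Real.rpow_le_rpow_of_nonpos (by norm_num) (by linarith [ht.2]) (by linarith)
  have h3 : ((1:ℝ)/2) ^ (-q) = 2 ^ q := by
    rw [one_div, Real.inv_rpow (by norm_num), Real.rpow_neg (by norm_num), inv_inv]
  unfold Aq; linarith

lemma Bq_upper1 {q : ℝ} (hq : 0 < q) :
    ∃ C, 0 ≤ C ∧ ∀ t ∈ Set.Icc (0:ℝ) (1/2), Bq q t ≤ C * t := by
  obtain ⟨C, hC0, hC⟩ := Aq_upper0 (q := q+1) (by linarith)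
  refine ⟨q * C, by positivity, ?_⟩
  apply le_of_hasDerivAt_le (fun t ht => hasDerivAt_Bq q t ht)
    (fun t _ => by simpa using (hasDerivAt_id t).const_mul (q*C))
  · simp [Bq_zero]
  · intro t ht
    exact mul_le_mul_of_nonneg_left (hC t ht) hq.le

lemma Aq_upper2 {q : ℝ} (hq : 0 < q) :
    ∃ C, 0 ≤ C ∧ ∀ t ∈ Set.Icc (0:ℝ) (1/2), Aq q t ≤ 2 + C * t ^ 2 := by
  obtain ⟨C, hC0, hC⟩ := Bq_upper1 (q := q+1) (by linarith)
  refine ⟨q * C, by positivity, ?_⟩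
  apply le_of_hasDerivAt_le (fun t ht => hasDerivAt_Aq q t ht)
    (fun t _ => (hasDerivAt_pow_aux (q*C) 1 t).const_add 2)
  · simp [Aq_zero]
  · intro t ht
    have := mul_le_mul_of_nonneg_left (hC t ht) hq.le
    have h2 : 0 ≤ q * C * t := by have := ht.1; positivity
    norm_num
    linarith

lemma Bq_upper3 {q : ℝ} (hq : 0 < q) :
    ∃ C, 0 ≤ C ∧ ∀ t ∈ Set.Icc (0:ℝ) (1/2), Bq q t ≤ 2 * q * t + C * t ^ 3 := by
  obtain ⟨C, hC0, hC⟩ := Aq_upper2 (q := q+1) (by linarith)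
  refine ⟨q * C, by positivity, ?_⟩
  apply le_of_hasDerivAt_le (fun t ht => hasDerivAt_Bq q t ht)
    (fun t _ => ((hasDerivAt_id t).const_mul (2*q)).add (hasDerivAt_pow_aux (q*C) 2 t))
  · simp [Bq_zero]
  · intro t ht
    have := mul_le_mul_of_nonneg_left (hC t ht) hq.le
    have h2 : 0 ≤ q * C * t ^ 2 := by positivity
    norm_num
    linarith

lemma Aq_upper4 {q : ℝ} (hq : 0 < q) :
    ∃ C, 0 ≤ C ∧ ∀ t ∈ Set.Icc (0:ℝ) (1/2), Aq q t ≤ 2 + q * (q+1) * t ^ 2 + C * t ^ 4 := by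
  obtain ⟨C, hC0, hC⟩ := Bq_upper3 (q := q+1) (by linarith)
  refine ⟨q * C, by positivity, ?_⟩
  apply le_of_hasDerivAt_le (fun t ht => hasDerivAt_Aq q t ht)
    (fun t _ => (((hasDerivAt_pow_aux (q*(q+1)) 1 t).const_add 2).add (hasDerivAt_pow_aux (q*C) 3 t)))
  · simp [Aq_zero]
  · intro t ht
    have := mul_le_mul_of_nonneg_left (hC t ht) hq.le
    have h2 : 0 ≤ q * C * t ^ 3 := by have := ht.1; positivity
    norm_num
    linarith

lemma Aq_nonneg (q t : ℝ) (ht : t ∈ Set.Icc (0:ℝ) (1/2)) : 0 ≤ Aq q t := by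
  have h1 : (0:ℝ) ≤ 1 + t := by linarith [ht.1]
  have h2 : (0:ℝ) ≤ 1 - t := by linarith [ht.2]
  unfold Aq; positivity

lemma Bq_lower0 {q : ℝ} (hq : 0 < q) : ∀ t ∈ Set.Icc (0:ℝ) (1/2), 0 ≤ Bq q t := by
  apply le_of_hasDerivAt_le (fun t _ => hasDerivAt_const t (0:ℝ)) (fun t ht => hasDerivAt_Bq q t ht)
  · simp [Bq_zero]
  · intro t ht
    exact mul_nonneg hq.le (Aq_nonneg _ t ht)

lemma Aq_lower0 {q : ℝ} (hq : 0 < q) : ∀ t ∈ Set.Icc (0:ℝ) (1/2), 2 ≤ Aq q t := by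
  apply le_of_hasDerivAt_le (fun t _ => hasDerivAt_const t (2:ℝ)) (fun t ht => hasDerivAt_Aq q t ht)
  · simp [Aq_zero]
  · intro t ht
    exact mul_nonneg hq.le (Bq_lower0 (by linarith) t ht)

lemma Bq_lower1 {q : ℝ} (hq : 0 < q) : ∀ t ∈ Set.Icc (0:ℝ) (1/2), 2 * q * t ≤ Bq q t := by
  apply le_of_hasDerivAt_le (fun t _ => (hasDerivAt_id t).const_mul (2*q))
    (fun t ht => hasDerivAt_Bq q t ht)
  · simp [Bq_zero]
  · intro t ht
    have := mul_le_mul_of_nonneg_left (Aq_lower0 (q := q+1) (by linarith) t ht) hq.le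
    linarith

lemma Aq_lower2 {q : ℝ} (hq : 0 < q) :
    ∀ t ∈ Set.Icc (0:ℝ) (1/2), 2 + q * (q+1) * t ^ 2 ≤ Aq q t := by
  apply le_of_hasDerivAt_le (fun t _ => (hasDerivAt_pow_aux (q*(q+1)) 1 t).const_add 2)
    (fun t ht => hasDerivAt_Aq q t ht)
  · simp [Aq_zero]
  · intro t ht
    have := mul_le_mul_of_nonneg_left (Bq_lower1 (q := q+1) (by linarith) t ht) hq.le
    norm_num
    linarith

lemma Aq_neg (q t : ℝ) : Aq q (-t) = Aq q t := by
  unfold Aq; rw [add_comm]; congr 2 <;> ring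

lemma Aq_bounds {q : ℝ} (hq : 0 < q) : ∃ C, 0 ≤ C ∧ ∀ t : ℝ, |t| ≤ 1/2 →
    2 + q * (q+1) * t ^ 2 ≤ Aq q t ∧ Aq q t ≤ 2 + q * (q+1) * t ^ 2 + C * t ^ 4 := by
  obtain ⟨C, hC0, hC⟩ := Aq_upper4 hq
  refine ⟨C, hC0, fun t ht => ?_⟩
  have hm : |t| ∈ Set.Icc (0:ℝ) (1/2) := ⟨abs_nonneg t, ht⟩
  have hA : Aq q |t| = Aq q t := by
    rcases abs_choice t with h | h <;> rw [h]; exact Aq_neg q t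
  have h1 := Aq_lower2 hq _ hm
  have h2 := hC _ hm
  have h4 : |t| ^ 4 = t ^ 4 := by
    rw [show (4:ℕ) = 2 * 2 by norm_num, pow_mul, pow_mul, sq_abs]
  rw [hA, sq_abs] at h1
  rw [hA, sq_abs, h4] at h2
  exact ⟨h1, h2⟩

lemma one_sub_rpow_bounds {q : ℝ} (hq : 0 < q) : ∃ C, 0 ≤ C ∧ ∀ x ∈ Set.Icc (0:ℝ) (1/2),
    1 + q * x ≤ (1 - x) ^ (-q) ∧ (1 - x) ^ (-q) ≤ 1 + q * x + C * x ^ 2 := by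
  obtain ⟨C, hC0, hC⟩ := Aq_upper2 hq
  obtain ⟨C', hC0', hC'⟩ := Bq_upper3 hq
  refine ⟨C + C', by positivity, fun x hx => ?_⟩
  have e : (1 - x) ^ (-q) = (Aq q x + Bq q x) / 2 := by unfold Aq Bq; ring
  have h1 := hC x hx
  have h2 := hC' x hx
  have h3 := Aq_lower0 hq x hx
  have h4 := Bq_lower1 hq x hx
  have h5 : x ^ 3 ≤ x ^ 2 := by
    have : x ^ 3 = x ^ 2 * x := by ring
    rw [this]; nlinarith [sq_nonneg x, hx.2]
  have h6 := mul_le_mul_of_nonneg_left h5 hC0'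
  have h7 : 0 ≤ C * x ^ 2 := by positivity
  have h8 : 0 ≤ C' * x ^ 2 := by positivity
  rw [e]
  constructor <;> nlinarith

end Analysis

section Lattice

def eV (i : Fin d) : V d := Pi.single i 1

noncomputable def avg (f : V d → ℝ) (x : V d) : ℝ :=
  (∑ i, (f (x + eV i) + f (x - eV i))) / (2 * d)

noncomputable def nsq (x : V d) : ℝ := ∑ i, (x i : ℝ) ^ 2

lemma nsq_nonneg (x : V d) : 0 ≤ nsq x := Finset.sum_nonneg fun _ _ => sq_nonneg _

lemma sq_le_nsq (x : V d) (i : Fin d) : (x i : ℝ) ^ 2 ≤ nsq x :=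
  Finset.single_le_sum (f := fun i => (x i : ℝ) ^ 2) (fun _ _ => sq_nonneg _) (Finset.mem_univ i)

lemma nsq_neg (x : V d) : nsq (-x) = nsq x := by simp [nsq]

lemma nsq_sub_comm (x y : V d) : nsq (x - y) = nsq (y - x) := by
  rw [← nsq_neg]; congr 1; abel

lemma nsq_add_le (x y : V d) : nsq (x + y) ≤ 2 * nsq x + 2 * nsq y := by
  unfold nsq
  rw [Finset.mul_sum, Finset.mul_sum, ← Finset.sum_add_distrib]
  apply Finset.sum_le_sum
  intro i _
  simp only [Pi.add_apply, Int.cast_add]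
  nlinarith [sq_nonneg ((x i : ℝ) - y i)]

lemma nsq_add_eV (x : V d) (i : Fin d) : nsq (x + eV i) = nsq x + 1 + 2 * x i := by
  unfold nsq
  have : ∀ j, (((x + eV i) j : ℤ) : ℝ) ^ 2 = (x j : ℝ) ^ 2 + (if j = i then (1 + 2 * (x i : ℝ)) else 0) := by
    intro j
    by_cases h : j = i
    · subst h; simp [eV]; ring
    · simp [eV, h]
  simp_rw [this]
  rw [Finset.sum_add_distrib]
  simp; ring

lemma nsq_sub_eV (x : V d) (i : Fin d) : nsq (x - eV i) = nsq x + 1 - 2 * x i := by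
  have := nsq_add_eV (-x) i
  rw [show x - eV i = -(-x + eV i) by abel, nsq_neg, this, nsq_neg]
  simp; ring

lemma avg_mono {f g : V d → ℝ} {x : V d} (h : ∀ y, f y ≤ g y) : avg f x ≤ avg g x := by
  unfold avg
  gcongr with i
  · exact h _
  · exact h _

lemma avg_add (f g : V d → ℝ) (x : V d) : avg (fun y => f y + g y) x = avg f x + avg g x := by
  unfold avg
  rw [← add_div, ← Finset.sum_add_distrib]
  congr 1
  apply Finset.sum_congr rfl
  intros; ring

lemma avg_smul (c : ℝ) (f : V d → ℝ) (x : V d) : avg (fun y => c * f y) x = c * avg f x := by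
  unfold avg
  rw [← mul_div_assoc, Finset.mul_sum]
  congr 1
  apply Finset.sum_congr rfl
  intros; ring

lemma avg_const (hd : 0 < d) (c : ℝ) (x : V d) : avg (fun _ => c) x = c := by
  unfold avg
  have : (d : ℝ) ≠ 0 := by positivity
  simp; field_simp; ring

lemma avg_sub (f g : V d → ℝ) (x : V d) : avg (fun y => f y - g y) x = avg f x - avg g x := by
  have h := avg_add f (fun y => (-1) * g y) x
  rw [avg_smul] at h
  simp only [neg_mul, one_mul, ← sub_eq_add_neg] at h
  exact h

lemma avg_nonneg {f : V d → ℝ} {x : V d} (h : ∀ y, 0 ≤ f y) : 0 ≤ avg f x := by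
  unfold avg
  apply div_nonneg _ (by positivity)
  exact Finset.sum_nonneg fun i _ => add_nonneg (h _) (h _)

lemma avg_shift (f : V d → ℝ) (x y : V d) : avg (fun z => f (z - y)) x = avg f (x - y) := by
  unfold avg
  congr 1
  apply Finset.sum_congr rfl
  intro i _
  beta_reduce
  rw [show x + eV i - y = x - y + eV i by abel, show x - eV i - y = x - y - eV i by abel]

lemma avg_power {q K : ℝ} {x : V d} (hpos : 0 < nsq x + 1 + K)
    (hs : ∀ i, |2 * (x i : ℝ) / (nsq x + 1 + K)| ≤ 1/2) :
    avg (fun y => (nsq y + K) ^ (-q)) x =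
      (nsq x + 1 + K) ^ (-q) * (∑ i, Aq q (2 * (x i : ℝ) / (nsq x + 1 + K))) / (2 * d) := by
  unfold avg
  congr 1
  rw [Finset.mul_sum]
  apply Finset.sum_congr rfl
  intro i _
  set s := nsq x + 1 + K with hsdef
  have h1 := abs_le.1 (hs i)
  simp only [nsq_add_eV, nsq_sub_eV]
  have e1 : nsq x + 1 + 2 * (x i : ℝ) + K = s * (1 + 2 * (x i : ℝ) / s) := by
    field_simp; rw [hsdef]; ring
  have e2 : nsq x + 1 - 2 * (x i : ℝ) + K = s * (1 - 2 * (x i : ℝ) / s) := by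
    field_simp; rw [hsdef]; ring
  rw [e1, e2, Real.mul_rpow hpos.le (by linarith), Real.mul_rpow hpos.le (by linarith)]
  unfold Aq; ring

lemma superharm (hd : 0 < d) {q : ℝ} (hq : 0 < q) : ∃ K0 : ℝ, 3 ≤ K0 ∧ ∀ K ≥ K0, ∀ x : V d,
    (nsq x + 1 + K) ^ (-q - 2) * (q * (1 - 2 * (q+1) / d) * nsq x + q * (1 + K) / 2) ≤
      (nsq x + K) ^ (-q) - avg (fun y => (nsq y + K) ^ (-q)) x := by
  obtain ⟨C, hC0, hC⟩ := Aq_bounds hq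
  obtain ⟨C2, hC20, hC2⟩ := one_sub_rpow_bounds hq
  refine ⟨3 + 16 * C / (d * q), by have : 0 ≤ 16 * C / (d * q) := by positivity
                                   linarith, fun K hK x => ?_⟩
  have hdR : (0:ℝ) < d := by exact_mod_cast hd
  have hKa : 16 * C / (d * q) ≤ K := by linarith
  have hKa' : 16 * C / d ≤ q * K := by
    rw [div_le_iff₀ (by positivity)] at hKa ⊢
    linarith
  have hK3 : 3 ≤ K := by have : 0 ≤ 16 * C / (d * q) := by positivity
                         linarith
  have hn := nsq_nonneg x
  set s := nsq x + 1 + K with hsdef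
  have hs0 : 0 < s := by linarith
  have ht : ∀ i, |2 * (x i : ℝ) / s| ≤ 1/2 := by
    intro i
    rw [abs_div, abs_of_pos hs0, div_le_iff₀ hs0, abs_mul, abs_two]
    have := sq_le_nsq x i
    have h2 : |(x i : ℝ)| ^ 2 = (x i : ℝ) ^ 2 := sq_abs _
    nlinarith [sq_nonneg (|(x i : ℝ)| - 2)]
  rw [avg_power hs0 ht]
  have hsum : ∑ i, Aq q (2 * (x i : ℝ) / s) ≤ 2 * d + q * (q+1) * (4 * nsq x / s ^ 2) + C * (16 / s ^ 2) := by
    calc ∑ i, Aq q (2 * (x i : ℝ) / s)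
        ≤ ∑ i, (2 + q * (q+1) * (2 * (x i : ℝ) / s) ^ 2 + C * (2 * (x i : ℝ) / s) ^ 4) :=
          Finset.sum_le_sum fun i _ => (hC _ (ht i)).2
      _ = 2 * d + q * (q+1) * (4 * nsq x / s ^ 2) + C * (∑ i, (2 * (x i : ℝ) / s) ^ 4) := by
          rw [Finset.sum_add_distrib, Finset.sum_add_distrib, ← Finset.mul_sum, ← Finset.mul_sum]
          congr 2
          · simp; ring
          · congr 1
            unfold nsq
            rw [Finset.mul_sum, Finset.sum_div]
            apply Finset.sum_congr rfl
            intro i _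
            field_simp; norm_num <;> ring
      _ ≤ _ := by
          gcongr
          have h4 : ∑ i, (2 * (x i : ℝ) / s) ^ 4 ≤ ∑ i, 16 / s ^ 3 * (x i : ℝ) ^ 2 := by
            apply Finset.sum_le_sum
            intro i _
            have h1 := sq_le_nsq x i
            have : (2 * (x i : ℝ) / s) ^ 4 = 16 / s ^ 4 * (x i : ℝ) ^ 2 * (x i : ℝ) ^ 2 := by
              field_simp; norm_num <;> ring
            rw [this]
            have h2 : (x i : ℝ) ^ 2 ≤ s := by linarith
            have : 16 / s ^ 3 * (x i : ℝ) ^ 2 = 16 / s ^ 4 * s * (x i : ℝ) ^ 2 := by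
              field_simp
            rw [this]
            gcongr
          refine h4.trans ?_
          rw [← Finset.mul_sum]
          have : 16 / s ^ 2 = 16 / s ^ 3 * s := by field_simp
          rw [this]
          gcongr
          change nsq x ≤ s
          linarith
  have hf : (nsq x + K) ^ (-q) ≥ s ^ (-q) * (1 + q / s) := by
    have e : nsq x + K = s * (1 - 1 / s) := by field_simp; rw [hsdef]; ring
    have h1s : 1 / s ∈ Set.Icc (0:ℝ) (1/2) := by
      refine ⟨by positivity, ?_⟩
      apply one_div_le_one_div_of_le <;> linarith
    rw [e, Real.mul_rpow hs0.le (by linarith [h1s.2])]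
    have := (hC2 _ h1s).1
    have hp : 0 < s ^ (-q) := Real.rpow_pos_of_pos hs0 _
    have : 1 + q / s ≤ (1 - 1/s) ^ (-q) := by
      rw [show q / s = q * (1 / s) by ring]; exact this
    exact mul_le_mul_of_nonneg_left this hp.le
  have e2 : s ^ (-q - 2) = s ^ (-q) / s ^ 2 := by
    rw [Real.rpow_sub hs0]; norm_num
  have hp : 0 < s ^ (-q) := Real.rpow_pos_of_pos hs0 _
  have h3 : s ^ (-q) * (∑ i, Aq q (2 * (x i : ℝ) / s)) / (2 * d) ≤
      s ^ (-q) * (2 * d + q * (q+1) * (4 * nsq x / s ^ 2) + C * (16 / s ^ 2)) / (2 * d) := by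
    gcongr
  have key : s ^ (-q) / s ^ 2 * (q * (1 - 2 * (q+1) / d) * nsq x + q * (1 + K) / 2) ≤
      s ^ (-q) * (1 + q / s) -
      s ^ (-q) * (2 * d + q * (q+1) * (4 * nsq x / s ^ 2) + C * (16 / s ^ 2)) / (2 * d) := by
    have e3 : s ^ (-q) * (1 + q / s) -
      s ^ (-q) * (2 * d + q * (q+1) * (4 * nsq x / s ^ 2) + C * (16 / s ^ 2)) / (2 * d)
      = s ^ (-q) / s ^ 2 * (q * s - q * (2 * (q+1) / d) * nsq x - 8 * C / d) := by
      field_simp; ring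
    rw [e3]
    have : 0 < s ^ (-q) / s ^ 2 := by positivity
    apply mul_le_mul_of_nonneg_left _ this.le
    have : 16 * C / d = 2 * (8 * C / d) := by ring
    rw [hsdef]
    nlinarith
  rw [e2]
  linarith

lemma subharm (hd : 0 < d) {q : ℝ} (hq : 0 < q) (hqd : 2 * (q + 1) = d) :
    ∃ K : ℝ, 32 ≤ K ∧ ∀ x : V d, 2 * K ≤ nsq x →
      (nsq x + (-K)) ^ (-q) ≤ avg (fun y => (nsq y + (-K)) ^ (-q)) x := by
  obtain ⟨C, hC0, hC⟩ := Aq_bounds hq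
  obtain ⟨C2, hC20, hC2⟩ := one_sub_rpow_bounds hq
  have hdR : (0:ℝ) < d := by exact_mod_cast hd
  refine ⟨32 + C2 / q, by have : 0 ≤ C2 / q := by positivity
                          linarith, fun x hx => ?_⟩
  set K := 32 + C2 / q with hK
  have hK1 : C2 ≤ q * (K - 1) := by
    have : C2 = q * (C2 / q) := by field_simp
    rw [hK]; nlinarith
  have hK32 : 32 ≤ K := by have : 0 ≤ C2 / q := by positivity
                           linarith
  set s := nsq x + 1 + -K with hsdef
  have hs0 : 0 < s := by linarith
  have ht : ∀ i, |2 * (x i : ℝ) / s| ≤ 1/2 := by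
    intro i
    rw [abs_div, abs_of_pos hs0, div_le_iff₀ hs0, abs_mul, abs_two]
    have := sq_le_nsq x i
    have h2 : |(x i : ℝ)| ^ 2 = (x i : ℝ) ^ 2 := sq_abs _
    nlinarith [sq_nonneg (|(x i : ℝ)| - 8), abs_nonneg (x i : ℝ)]
  rw [avg_power hs0 ht]
  have hsum : 2 * d + q * (q+1) * (4 * nsq x / s ^ 2) ≤ ∑ i, Aq q (2 * (x i : ℝ) / s) := by
    calc ∑ i, Aq q (2 * (x i : ℝ) / s)
        ≥ ∑ i, (2 + q * (q+1) * (2 * (x i : ℝ) / s) ^ 2) :=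
          Finset.sum_le_sum fun i _ => (hC _ (ht i)).1
      _ = 2 * d + q * (q+1) * (4 * nsq x / s ^ 2) := by
          rw [Finset.sum_add_distrib, ← Finset.mul_sum]
          congr 1
          · simp; ring
          · congr 1
            unfold nsq
            rw [Finset.mul_sum, Finset.sum_div]
            apply Finset.sum_congr rfl
            intro i _
            field_simp; norm_num <;> ring
  have hf : (nsq x + -K) ^ (-q) ≤ s ^ (-q) * (1 + q / s + C2 / s ^ 2) := by
    have e : nsq x + -K = s * (1 - 1 / s) := by field_simp; rw [hsdef]; ring
    have h1s : 1 / s ∈ Set.Icc (0:ℝ) (1/2) := by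
      refine ⟨by positivity, ?_⟩
      apply one_div_le_one_div_of_le <;> linarith
    rw [e, Real.mul_rpow hs0.le (by linarith [h1s.2])]
    have := (hC2 _ h1s).2
    have hp : 0 < s ^ (-q) := Real.rpow_pos_of_pos hs0 _
    have : (1 - 1/s) ^ (-q) ≤ 1 + q / s + C2 / s ^ 2 := by
      rw [show q / s = q * (1 / s) by ring, show C2 / s ^ 2 = C2 * (1/s)^2 by ring]; exact this
    exact mul_le_mul_of_nonneg_left this hp.le
  have hp : 0 < s ^ (-q) := Real.rpow_pos_of_pos hs0 _
  have h3 : s ^ (-q) * (2 * d + q * (q+1) * (4 * nsq x / s ^ 2)) / (2 * d) ≤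
    s ^ (-q) * (∑ i, Aq q (2 * (x i : ℝ) / s)) / (2 * d) := by
    gcongr
  have e3 : s ^ (-q) * (2 * d + q * (q+1) * (4 * nsq x / s ^ 2)) / (2 * d) -
      s ^ (-q) * (1 + q / s + C2 / s ^ 2)
      = s ^ (-q) / s ^ 2 * (q * nsq x - q * s - C2) := by
    rw [← hqd]
    have : q + 1 ≠ 0 := by positivity
    field_simp; ring
  have h4 : 0 ≤ s ^ (-q) / s ^ 2 * (q * nsq x - q * s - C2) := by
    apply mul_nonneg (by positivity)
    rw [hsdef]; nlinarith
  linarith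

end Lattice

end

section
section Green

noncomputable def qk (U : Set (V d)) (F : V d → ℝ) : ℕ → V d → ℝ
  | 0 => fun x => if x ∈ U then F x else 0
  | t+1 => fun x => if x ∈ U then avg (qk U F t) x else 0

noncomputable def GF (U : Set (V d)) (F : V d → ℝ) (x : V d) : ℝ := ∑' t, qk U F t x

noncomputable def dl (y : V d) : V d → ℝ := fun x => if x = y then 1 else 0

noncomputable def Green (U : Set (V d)) (y x : V d) : ℝ := GF U (dl y) x

lemma avg_congr {f g : V d → ℝ} {x : V d} (h : ∀ i, f (x + eV i) = g (x + eV i) ∧ f (x - eV i) = g (x - eV i)) :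
    avg f x = avg g x := by
  unfold avg; congr 1
  exact Finset.sum_congr rfl fun i _ => by rw [(h i).1, (h i).2]

lemma avg_sum {ι : Type*} (s : Finset ι) (f : ι → V d → ℝ) (x : V d) :
    avg (fun y => ∑ j ∈ s, f j y) x = ∑ j ∈ s, avg (f j) x := by
  induction s using Finset.induction_on with
  | empty => simp [avg]
  | insert a s ha ih => simp_rw [Finset.sum_insert ha]; rw [avg_add, ih]

lemma qk_nonneg {U : Set (V d)} {F : V d → ℝ} (hF : ∀ x, 0 ≤ F x) (t : ℕ) (x : V d) : 0 ≤ qk U F t x := by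
  induction t generalizing x with
  | zero => simp only [qk]; split_ifs; exacts [hF x, le_rfl]
  | succ t ih => simp only [qk]; split_ifs; exacts [avg_nonneg ih, le_rfl]

lemma qk_off {U : Set (V d)} {F : V d → ℝ} {x : V d} (hx : x ∉ U) (t : ℕ) : qk U F t x = 0 := by
  cases t <;> simp [qk, hx]

lemma qk_partial {U : Set (V d)} {F φ : V d → ℝ} (hφ : ∀ x, 0 ≤ φ x)
    (h : ∀ x ∈ U, F x + avg φ x ≤ φ x) (T : ℕ) (x : V d) :
    ∑ t ∈ Finset.range T, qk U F t x ≤ φ x := by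
  induction T generalizing x with
  | zero => simpa using hφ x
  | succ T ih =>
    by_cases hx : x ∈ U
    · rw [Finset.sum_range_succ']
      simp only [qk, hx, if_true]
      rw [← avg_sum, add_comm]
      have := avg_mono (x := x) ih
      linarith [h x hx]
    · simp [qk_off hx, hφ x]

lemma qk_summable {U : Set (V d)} {F φ : V d → ℝ} (hF : ∀ x, 0 ≤ F x) (hφ : ∀ x, 0 ≤ φ x)
    (h : ∀ x ∈ U, F x + avg φ x ≤ φ x) (x : V d) : Summable (fun t => qk U F t x) :=
  summable_of_sum_range_le (fun t => qk_nonneg hF t x) (fun T => qk_partial hφ h T x)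

lemma GF_le {U : Set (V d)} {F φ : V d → ℝ} (hF : ∀ x, 0 ≤ F x) (hφ : ∀ x, 0 ≤ φ x)
    (h : ∀ x ∈ U, F x + avg φ x ≤ φ x) (x : V d) : GF U F x ≤ φ x :=
  Real.tsum_le_of_sum_range_le (fun t => qk_nonneg hF t x) (fun T => qk_partial hφ h T x)

lemma GF_nonneg {U : Set (V d)} {F : V d → ℝ} (hF : ∀ x, 0 ≤ F x) (x : V d) : 0 ≤ GF U F x :=
  tsum_nonneg fun t => qk_nonneg hF t x

lemma GF_off {U : Set (V d)} {F : V d → ℝ} {x : V d} (hx : x ∉ U) : GF U F x = 0 := by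
  simp [GF, qk_off hx]

lemma GF_eq {U : Set (V d)} {F : V d → ℝ} (hs : ∀ x, Summable (fun t => qk U F t x)) {x : V d} (hx : x ∈ U) :
    GF U F x = F x + avg (GF U F) x := by
  unfold GF
  rw [(hs x).tsum_eq_zero_add]
  simp only [qk, hx, if_true]
  congr 1
  unfold avg
  rw [tsum_div_const]
  congr 1
  rw [Summable.tsum_finsetSum]
  · exact Finset.sum_congr rfl fun i _ => (Summable.tsum_add (hs _) (hs _))
  · exact fun i _ => (hs _).add (hs _)

lemma qk_lin {ι : Type*} (U : Set (V d)) (s : Finset ι) (c : ι → ℝ) (F : ι → V d → ℝ) (t : ℕ) (x : V d) :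
    qk U (fun y => ∑ j ∈ s, c j * F j y) t x = ∑ j ∈ s, c j * qk U (F j) t x := by
  induction t generalizing x with
  | zero => simp only [qk]; split_ifs <;> simp
  | succ t ih =>
    simp only [qk]
    split_ifs
    · rw [show qk U (fun y => ∑ j ∈ s, c j * F j y) t = fun y => ∑ j ∈ s, c j * qk U (F j) t y from funext ih, avg_sum]
      simp_rw [avg_smul]
    · simp

/-! constants -/

lemma pow_super {q : ℝ} {K s : ℝ} (hK : 3 ≤ K) (hs : 0 ≤ s) (hq : 0 ≤ q) : (2:ℝ) ^ (-q) * (s + K) ^ (-q) ≤ (s + 1 + K) ^ (-q) := by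
  rw [← Real.mul_rpow (by norm_num) (by linarith)]
  exact Real.rpow_le_rpow_of_nonpos (by linarith) (by linarith) (by linarith)

lemma exK (hd : 5 ≤ d) : ∃ K : ℝ, 3 ≤ K ∧ ∃ c : ℝ, 0 < c ∧ ∀ x : V d,
    (c * dl 0 x + avg (fun y => (nsq y + K) ^ (-((d:ℝ)-2)/2)) x ≤ (nsq x + K) ^ (-((d:ℝ)-2)/2)) ∧
    (c * (nsq x + K) ^ (-((d:ℝ)-2)/2) + avg (fun y => (nsq y + K) ^ (-((d:ℝ)-4)/2)) x ≤ (nsq x + K) ^ (-((d:ℝ)-4)/2)) := by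
  have hd5 : (5:ℝ) ≤ d := by exact_mod_cast hd
  obtain ⟨K1, h1, hK1⟩ := superharm (d := d) (by omega) (q := ((d:ℝ)-2)/2) (by linarith)
  obtain ⟨K2, h2, hK2⟩ := superharm (d := d) (by omega) (q := ((d:ℝ)-4)/2) (by linarith)
  set K := max K1 K2
  have hK3 : 3 ≤ K := h1.trans (le_max_left _ _)
  set p := ((d:ℝ)-2)/2 with hp
  set q := ((d:ℝ)-4)/2 with hq
  have hp0 : 0 < p := by rw [hp]; linarith
  have hq0 : 0 < q := by rw [hq]; linarith
  have ep : -((d:ℝ)-2)/2 = -p := by rw [hp]; ring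
  have eq : -((d:ℝ)-4)/2 = -q := by rw [hq]; ring
  set c1 := (1+K) ^ (-p-2) * (p * (1+K)/2)
  set c2 := (2:ℝ) ^ (-p) * (q / d)
  have hc1 : 0 < c1 := by positivity
  have hc2 : 0 < c2 := by positivity
  refine ⟨K, hK3, min c1 c2, lt_min hc1 hc2, fun x => ?_⟩
  have a1 := hK1 K (le_max_left _ _) x
  have a2 := hK2 K (le_max_right _ _) x
  rw [ep, eq]
  have hn := nsq_nonneg x
  constructor
  · have e : 1 - 2 * (p+1)/d = 0 := by rw [hp]; field_simp; ring
    rw [e] at a1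
    have : min c1 c2 * dl 0 x ≤ (nsq x + 1 + K) ^ (-p - 2) * (p * 0 * nsq x + p * (1 + K) / 2) := by
      unfold dl
      split_ifs with hx
      · subst hx
        have : nsq (0 : V d) = 0 := by simp [nsq]
        rw [this]; simp only [zero_add, mul_zero, mul_one]
        exact min_le_left _ _
      · rw [mul_zero]; positivity
    linarith
  · have e : 1 - 2 * (q+1)/d = 2/d := by rw [hq]; field_simp; ring
    rw [e] at a2
    have hs : 0 < nsq x + 1 + K := by linarith
    have : min c1 c2 * (nsq x + K) ^ (-p) ≤ (nsq x + 1 + K) ^ (-q - 2) * (q * (2/d) * nsq x + q * (1 + K) / 2) := by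
      calc min c1 c2 * (nsq x + K) ^ (-p) ≤ c2 * (nsq x + K) ^ (-p) := by
            gcongr; exact min_le_right _ _
        _ = (q/d) * (2 ^ (-p) * (nsq x + K) ^ (-p)) := by ring
        _ ≤ (q/d) * (nsq x + 1 + K) ^ (-p) := by gcongr; exact pow_super hK3 hn hp0.le
        _ = (nsq x + 1 + K) ^ (-q-2) * (q / d * (nsq x + 1 + K)) := by
            rw [show -p = -q-2+1 by rw [hp, hq]; ring, Real.rpow_add_one hs.ne']; ring
        _ ≤ _ := by
            gcongr
            have h3 : q / d * (1 + K) ≤ q * (1+K)/2 := by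
              have : q / d ≤ q / 2 := by gcongr; linarith
              nlinarith
            have h4 : 0 ≤ q / d * nsq x := by positivity
            have : q * (2/d) * nsq x = 2 * (q / d * nsq x) := by ring
            nlinarith
    linarith

noncomputable def KK (d : ℕ) : ℝ := if h : 5 ≤ d then (exK h).choose else 3

noncomputable def ff (x : V d) : ℝ := (nsq x + KK d) ^ (-((d:ℝ)-2)/2)
noncomputable def ff1 (x : V d) : ℝ := (nsq x + KK d) ^ (-((d:ℝ)-4)/2)

lemma KK_ge (hd : 5 ≤ d) : 3 ≤ KK d := by
  unfold KK; rw [dif_pos hd]; exact (exK hd).choose_spec.1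

lemma ff_super (hd : 5 ≤ d) : ∃ c : ℝ, 0 < c ∧ ∀ x : V d,
    (c * dl 0 x + avg ff x ≤ ff x) ∧ (c * ff x + avg ff1 x ≤ ff1 x) := by
  have := (exK hd).choose_spec.2
  have e : KK d = (exK hd).choose := by unfold KK; rw [dif_pos hd]
  unfold ff ff1
  rw [e]; exact this

lemma ff_pos (hd : 5 ≤ d) (x : V d) : 0 < ff x :=
  Real.rpow_pos_of_pos (by linarith [nsq_nonneg x, KK_ge hd]) _
lemma ff1_pos (hd : 5 ≤ d) (x : V d) : 0 < ff1 x :=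
  Real.rpow_pos_of_pos (by linarith [nsq_nonneg x, KK_ge hd]) _

lemma ff_sub_comm (x y : V d) : ff (x - y) = ff (y - x) := by unfold ff; rw [nsq_sub_comm]

lemma dl_nonneg (y x : V d) : 0 ≤ dl y x := by unfold dl; split_ifs <;> norm_num

lemma dl_sub (y x : V d) : dl 0 (x - y) = dl y x := by simp [dl, sub_eq_zero]

lemma green_facts (hd : 5 ≤ d) : ∃ C : ℝ, 0 < C ∧ ∀ (U : Set (V d)) (y x : V d),
    Summable (fun t => qk U (dl y) t x) ∧ Green U y x ≤ C * ff (x - y) := by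
  obtain ⟨c, hc, h⟩ := ff_super (d := d) hd
  have key : ∀ (U : Set (V d)) (y : V d), ∀ x ∈ U, dl y x + avg (fun z => c⁻¹ * ff (z - y)) x ≤ c⁻¹ * ff (x - y) := by
    intro U y x _
    rw [avg_smul, avg_shift]
    have := (h (x - y)).1
    rw [dl_sub] at this
    have h2 := mul_le_mul_of_nonneg_left this (inv_nonneg.2 hc.le)
    rw [mul_add, ← mul_assoc, inv_mul_cancel₀ hc.ne', one_mul] at h2
    exact h2
  have hφ : ∀ y z : V d, 0 ≤ c⁻¹ * ff (z - y) := fun y z => by have := ff_pos hd (z-y); positivity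
  exact ⟨c⁻¹, by positivity, fun U y x => ⟨qk_summable (dl_nonneg y) (hφ y) (key U y) x,
    GF_le (dl_nonneg y) (hφ y) (key U y) x⟩⟩

lemma green_summable (hd : 5 ≤ d) (U : Set (V d)) (y x : V d) : Summable (fun t => qk U (dl y) t x) := by
  obtain ⟨C, _, h⟩ := green_facts (d := d) hd
  exact (h U y x).1

lemma green_eq (hd : 5 ≤ d) {U : Set (V d)} {y x : V d} (hx : x ∈ U) :
    Green U y x = dl y x + avg (Green U y) x := GF_eq (green_summable hd U y) hx

lemma green_nonneg (U : Set (V d)) (y x : V d) : 0 ≤ Green U y x := GF_nonneg (dl_nonneg y) x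
lemma green_off {U : Set (V d)} {y x : V d} (hx : x ∉ U) : Green U y x = 0 := GF_off hx

lemma green_sum_le (hd : 5 ≤ d) {U : Set (V d)} {S : Finset (V d)} {F φ : V d → ℝ} (hF : ∀ x, 0 ≤ F x) (hφ : ∀ x, 0 ≤ φ x)
    (h : ∀ x ∈ U, F x + avg φ x ≤ φ x) (x : V d) : ∑ y ∈ S, F y * Green U y x ≤ φ x := by
  have e : ∑ y ∈ S, F y * Green U y x = GF U (fun z => ∑ y ∈ S, F y * dl y z) x := by
    unfold GF
    simp_rw [qk_lin]
    rw [Summable.tsum_finsetSum (fun y _ => (green_summable hd U y x).mul_left _)]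
    simp_rw [tsum_mul_left]; rfl
  have e2 : ∀ z, ∑ y ∈ S, F y * dl y z = if z ∈ S then F z else 0 := by
    intro z; simp [dl]
  rw [e]
  refine GF_le ?_ hφ ?_ x
  · intro z; rw [e2]; split_ifs; exacts [hF z, le_rfl]
  · intro z hz; rw [e2]
    refine le_trans ?_ (h z hz)
    gcongr
    split_ifs; exacts [le_rfl, hF z]

lemma green_conv (hd : 5 ≤ d) : ∃ C : ℝ, 0 < C ∧ ∀ (U : Set (V d)) (S : Finset (V d)) (x v : V d),
    ∑ y ∈ S, ff (y - v) * Green U y x ≤ C * ff1 (x - v) := by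
  obtain ⟨c, hc, h⟩ := ff_super (d := d) hd
  refine ⟨c⁻¹, by positivity, fun U S x v => ?_⟩
  refine green_sum_le hd (fun y => (ff_pos hd _).le) (φ := fun x => c⁻¹ * ff1 (x - v))
    (fun y => by have := ff1_pos hd (y-v); positivity) ?_ x
  intro x _
  rw [avg_smul, avg_shift]
  have := (h (x - v)).2
  have h2 := mul_le_mul_of_nonneg_left this (inv_nonneg.2 hc.le)
  rw [mul_add, ← mul_assoc, inv_mul_cancel₀ hc.ne', one_mul] at h2
  exact h2

lemma maxprin (hd : 0 < d) {Λ : Set (V d)} (hfin : Λ.Finite) {u : V d → ℝ} (h1 : ∀ x ∈ Λ, u x ≤ avg u x)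
    (h2 : ∀ x ∉ Λ, (∃ i, x + eV i ∈ Λ ∨ x - eV i ∈ Λ) → u x ≤ 0) : ∀ x ∈ Λ, u x ≤ 0 := by
  by_contra! hcon
  obtain ⟨x0, hx0, hpos⟩ := hcon
  obtain ⟨x1, hx1, hmax⟩ := Set.exists_max_image Λ u hfin ⟨x0, hx0⟩
  let Λ' := {x ∈ Λ | u x = u x1}
  let j : Fin d := ⟨0, hd⟩
  obtain ⟨x2, ⟨hx2, hux2⟩, hmax2⟩ := Set.exists_max_image Λ' (fun x => x j) (hfin.subset (Set.sep_subset _ _)) ⟨x1, hx1, rfl⟩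
  have hM : 0 < u x1 := lt_of_lt_of_le hpos (hmax x0 hx0)
  have hle : ∀ i, u (x2 + eV i) ≤ u x1 ∧ u (x2 - eV i) ≤ u x1 := by
    intro i; constructor
    · by_cases h : x2 + eV i ∈ Λ
      · exact hmax _ h
      · exact (h2 _ h ⟨i, Or.inr (by simpa using hx2)⟩).trans hM.le
    · by_cases h : x2 - eV i ∈ Λ
      · exact hmax _ h
      · exact (h2 _ h ⟨i, Or.inl (by simpa using hx2)⟩).trans hM.le
  have hlt : u (x2 + eV j) < u x1 := by
    by_cases h : x2 + eV j ∈ Λ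
    · refine lt_of_le_of_ne (hle j).1 fun he => ?_
      have := hmax2 _ ⟨h, he⟩
      simp [eV] at this
    · exact lt_of_le_of_lt (h2 _ h ⟨j, Or.inr (by simpa using hx2)⟩) hM
  have : avg u x2 < u x1 := by
    unfold avg
    have hdR : (0:ℝ) < d := by exact_mod_cast hd
    rw [div_lt_iff₀ (by positivity)]
    calc _ < ∑ i : Fin d, (u x1 + u x1) := by
          apply Finset.sum_lt_sum
          · exact fun i _ => add_le_add (hle i).1 (hle i).2
          · exact ⟨j, Finset.mem_univ _, add_lt_add_of_lt_of_le hlt (hle j).2⟩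
      _ = _ := by simp; ring
  linarith [h1 x2 hx2]

lemma le_avg_mul (hd : 0 < d) {h : V d → ℝ} (h0 : ∀ x, 0 ≤ h x) (x : V d) (i : Fin d) :
    h (x + eV i) ≤ (2 * d) * avg h x ∧ h (x - eV i) ≤ (2 * d) * avg h x := by
  have hdR : (0:ℝ) < d := by exact_mod_cast hd
  have e : (2 * d) * avg h x = ∑ i, (h (x + eV i) + h (x - eV i)) := by unfold avg; field_simp
  have := Finset.single_le_sum (f := fun i => h (x + eV i) + h (x - eV i)) (fun i _ => add_nonneg (h0 _) (h0 _)) (Finset.mem_univ i)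
  rw [e]
  constructor <;> linarith [h0 (x + eV i), h0 (x - eV i)]

lemma triv_harnack (hd : 0 < d) {h : V d → ℝ} (h0 : ∀ x, 0 ≤ h x) (y : V d) (n : ℕ) : ∀ x : V d,
    ∑ i, (x i - y i).natAbs = n → (∀ q : V d, (∀ i, q i ∈ Set.uIcc (x i) (y i)) → avg h q ≤ h q) →
    h y ≤ (2 * d : ℝ) ^ n * h x := by
  induction n with
  | zero =>
    intro x hx _
    have : x = y := by
      ext i
      have := (Finset.sum_eq_zero_iff.1 hx) i (Finset.mem_univ i)
      omega
    simp [this]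
  | succ n ih =>
    intro x hx hq
    obtain ⟨i, hi⟩ : ∃ i, x i ≠ y i := by
      by_contra! hc
      simp [hc] at hx
    have hav : avg h x ≤ h x := hq x fun i => by simp
    have main : ∀ x' : V d, (∀ j, j ≠ i → x' j = x j) → (x' i - y i).natAbs + 1 = (x i - y i).natAbs →
        x' i ∈ Set.uIcc (x i) (y i) → h x' ≤ (2 * d) * avg h x → h y ≤ (2 * d : ℝ) ^ (n+1) * h x := by
      intro x' h1 h2 h3 h4
      have s1 : ∑ j, (x' j - y j).natAbs = n := by
        rw [← Finset.add_sum_erase _ _ (Finset.mem_univ i)] at hx ⊢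
        have : ∑ j ∈ Finset.univ.erase i, (x' j - y j).natAbs = ∑ j ∈ Finset.univ.erase i, (x j - y j).natAbs :=
          Finset.sum_congr rfl fun j hj => by rw [h1 j (Finset.ne_of_mem_erase hj)]
        omega
      have := ih x' s1 fun q hq' => hq q fun j => by
        by_cases hj : j = i
        · subst hj
          exact Set.uIcc_subset_uIcc_right h3 (hq' j)
        · rw [← h1 j hj]; exact hq' j
      calc h y ≤ (2 * d : ℝ) ^ n * h x' := this
        _ ≤ (2 * d : ℝ) ^ n * ((2 * d) * h x) := by
            have : (2 * d : ℝ) * avg h x ≤ (2 * d) * h x := by gcongr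
            gcongr; linarith
        _ = _ := by ring
    have ha := le_avg_mul hd h0 x i
    rcases lt_or_gt_of_ne hi with hlt | hgt
    · refine main (x + eV i) (fun j hj => by simp [eV, hj]) ?_ ?_ ha.1
      · simp [eV]; omega
      · simp [eV, Set.mem_uIcc]; omega
    · refine main (x - eV i) (fun j hj => by simp [eV, hj]) ?_ ?_ ha.2
      · simp [eV]; omega
      · simp [eV, Set.mem_uIcc]; omega

lemma natAbs_sum_le_nsq (x y : V d) : ((∑ i, (x i - y i).natAbs : ℕ) : ℝ) ≤ nsq (x - y) := by
  unfold nsq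
  push_cast
  apply Finset.sum_le_sum
  intro i _
  have : (((x i - y i).natAbs : ℤ)) ≤ (x i - y i) ^ 2 := by
    rw [Int.natCast_natAbs, ← sq_abs]
    rcases (abs_nonneg (x i - y i)).eq_or_lt with h | h
    · rw [← h]; norm_num
    · nlinarith
  have h2 : ((((x i - y i).natAbs : ℤ)) : ℝ) ≤ (((x i - y i) ^ 2 : ℤ) : ℝ) := by exact_mod_cast this
  simpa using h2

lemma finite_nsq (w : V d) (S : ℝ) : {x : V d | nsq (x - w) < S}.Finite := by
  apply (Set.finite_Icc (fun i => w i - ⌈|S|⌉ - 1) (fun i => w i + ⌈|S|⌉ + 1)).subset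
  intro x hx
  have key : ∀ i, |x i - w i| ≤ ⌈|S|⌉ := by
    intro i
    have h1 : ((x - w) i : ℝ) ^ 2 ≤ nsq (x-w) := sq_le_nsq _ i
    have h2 : ((|x i - w i| : ℤ) : ℝ) ≤ |S| := by
      have h3 : (|x i - w i|) ≤ (x i - w i)^2 := by
        rw [← sq_abs]
        rcases (abs_nonneg (x i - w i)).eq_or_lt with h | h
        · rw [← h]; norm_num
        · nlinarith
      have h4 : ((|x i - w i| : ℤ) : ℝ) ≤ (((x i - w i)^2 : ℤ) : ℝ) := by exact_mod_cast h3
      push_cast at h1 h4 ⊢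
      have : nsq (x - w) < S := hx
      simp at h1
      linarith [le_abs_self S]
    exact_mod_cast h2.trans (Int.le_ceil _)
  rw [Set.mem_Icc, Pi.le_def, Pi.le_def]
  constructor <;> intro i <;> have := abs_le.1 (key i) <;> omega

lemma green_lower (hd : 5 ≤ d) : ∃ c S0 : ℝ, 0 < c ∧ 1 ≤ S0 ∧ ∀ S ≥ S0, ∀ (U : Set (V d)) (w : V d),
    (∀ x, nsq (x - w) < S → x ∈ U) → ∀ x, nsq (x - w) ≤ S / 4 → c * S ^ (-((d:ℝ)-2)/2) ≤ Green U w x := by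
  have hd5 : (5:ℝ) ≤ d := by exact_mod_cast hd
  have hd0 : 0 < d := by omega
  set p := ((d:ℝ)-2)/2 with hp
  have hp0 : 0 < p := by rw [hp]; linarith
  have ep : -((d:ℝ)-2)/2 = -p := by rw [hp]; ring
  rw [ep]
  obtain ⟨K, hK, hsub⟩ := subharm (d := d) hd0 hp0 (by rw [hp]; ring)
  set c0 : ℝ := ((2 * d : ℝ) ^ ⌈4 * K⌉₊)⁻¹ with hc0
  have hc0p : 0 < c0 := by positivity
  have h42 : (0:ℝ) < (4:ℝ) ^ p - 2 ^ p := by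
    have := Real.rpow_lt_rpow (x := 2) (y := 4) (by norm_num) (by norm_num) hp0
    linarith
  refine ⟨min c0 (c0 * ((4:ℝ) ^ p - 2 ^ p)), 4 * K, by positivity, by linarith, fun S hS U w hU x hx => ?_⟩
  have hS0 : 0 < S := by linarith
  have near : ∀ x, nsq (x - w) < 4 * K → c0 ≤ Green U w x := by
    intro x hx
    have h1 : 1 ≤ Green U w w := by
      rw [green_eq hd (hU w (by simp [nsq]; linarith))]
      have := avg_nonneg (x := w) (green_nonneg U w)
      simp [dl]; linarith
    have h2 := triv_harnack hd0 (green_nonneg U w) w _ x rfl ?_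
    · have h3 : (2 * d : ℝ) ^ (∑ i, (x i - w i).natAbs) ≤ (2 * d : ℝ) ^ ⌈4 * K⌉₊ := by
        apply pow_le_pow_right₀ (by linarith)
        have := (natAbs_sum_le_nsq x w).trans (hx.le.trans (Nat.le_ceil _))
        exact_mod_cast this
      have h4 : 1 ≤ (2 * d : ℝ) ^ ⌈4 * K⌉₊ * Green U w x :=
        h1.trans (h2.trans (mul_le_mul_of_nonneg_right h3 (green_nonneg U w x)))
      rw [hc0, inv_le_iff_one_le_mul₀' (by positivity)]
      exact h4
    · intro q hq
      have : nsq (q - w) ≤ nsq (x - w) := by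
        unfold nsq
        apply Finset.sum_le_sum
        intro i _
        have := hq i
        have h2 : |(q - w) i| ≤ |(x-w) i| := by
          simp only [Pi.sub_apply]
          rw [abs_le]
          rcases Set.mem_uIcc.1 this with h | h
          · rw [abs_of_nonpos (by omega)]; omega
          · rw [abs_of_nonneg (by omega)]; omega
        exact sq_le_sq.2 (by exact_mod_cast h2)
      rw [green_eq hd (hU q (by linarith))]
      linarith [dl_nonneg w q]
  have hSp : 0 < S ^ (-p) := Real.rpow_pos_of_pos hS0 _
  by_cases hx4 : nsq (x - w) < 4 * K
  · have h1 : S ^ (-p) ≤ 1 := Real.rpow_le_one_of_one_le_of_nonpos (by linarith) (by linarith)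
    calc _ ≤ c0 * 1 := by gcongr; exact min_le_left _ _
      _ ≤ _ := by rw [mul_one]; exact near x hx4
  push Not at hx4
  let Λ : Set (V d) := {x | 4 * K ≤ nsq (x - w) ∧ nsq (x - w) < S}
  have hΛ : Λ.Finite := (finite_nsq w S).subset fun x hx => hx.2
  set ψ : V d → ℝ := fun x => (nsq (x - w) + -K) ^ (-p) with hψ
  have hmp := maxprin (d := d) hd0 hΛ (u := fun x => c0 * (ψ x - (S - K) ^ (-p)) - Green U w x) ?_ ?_ x ⟨hx4, by linarith⟩
  · have hψx : S ^ (-p) * ((4:ℝ)^p - 2^p) ≤ ψ x - (S-K)^(-p) := by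
      have a1 : (S/4) ^ (-p) ≤ ψ x := Real.rpow_le_rpow_of_nonpos (by linarith) (by linarith) (by linarith)
      have a2 : (S-K) ^ (-p) ≤ (S/2) ^ (-p) := Real.rpow_le_rpow_of_nonpos (by linarith) (by linarith) (by linarith)
      have a3 : (S/4) ^ (-p) = S ^ (-p) * 4 ^ p := by
        rw [Real.div_rpow hS0.le (by norm_num), Real.rpow_neg (by norm_num : (0:ℝ) ≤ 4)]; simp
      have a4 : (S/2) ^ (-p) = S ^ (-p) * 2 ^ p := by
        rw [Real.div_rpow hS0.le (by norm_num), Real.rpow_neg (by norm_num : (0:ℝ) ≤ 2)]; simp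
      rw [mul_sub]; linarith
    have := mul_le_mul_of_nonneg_left hψx hc0p.le
    calc _ ≤ (c0 * ((4:ℝ) ^ p - 2 ^ p)) * S ^ (-p) := by gcongr; exact min_le_right _ _
      _ = c0 * (S ^ (-p) * ((4:ℝ)^p - 2^p)) := by ring
      _ ≤ _ := by linarith
  · intro x hx
    have hxw : x ≠ w := by
      rintro rfl
      have := hx.1
      simp [nsq] at this; linarith
    have e1 := green_eq hd (y := w) (hU x hx.2)
    simp only [dl, hxw, if_false, zero_add] at e1
    have e2 : avg (fun x => c0 * (ψ x - (S - K) ^ (-p)) - Green U w x) x =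
        c0 * (avg ψ x - (S-K)^(-p)) - avg (Green U w) x := by
      rw [avg_sub, avg_smul, avg_sub, avg_const hd0]
    rw [e2, ← e1]
    have e3 : ψ x ≤ avg ψ x := by
      rw [hψ, avg_shift (fun y => (nsq y + -K) ^ (-p))]
      exact hsub _ (by linarith [hx.1])
    gcongr
  · rintro x hx ⟨i, hi⟩
    by_cases hS' : S ≤ nsq (x - w)
    · have : ψ x ≤ (S - K) ^ (-p) := Real.rpow_le_rpow_of_nonpos (by linarith) (by linarith) (by linarith)
      have := green_nonneg U w x
      nlinarith
    · have hlt : nsq (x - w) < 4 * K := by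
        by_contra hc
        exact hx ⟨not_lt.1 hc, not_le.1 hS'⟩
      have hsq := sq_le_nsq (x - w) i
      have hge : 4 * K ≤ 2 * nsq (x - w) + 2 := by
        rcases hi with hi | hi
        · have := hi.1
          rw [show x + eV i - w = x - w + eV i by abel, nsq_add_eV] at this
          nlinarith [sq_nonneg (((x-w) i : ℝ) - 1)]
        · have := hi.1
          rw [show x - eV i - w = x - w - eV i by abel, nsq_sub_eV] at this
          nlinarith [sq_nonneg (((x-w) i : ℝ) + 1)]
      have h1 : ψ x ≤ 1 := Real.rpow_le_one_of_one_le_of_nonpos (by linarith) (by linarith)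
      have h2 := near x hlt
      have h3 : 0 ≤ (S - K) ^ (-p) := Real.rpow_nonneg (by linarith) _
      have : c0 * (ψ x - (S-K)^(-p)) ≤ c0 * 1 := by gcongr; linarith
      linarith

end Green

end

section
section Harnack

noncomputable def red (h : V d → ℝ) (W Λ : Set (V d)) : ℕ → V d → ℝ
  | 0 => fun _ => 0
  | t+1 => fun x => if x ∈ W then h x else if x ∈ Λ then avg (red h W Λ t) x else 0

lemma tendsto_avg {f : ℕ → V d → ℝ} {g : V d → ℝ} (h : ∀ x, Filter.Tendsto (fun t => f t x) Filter.atTop (nhds (g x)))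
    (x : V d) : Filter.Tendsto (fun t => avg (f t) x) Filter.atTop (nhds (avg g x)) := by
  unfold avg
  exact (tendsto_finsetSum _ fun i _ => (h _).add (h _)).div_const _

lemma reduite {h : V d → ℝ} (h0 : ∀ x, 0 ≤ h x) {W Λ : Set (V d)} (hW : W ⊆ Λ)
    (hh : ∀ x ∈ Λ, h x = avg h x) : ∃ r : V d → ℝ, (∀ x ∈ W, r x = h x) ∧ (∀ x ∈ Λ, x ∉ W → r x = avg r x) ∧
      (∀ x ∉ Λ, r x = 0) ∧ (∀ x ∈ W, avg r x ≤ r x) := by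
  have hle : ∀ t x, red h W Λ t x ≤ h x := by
    intro t; induction t with
    | zero => exact h0
    | succ t ih =>
      intro x; simp only [red]
      split_ifs with h1 h2
      · exact le_rfl
      · rw [hh x h2]; exact avg_mono ih
      · exact h0 x
  have hnn : ∀ t x, 0 ≤ red h W Λ t x := by
    intro t; induction t with
    | zero => exact fun _ => le_rfl
    | succ t ih =>
      intro x; simp only [red]
      split_ifs with h1 h2
      exacts [h0 x, avg_nonneg ih, le_rfl]
  have hmono : ∀ t x, red h W Λ t x ≤ red h W Λ (t+1) x := by
    intro t; induction t with
    | zero => exact hnn 1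
    | succ t ih =>
      intro x
      rw [red, red]; beta_reduce
      split_ifs with h1 h2
      exacts [le_rfl, avg_mono ih, le_rfl]
  have hlim : ∀ x, ∃ r, Filter.Tendsto (fun t => red h W Λ t x) Filter.atTop (nhds r) := fun x =>
    ⟨_, tendsto_atTop_ciSup (monotone_nat_of_le_succ fun t => hmono t x) ⟨h x, by rintro _ ⟨t, rfl⟩; exact hle t x⟩⟩
  choose r hr using hlim
  have hr' : ∀ x, Filter.Tendsto (fun t => red h W Λ (t+1) x) Filter.atTop (nhds (r x)) := fun x =>
    (Filter.tendsto_add_atTop_iff_nat 1).2 (hr x)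
  have hrW : ∀ x ∈ W, r x = h x := fun x hx => by
    have := hr' x
    simp only [red, hx, if_true] at this
    exact tendsto_nhds_unique this tendsto_const_nhds
  refine ⟨r, hrW, fun x hx hxW => ?_, fun x hx => ?_, fun x hx => ?_⟩
  · have := hr' x
    simp only [red, hx, hxW, if_true, if_false] at this
    exact tendsto_nhds_unique this (tendsto_avg hr x)
  · have := hr' x
    have hxW : x ∉ W := fun h => hx (hW h)
    simp only [red, hx, hxW, if_false] at this
    exact tendsto_nhds_unique this tendsto_const_nhds
  · rw [hrW x hx, hh x (hW hx)]
    exact avg_mono fun y => le_of_tendsto (hr y) (Filter.Eventually.of_forall fun t => hle t y)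

lemma avg_sum_mul (S : Finset (V d)) (q : V d → ℝ) (G : V d → V d → ℝ) (x : V d) :
    avg (fun z => ∑ w ∈ S, q w * G w z) x = ∑ w ∈ S, q w * avg (G w) x := by
  rw [avg_sum]; simp_rw [avg_smul]

lemma green_repr (hd : 5 ≤ d) {r : V d → ℝ} {W : Finset (V d)} {Λ : Set (V d)} (hΛ : Λ.Finite) (_hW : ↑W ⊆ Λ)
    (h1 : ∀ x ∈ Λ, x ∉ W → r x = avg r x) (h2 : ∀ x ∉ Λ, r x = 0) (x : V d) (hx : x ∈ Λ) :
    r x = ∑ w ∈ W, (r w - avg r w) * Green Λ w x := by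
  have hd0 : 0 < d := by omega
  set R : V d → ℝ := fun z => ∑ w ∈ W, (r w - avg r w) * Green Λ w z with hR
  have hR1 : ∀ x ∈ Λ, R x - avg R x = r x - avg r x := by
    intro x hx
    rw [hR, avg_sum_mul, ← Finset.sum_sub_distrib]
    have : ∀ w ∈ W, (r w - avg r w) * Green Λ w x - (r w - avg r w) * avg (Green Λ w) x
        = (r w - avg r w) * dl w x := by
      intro w _
      rw [green_eq hd hx]; ring
    rw [Finset.sum_congr rfl this]
    by_cases hxW : x ∈ W
    · simp [dl, hxW]
    · simp [dl, hxW, sub_eq_zero.2 (h1 x hx hxW)]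
  have hR2 : ∀ x ∉ Λ, R x = 0 := fun x hx => by simp [hR, green_off hx]
  have a := maxprin hd0 hΛ (u := fun z => r z - R z) (fun x hx => by rw [avg_sub]; linarith [hR1 x hx])
    (fun x hx _ => by simp [h2 x hx, hR2 x hx]) x hx
  have b := maxprin hd0 hΛ (u := fun z => R z - r z) (fun x hx => by rw [avg_sub]; linarith [hR1 x hx])
    (fun x hx _ => by simp [h2 x hx, hR2 x hx]) x hx
  show r x = R x
  linarith

lemma nsq_nbr (x : V d) (i : Fin d) : nsq (x + eV i) ≤ 2 * nsq x + 2 ∧ nsq (x - eV i) ≤ 2 * nsq x + 2 := by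
  rw [nsq_add_eV, nsq_sub_eV]
  have := sq_le_nsq x i
  constructor
  · nlinarith [sq_nonneg ((x i : ℝ) - 1)]
  · nlinarith [sq_nonneg ((x i : ℝ) + 1)]

lemma nsq_tri (x y z : V d) : nsq (x - z) ≤ 2 * nsq (x - y) + 2 * nsq (y - z) := by
  have := nsq_add_le (x - y) (y - z)
  rwa [sub_add_sub_cancel] at this

lemma harnack_ball (hd : 5 ≤ d) : ∃ C S0 : ℝ, 1 ≤ C ∧ 1 ≤ S0 ∧ ∀ S ≥ S0, ∀ (c : V d) (h : V d → ℝ), (∀ x, 0 ≤ h x) →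
    (∀ x, nsq (x - c) < S → h x = avg h x) → ∀ x y, nsq (x - c) ≤ S / 1024 → nsq (y - c) ≤ S / 1024 → h x ≤ C * h y := by
  obtain ⟨C1, hC1, hG1⟩ := green_facts (d := d) hd
  obtain ⟨c2, S2, hc2, hS2, hG2⟩ := green_lower (d := d) hd
  have hd5 : (5:ℝ) ≤ d := by exact_mod_cast hd
  set p := -((d:ℝ)-2)/2 with hp
  have hp0 : p < 0 := by rw [hp]; linarith
  set C := C1 * 1024 ^ (-p) / (c2 * 4 ^ (-p)) with hC
  have hCp : 0 < C := by positivity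
  refine ⟨max C 1, max 512 (4 * S2), le_max_right _ _, le_trans (by norm_num) (le_max_left _ _), fun S hS c h h0 hh x y hx hy => ?_⟩
  have hS5 : 512 ≤ S := (le_max_left _ _).trans hS
  have hS4 : 4 * S2 ≤ S := (le_max_right _ _).trans hS
  set Λ : Set (V d) := {x | nsq (x - c) < S} with hΛ
  have hfin : Λ.Finite := finite_nsq c S
  have hWfin : {x : V d | nsq (x - c) ≤ S/64}.Finite := (finite_nsq c S).subset fun x hx => by
    simp only [Set.mem_ofPred_eq] at hx ⊢; linarith
  set W := hWfin.toFinset with hWdef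
  have hWm : ∀ x, x ∈ W ↔ nsq (x - c) ≤ S/64 := by intro x; rw [hWdef]; simp
  have hWΛ : (W : Set (V d)) ⊆ Λ := by
    intro x hx
    have := (hWm x).1 hx
    simp only [hΛ, Set.mem_ofPred_eq]; linarith
  obtain ⟨r, hr1, hr2, hr3, hr4⟩ := reduite h0 hWΛ hh
  have hrep := green_repr hd hfin hWΛ hr2 hr3
  have hxW : x ∈ W := (hWm x).2 (by linarith)
  have hyW : y ∈ W := (hWm y).2 (by linarith)
  have hS0 : 0 < S := by linarith
  have main : h x ≤ C * h y := by
    rw [← hr1 x hxW, ← hr1 y hyW, hrep x (hWΛ hxW), hrep y (hWΛ hyW), Finset.mul_sum]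
    apply Finset.sum_le_sum
    intro w hw
    by_cases hint : ∀ i, w + eV i ∈ W ∧ w - eV i ∈ W
    · have : r w - avg r w = 0 := by
        rw [hr1 w hw, hh w (hWΛ hw), sub_eq_zero]
        exact avg_congr fun i => ⟨(hr1 _ (hint i).1).symm, (hr1 _ (hint i).2).symm⟩
      simp [this]
    · have hq := hr4 w hw
      have hw1 := (hWm w).1 hw
      have hw2 : S/256 ≤ nsq (w - c) := by
        push Not at hint
        obtain ⟨i, hi⟩ := hint
        have hn := nsq_nbr (w - c) i
        by_cases h1 : w + eV i ∈ W
        · have h2 : ¬ _ := mt (hWm _).2 (hi h1)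
          rw [show w - eV i - c = w - c - eV i by abel] at h2
          linarith [hn.2]
        · have h2 : ¬ _ := mt (hWm _).2 h1
          rw [show w + eV i - c = w - c + eV i by abel] at h2
          linarith [hn.1]
      have t1 := nsq_tri w x c
      have t2 := nsq_tri y c w
      rw [nsq_sub_comm c w] at t2
      rw [nsq_sub_comm w x] at t1
      have u1 : Green Λ w x ≤ C1 * (S/1024) ^ p := by
        refine (hG1 Λ w x).2.trans ?_
        gcongr
        exact Real.rpow_le_rpow_of_nonpos (by linarith) (by linarith [KK_ge hd]) hp0.le
      have u2 : c2 * (S/4) ^ p ≤ Green Λ w y := by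
        apply hG2 (S/4) (by linarith) Λ w _ y (by linarith)
        intro z hz
        have := nsq_tri z w c
        simp only [hΛ, Set.mem_ofPred_eq]; linarith
      have e1 : (S/1024) ^ p = S ^ p * 1024 ^ (-p) := by
        rw [Real.div_rpow hS0.le (by norm_num), Real.rpow_neg (by norm_num)]; rfl
      have e2 : (S/4) ^ p = S ^ p * 4 ^ (-p) := by
        rw [Real.div_rpow hS0.le (by norm_num), Real.rpow_neg (by norm_num)]; rfl
      have hSp : 0 < S ^ p := Real.rpow_pos_of_pos hS0 _
      have e3 : C1 * (S/1024) ^ p = C * (c2 * (S/4) ^ p) := by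
        rw [e1, e2, hC]; field_simp
      have : Green Λ w x ≤ C * Green Λ w y := by
        rw [e3] at u1; exact u1.trans (by gcongr)
      calc _ ≤ (r w - avg r w) * (C * Green Λ w y) := mul_le_mul_of_nonneg_left this (by linarith)
        _ = _ := by ring
  exact main.trans (mul_le_mul_of_nonneg_right (le_max_left _ _) (h0 y))

lemma interp_bounds (a : ℤ) (k M : ℕ) (hk : k < M) :
    |((a * (k+1 : ℕ) / M : ℤ) : ℝ) - ((a * k / M : ℤ) : ℝ)| ≤ |(a:ℝ)| / M + 1 := by
  have hM : (0:ℝ) < M := by exact_mod_cast (by omega : 0 < M)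
  have f : ∀ b : ℤ, ((b / M : ℤ) : ℝ) ≤ (b:ℝ)/M ∧ (b:ℝ)/M - 1 < ((b / M : ℤ) : ℝ) := by
    intro b
    have e : ((b / M : ℤ)) = ⌊(b:ℝ)/M⌋ := by
      have := Int.floor_div_natCast (b:ℝ) M
      rw [this]; simp
    rw [e]
    exact ⟨Int.floor_le _, Int.sub_one_lt_floor _⟩
  have h1 := f (a * (k+1 : ℕ))
  have h2 := f (a * k)
  have e : ((a * (k+1:ℕ) : ℤ) : ℝ) / M - ((a * k : ℤ) : ℝ) / M = (a:ℝ) / M := by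
    push_cast; field_simp; ring
  have h3 : |(a:ℝ)/M| = |(a:ℝ)|/M := by rw [abs_div, abs_of_pos hM]
  have h4 := abs_le.1 (le_refl |(a:ℝ)/M|)
  rw [h3] at h4
  rw [abs_le]
  constructor <;> linarith

lemma harnack_chain (hd : 5 ≤ d) (A : ℝ) : ∃ C S0 : ℝ, 1 ≤ C ∧ 1 ≤ S0 ∧ ∀ S ≥ S0, ∀ (h : V d → ℝ), (∀ x, 0 ≤ h x) →
    ∀ x y : V d, nsq (x - y) ≤ A * S →
    (∀ q : V d, (∀ i, q i ∈ Set.uIcc (x i) (y i)) → ∀ z, nsq (z - q) < S → h z = avg h z) → h x ≤ C * h y := by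
  obtain ⟨C, S0, hC, hS0, H⟩ := harnack_ball (d := d) hd
  obtain ⟨M, hM⟩ := exists_nat_ge (4096 * |A| + 1)
  have hM1 : (1:ℝ) ≤ M := by linarith [abs_nonneg A]
  have hMn : 0 < M := by exact_mod_cast (by linarith : (0:ℝ) < M)
  refine ⟨C ^ M, max S0 (4096 * d), one_le_pow₀ hC, hS0.trans (le_max_left _ _), fun S hS h h0 x y hxy hh => ?_⟩
  have hS1 : S0 ≤ S := (le_max_left _ _).trans hS
  have hS2 : 4096 * d ≤ S := (le_max_right _ _).trans hS
  have hSp : 0 < S := by linarith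
  let xk : ℕ → V d := fun k i => x i + (y i - x i) * k / M
  have hull : ∀ k ≤ M, ∀ i, xk k i ∈ Set.uIcc (x i) (y i) := by
    intro k hk i
    have hk' : (k:ℤ) ≤ M := by exact_mod_cast hk
    have hM' : (0:ℤ) < M := by exact_mod_cast hMn
    simp only [xk, Set.mem_uIcc]
    rcases le_total (x i) (y i) with hle | hle
    · left
      have a1 : 0 ≤ (y i - x i) * k / M := Int.ediv_nonneg (mul_nonneg (by omega) (by omega)) hM'.le
      have a2 : (y i - x i) * k / M ≤ y i - x i := by
        apply Int.ediv_le_of_le_mul hM'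
        exact mul_le_mul_of_nonneg_left hk' (by omega)
      omega
    · right
      have a1 : (y i - x i) * k / M ≤ 0 := by
        apply Int.ediv_le_of_le_mul hM'
        rw [zero_mul]
        exact mul_nonpos_of_nonpos_of_nonneg (by omega) (by omega)
      have a2 : y i - x i ≤ (y i - x i) * k / M := by
        apply Int.le_ediv_of_mul_le hM'
        exact mul_le_mul_of_nonpos_left hk' (by omega)
      omega
  have step : ∀ k < M, h (xk k) ≤ C * h (xk (k+1)) := by
    intro k hk
    apply H S hS1 (xk k) h h0 (hh _ (hull k hk.le)) (xk k) (xk (k+1))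
    · simp [nsq]; positivity
    · have : nsq (xk (k+1) - xk k) ≤ 2 * nsq (x - y) / M ^ 2 + 2 * d := by
        unfold nsq
        have : ∀ i, (((xk (k+1) - xk k) i : ℤ) : ℝ) ^ 2 ≤ 2 / M ^ 2 * ((x - y) i : ℝ) ^ 2 + 2 := by
          intro i
          have hb := interp_bounds (y i - x i) k M hk
          have e : (((xk (k+1) - xk k) i : ℤ) : ℝ) = (((y i - x i) * (k+1 : ℕ) / M : ℤ) : ℝ) - (((y i - x i) * k / M : ℤ) : ℝ) := by
            simp only [xk, Pi.sub_apply]; push_cast; ring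
          rw [e, ← sq_abs]
          have h2 : (|((y i - x i : ℤ) : ℝ)| / M) ^ 2 = 1 / M ^ 2 * ((x - y) i : ℝ) ^ 2 := by
            rw [div_pow, sq_abs]; simp; ring
          have h3 : 2 / (M:ℝ) ^ 2 * ((x - y) i : ℝ) ^ 2 = 2 * (1 / M ^ 2 * ((x - y) i : ℝ) ^ 2) := by ring
          rw [h3, ← h2]
          nlinarith [abs_nonneg ((((y i - x i) * (k+1 : ℕ) / M : ℤ) : ℝ) - (((y i - x i) * k / M : ℤ) : ℝ)),
            sq_nonneg (|((y i - x i : ℤ) : ℝ)| / M - 1)]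
        calc _ ≤ ∑ i, (2 / (M:ℝ) ^ 2 * ((x - y) i : ℝ) ^ 2 + 2) := Finset.sum_le_sum fun i _ => this i
          _ = _ := by rw [Finset.sum_add_distrib, ← Finset.mul_sum]; simp; ring
      refine this.trans ?_
      have h5 : 2 * nsq (x - y) / M ^ 2 ≤ S / 2048 := by
        rw [div_le_iff₀ (by positivity)]
        have : A * S ≤ |A| * S := mul_le_mul_of_nonneg_right (le_abs_self A) hSp.le
        have h6 : 4096 * |A| ≤ (M:ℝ) ^ 2 := by nlinarith [abs_nonneg A]
        have h7 := mul_le_mul_of_nonneg_right h6 hSp.le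
        linarith
      linarith
  have all : ∀ k ≤ M, h (xk 0) ≤ C ^ k * h (xk k) := by
    intro k
    induction k with
    | zero => intro _; simp
    | succ k ih =>
      intro hk
      calc _ ≤ C ^ k * h (xk k) := ih (by omega)
        _ ≤ C ^ k * (C * h (xk (k+1))) := by gcongr; exact step k (by omega)
        _ = _ := by ring
  have e0 : xk 0 = x := by ext i; simp [xk]
  have eM : xk M = y := by
    ext i
    simp only [xk]
    rw [Int.mul_ediv_cancel _ (by exact_mod_cast hMn.ne')]; ring
  have := all M le_rfl
  rwa [e0, eM] at this

end Harnack

end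

section
section Walk

lemma adj_add (x : V d) (i : Fin d) : adj x (x + eV i) ∧ adj x (x - eV i) := by
  constructor <;> simp [adj, eV, Pi.single_apply, apply_ite abs]

lemma adj_iff {x y : V d} : adj x y ↔ ∃ i, y = x + eV i ∨ y = x - eV i := by
  constructor
  · intro h
    unfold adj at h
    obtain ⟨i, hi⟩ : ∃ i, x i ≠ y i := by
      by_contra! hc
      simp [hc] at h
    have h1 := Finset.add_sum_erase Finset.univ (fun i => |x i - y i|) (Finset.mem_univ i)
    beta_reduce at h1
    rw [h] at h1
    have hpos : 0 < |x i - y i| := abs_pos.2 (sub_ne_zero.2 hi)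
    have hnn : ∀ j ∈ Finset.univ.erase i, 0 ≤ |x j - y j| := fun j _ => abs_nonneg _
    have h0 : ∑ j ∈ Finset.univ.erase i, |x j - y j| = 0 := by
      have := Finset.sum_nonneg hnn
      omega
    have hz := (Finset.sum_eq_zero_iff_of_nonneg hnn).1 h0
    have hj : ∀ j, j ≠ i → x j = y j := fun j hj => by
      have := hz j (by simp [hj])
      rw [abs_eq_zero] at this; omega
    have h1' : |x i - y i| = 1 := by omega
    refine ⟨i, ?_⟩
    rcases (abs_eq (by norm_num)).1 h1' with h | h
    · right; ext j
      by_cases e : j = i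
      · subst e; simp [eV]; omega
      · simp [eV, e, hj j e]
    · left; ext j
      by_cases e : j = i
      · subst e; simp [eV]; omega
      · simp [eV, e, hj j e]
  · rintro ⟨i, rfl | rfl⟩
    exacts [(adj_add x i).1, (adj_add x i).2]

def sV (b : Fin d × Bool) : V d := if b.2 then eV b.1 else - eV b.1

lemma sV_inj : Function.Injective (sV (d := d)) := by
  rintro ⟨i, b⟩ ⟨j, b'⟩ h
  have h1 := congrFun h i
  have h2 := congrFun h j
  by_cases e : i = j
  · subst e
    cases b <;> cases b' <;> simp [sV, eV] at h1 ⊢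
  · exfalso
    have e' : j ≠ i := fun h => e h.symm
    cases b <;> cases b' <;> simp [sV, eV, Pi.single_apply, e] at h1

lemma adj_sV (x : V d) (b : Fin d × Bool) : adj x (x + sV b) := by
  rw [adj_iff]; refine ⟨b.1, ?_⟩
  unfold sV; split_ifs
  · left; rfl
  · right; abel

lemma adj_iff_sV {x y : V d} : adj x y ↔ ∃ b, y = x + sV b := by
  constructor
  · intro h
    obtain ⟨i, rfl | rfl⟩ := adj_iff.1 h
    · exact ⟨(i, true), by simp [sV]⟩
    · exact ⟨(i, false), by simp [sV]; abel⟩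
  · rintro ⟨b, rfl⟩; exact adj_sV x b

lemma avg_eq_sV (f : V d → ℝ) (x : V d) : avg f x = (∑ b, f (x + sV b)) / (2 * d) := by
  unfold avg; congr 1
  rw [Fintype.sum_prod_type]
  exact Finset.sum_congr rfl fun i _ => by simp [sV, sub_eq_add_neg]

def cyl (γ : ℕ → V d) (n : ℕ) : Set (ℕ → V d) := { ω | ∀ i ≤ n, ω i = γ i }

lemma meas_cyl (γ : ℕ → V d) (n : ℕ) : MeasurableSet (cyl γ n) := by
  have : cyl γ n = ⋂ i, ⋂ (_ : i ≤ n), (fun ω : ℕ → V d => ω i) ⁻¹' {γ i} := by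
    ext ω; simp [cyl]
  rw [this]
  exact MeasurableSet.iInter fun i => MeasurableSet.iInter fun _ => measurable_pi_apply i (measurableSet_singleton _)

lemma meas_at (j : ℕ) (S : Set (V d)) : MeasurableSet {ω : ℕ → V d | ω j ∈ S} :=
  measurable_pi_apply j (Set.to_countable S).measurableSet

lemma cyl_bad (hd : 0 < d) {μ : Measure (ℕ → V d)} {x : V d} (hμ : IsSRWLaw μ x) (n : ℕ) (γ : ℕ → V d)
    (hb : ¬ (γ 0 = x ∧ ∀ i < n, adj (γ i) (γ (i+1)))) : μ (cyl γ n) = 0 := by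
  have := hμ.1
  induction n with
  | zero =>
    have h1 : μ (cyl (fun _ => x) 0) = 1 := by
      have := hμ.2 0 (fun _ => x) rfl (by simp)
      rw [pow_zero] at this; exact this
    have h2 : cyl γ 0 ⊆ (cyl (fun _ => x) 0)ᶜ := by
      intro ω hω hω'
      apply hb
      refine ⟨?_, by simp⟩
      rw [← hω 0 le_rfl]; exact hω' 0 le_rfl
    refine measure_mono_null h2 ?_
    rw [measure_compl (meas_cyl _ _) (measure_ne_top _ _), h1]; simp
  | succ n ih =>
    by_cases hp : γ 0 = x ∧ ∀ i < n, adj (γ i) (γ (i+1))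
    · have hna : ¬ adj (γ n) (γ (n+1)) := by
        intro h; apply hb; refine ⟨hp.1, fun i hi => ?_⟩
        rcases Nat.lt_succ_iff_lt_or_eq.1 hi with h' | rfl
        exacts [hp.2 i h', h]
      let ext : Fin d × Bool → ℕ → V d := fun b i => if i ≤ n then γ i else γ n + sV b
      have hext : ∀ b, μ (cyl (ext b) (n+1)) = (2 * (d : ℝ≥0∞))⁻¹ ^ (n+1) := by
        intro b
        apply hμ.2
        · simp [ext, hp.1]
        · intro i hi
          rcases Nat.lt_succ_iff_lt_or_eq.1 hi with h' | rfl
          · simp only [ext, h'.le, Nat.succ_le_of_lt h', if_true]; exact hp.2 i h'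
          · simp [ext, adj_sV]
      have hcyl : μ (cyl γ n) = (2 * (d : ℝ≥0∞))⁻¹ ^ n := hμ.2 n γ hp.1 hp.2
      have hdisj : Pairwise (fun b b' => Disjoint (cyl (ext b) (n+1)) (cyl (ext b') (n+1))) := by
        intro b b' hbb
        rw [Set.disjoint_left]
        intro ω h1 h2
        have e1 := h1 (n+1) le_rfl
        have e2 := h2 (n+1) le_rfl
        simp only [ext, Nat.not_succ_le_self, if_false] at e1 e2
        exact hbb (sV_inj (add_left_cancel (e1.symm.trans e2)))
      have hU : μ (⋃ b, cyl (ext b) (n+1)) = μ (cyl γ n) := by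
        rw [measure_iUnion hdisj (fun b => meas_cyl _ _), tsum_fintype, hcyl]
        simp_rw [hext]
        simp only [Finset.sum_const, Finset.card_univ, Fintype.card_prod, Fintype.card_fin, Fintype.card_bool, nsmul_eq_mul]
        rw [pow_succ', ← mul_assoc]
        rw [show ((d * 2 : ℕ) : ℝ≥0∞) = 2 * d by push_cast; ring, ENNReal.mul_inv_cancel, one_mul]
        · have : (d : ℝ≥0∞) ≠ 0 := by exact_mod_cast hd.ne'
          simp [this]
        · exact ENNReal.mul_ne_top (by simp) (by simp)
      have hsub : (⋃ b, cyl (ext b) (n+1)) ⊆ cyl γ n := by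
        intro ω hω
        obtain ⟨b, hω⟩ := Set.mem_iUnion.1 hω
        intro i hi
        have := hω i (by omega)
        simpa [ext, hi] using this
      have h2 : cyl γ (n+1) ⊆ cyl γ n \ ⋃ b, cyl (ext b) (n+1) := by
        intro ω hω
        refine ⟨fun i hi => hω i (by omega), fun hc => ?_⟩
        obtain ⟨b, hc⟩ := Set.mem_iUnion.1 hc
        have e1 := hc (n+1) le_rfl
        simp only [ext, Nat.not_succ_le_self, if_false] at e1
        rw [hω (n+1) le_rfl] at e1
        exact hna (e1 ▸ adj_sV _ b)
      refine measure_mono_null h2 ?_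
      rw [measure_sdiff hsub (MeasurableSet.iUnion fun b => meas_cyl _ _).nullMeasurableSet (measure_ne_top _ _), hU]
      simp
    · exact measure_mono_null (show cyl γ (n+1) ⊆ cyl γ n from fun ω hω i hi => hω i (by omega)) (ih hp)

lemma srw_unique (hd : 0 < d) {μ ν : Measure (ℕ → V d)} {x : V d} (hμ : IsSRWLaw μ x) (hν : IsSRWLaw ν x) : μ = ν := by
  have := hμ.1
  have := hν.1
  let C : Set (Set (ℕ → V d)) := {s | ∃ γ n, s = cyl γ n}
  have hgen : (inferInstance : MeasurableSpace (ℕ → V d)) = MeasurableSpace.generateFrom C := by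
    apply le_antisymm
    · apply iSup_le
      intro j
      rw [← measurable_iff_comap_le]
      refine @measurable_to_countable' _ _ _ _ (MeasurableSpace.generateFrom C) _ fun v => ?_
      have : (fun ω : ℕ → V d => ω j) ⁻¹' {v} = ⋃ γ : Fin (j+1) → V d, ⋃ (_ : γ (Fin.last j) = v),
          cyl (fun i => if h : i < j+1 then γ ⟨i, h⟩ else 0) j := by
        ext ω
        simp only [Set.mem_preimage, Set.mem_singleton_iff, Set.mem_iUnion, cyl]
        constructor
        · intro h
          refine ⟨fun i => ω i, by simpa using h, fun i hi => ?_⟩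
          simp [Nat.lt_succ_of_le hi]
        · rintro ⟨γ, h1, h2⟩
          have := h2 j le_rfl
          simp only [Nat.lt_succ_self, dif_pos] at this
          rw [this, ← h1]; rfl
      rw [this]
      exact MeasurableSet.iUnion fun γ => MeasurableSet.iUnion fun _ => MeasurableSpace.measurableSet_generateFrom ⟨_, _, rfl⟩
    · apply MeasurableSpace.generateFrom_le
      rintro _ ⟨γ, n, rfl⟩
      exact meas_cyl γ n
  refine ext_of_generate_finite C hgen ?_ ?_ (by simp)
  · rintro _ ⟨γ, n, rfl⟩ _ ⟨γ', n', rfl⟩ ⟨ω, h1, h2⟩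
    refine ⟨ω, max n n', ?_⟩
    ext ω'
    constructor
    · rintro ⟨a1, a2⟩ i hi
      rcases le_max_iff.1 hi with h | h
      · rw [a1 i h, h1 i h]
      · rw [a2 i h, h2 i h]
    · intro a
      exact ⟨fun i hi => by rw [a i (hi.trans (le_max_left _ _)), h1 i hi],
        fun i hi => by rw [a i (hi.trans (le_max_right _ _)), h2 i hi]⟩
  · rintro _ ⟨γ, n, rfl⟩
    by_cases h : γ 0 = x ∧ ∀ i < n, adj (γ i) (γ (i+1))
    · exact (hμ.2 n γ h.1 h.2).trans (hν.2 n γ h.1 h.2).symm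
    · rw [cyl_bad hd hμ n γ h, cyl_bad hd hν n γ h]

noncomputable def Pm (μ : Measure (ℕ → V d)) (x : V d) : Measure (ℕ → V d) := μ.map (fun ω j => x + ω j)

lemma meas_shiftx (x : V d) : Measurable (fun (ω : ℕ → V d) (j : ℕ) => x + ω j) :=
  measurable_pi_lambda _ fun j => (measurable_of_countable (fun v : V d => x + v)).comp (measurable_pi_apply j)

lemma Pm_law {μ : Measure (ℕ → V d)} (hμ : IsSRWLaw μ 0) (x : V d) : IsSRWLaw (Pm μ x) x := by
  have := hμ.1
  refine ⟨Measure.isProbabilityMeasure_map (meas_shiftx x).aemeasurable, fun n γ h0 h => ?_⟩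
  have := hμ.2 n (fun i => γ i - x) (by simp [h0]) (fun i hi => by
    have := h i hi
    unfold adj at *; simpa using this)
  change (Pm μ x) (cyl γ n) = _
  rw [Pm, Measure.map_apply (meas_shiftx x) (meas_cyl _ _), ← this]
  congr 1
  ext ω
  simp [cyl, eq_sub_iff_add_eq, add_comm]

lemma Pm_zero {μ : Measure (ℕ → V d)} : Pm μ 0 = μ := by
  unfold Pm
  simp

def cns (x : V d) (ω : ℕ → V d) : ℕ → V d
  | 0 => x
  | j+1 => ω j

lemma meas_cns (x : V d) : Measurable (cns (d := d) x) := by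
  refine measurable_pi_lambda _ fun j => ?_
  cases j with
  | zero => exact measurable_const
  | succ j => exact measurable_pi_apply j

lemma cns_law (hd : 0 < d) {μ : Measure (ℕ → V d)} (hμ : IsSRWLaw μ 0) (x : V d) :
    IsSRWLaw ((2 * (d:ℝ≥0∞))⁻¹ • ∑ b, (Pm μ (x + sV b)).map (cns x)) x := by
  have hd0 : (d : ℝ≥0∞) ≠ 0 := by exact_mod_cast hd.ne'
  have h2d : (2 * (d:ℝ≥0∞)) ≠ 0 := by simp [hd0]
  have h2t : (2 * (d:ℝ≥0∞)) ≠ ⊤ := ENNReal.mul_ne_top (by simp) (by simp)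
  have hp : ∀ y, IsProbabilityMeasure ((Pm μ y).map (cns x)) := fun y => by
    have := (Pm_law hμ y).1
    exact Measure.isProbabilityMeasure_map (meas_cns x).aemeasurable
  constructor
  · constructor
    rw [Measure.smul_apply, Measure.finsetSum_apply]
    simp only [measure_univ, smul_eq_mul]
    simp only [Finset.sum_const, Finset.card_univ, Fintype.card_prod, Fintype.card_fin, Fintype.card_bool, nsmul_eq_mul, mul_one]
    rw [show ((d * 2 : ℕ) : ℝ≥0∞) = 2 * d by push_cast; ring, ENNReal.inv_mul_cancel h2d h2t]
  · intro n γ h0 h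
    change ((2 * (d:ℝ≥0∞))⁻¹ • ∑ b, (Pm μ (x + sV b)).map (cns x)) (cyl γ n) = _
    rw [Measure.smul_apply, Measure.finsetSum_apply]
    simp only [smul_eq_mul]
    cases n with
    | zero =>
      have : ∀ y, (Pm μ y).map (cns x) (cyl γ 0) = 1 := by
        intro y
        have := (Pm_law hμ y).1
        rw [Measure.map_apply (meas_cns x) (meas_cyl _ _)]
        have : cns x ⁻¹' cyl γ 0 = Set.univ := by
          ext ω; simp [cyl, cns, h0]
        rw [this]; simp
      simp only [this]
      simp only [Finset.sum_const, Finset.card_univ, Fintype.card_prod, Fintype.card_fin, Fintype.card_bool, nsmul_eq_mul, mul_one]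
      rw [show ((d * 2 : ℕ) : ℝ≥0∞) = 2 * d by push_cast; ring, ENNReal.inv_mul_cancel h2d h2t]; simp
    | succ n =>
      have hpre : cns x ⁻¹' cyl γ (n+1) = cyl (fun i => γ (i+1)) n := by
        ext ω
        simp only [cyl, Set.mem_preimage]
        constructor
        · intro h i hi; exact h (i+1) (by omega)
        · intro h i hi
          cases i with
          | zero => simp [cns, h0]
          | succ i => exact h i (by omega)
      obtain ⟨b0, hb0⟩ := adj_iff_sV.1 (h 0 (by omega))
      rw [h0] at hb0
      have : ∀ b, (Pm μ (x + sV b)).map (cns x) (cyl γ (n+1)) = if b = b0 then (2 * (d:ℝ≥0∞))⁻¹ ^ n else 0 := by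
        intro b
        rw [Measure.map_apply (meas_cns x) (meas_cyl _ _), hpre]
        split_ifs with hb
        · subst hb
          exact (Pm_law hμ _).2 n _ hb0 (fun i hi => h (i+1) (by omega))
        · apply cyl_bad hd (Pm_law hμ _)
          rintro ⟨h1, _⟩
          rw [hb0] at h1
          exact hb (sV_inj (add_left_cancel h1)).symm
      simp only [this, Finset.sum_ite_eq', Finset.mem_univ, if_true]
      rw [pow_succ']

variable {μ : Measure (ℕ → V d)}

lemma first_step (hd : 0 < d) (hμ : IsSRWLaw μ 0) (x : V d) {E : Set (ℕ → V d)} (hE : MeasurableSet E) :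
    (Pm μ x).real E = avg (fun y => (Pm μ y).real {ω | cns x ω ∈ E}) x := by
  have e := srw_unique hd (Pm_law hμ x) (cns_law hd hμ x)
  conv_lhs => rw [e]
  rw [avg_eq_sV, Measure.real, Measure.smul_apply, Measure.finsetSum_apply, smul_eq_mul, ENNReal.toReal_mul,
    ENNReal.toReal_sum]
  · simp only [Measure.map_apply (meas_cns x) hE]
    simp only [ENNReal.toReal_inv, ENNReal.toReal_mul, ENNReal.toReal_ofNat, ENNReal.toReal_natCast]
    rw [div_eq_inv_mul]; rfl
  · intro b _
    have := (Pm_law hμ (x + sV b)).1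
    rw [Measure.map_apply (meas_cns x) hE]
    exact measure_ne_top _ _

end Walk

end

section
section WalkLemmas

variable {μ : Measure (ℕ → V d)}

lemma Pm_prob (hμ : IsSRWLaw μ 0) (x : V d) : IsProbabilityMeasure (Pm μ x) := (Pm_law hμ x).1

lemma ae_start (hμ : IsSRWLaw μ 0) (x : V d) : ∀ᵐ ω ∂(Pm μ x), ω 0 = x := by
  have := Pm_prob hμ x
  have h := (Pm_law hμ x).2 0 (fun _ => x) rfl (by simp)
  rw [pow_zero] at h
  have h2 := (mem_ae_iff_prob_eq_one (meas_cyl (fun _ => x) 0)).2 h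
  filter_upwards [h2] with ω hω
  exact hω 0 le_rfl

lemma real_zero_start (hμ : IsSRWLaw μ 0) (x : V d) {E : Set (ℕ → V d)} (h : ∀ ω, ω 0 = x → ω ∉ E) :
    (Pm μ x).real E = 0 := by
  rw [measureReal_def, ENNReal.toReal_eq_zero_iff]
  left
  refine measure_mono_null (fun ω hω => ?_) (ae_iff.1 (ae_start hμ x))
  exact fun h0 => h ω h0 hω

lemma real_congr_start (hμ : IsSRWLaw μ 0) (x : V d) {E F : Set (ℕ → V d)} (h : ∀ ω, ω 0 = x → (ω ∈ E ↔ ω ∈ F)) :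
    (Pm μ x).real E = (Pm μ x).real F := by
  apply measureReal_congr
  filter_upwards [ae_start hμ x] with ω hω
  exact propext (h ω hω)

lemma real_le_one (hμ : IsSRWLaw μ 0) (x : V d) (E : Set (ℕ → V d)) : (Pm μ x).real E ≤ 1 := by
  have := Pm_prob hμ x
  exact measureReal_le_one

lemma ae_adj (hd : 0 < d) (hμ : IsSRWLaw μ 0) (x : V d) : ∀ᵐ ω ∂(Pm μ x), ∀ j, adj (ω j) (ω (j+1)) := by
  rw [ae_all_iff]
  intro j
  have hm : ∀ j, MeasurableSet {ω : ℕ → V d | adj (ω j) (ω (j+1))} := by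
    intro j
    have : {ω : ℕ → V d | adj (ω j) (ω (j+1))} = (fun ω : ℕ → V d => (ω j, ω (j+1))) ⁻¹' {q | adj q.1 q.2} := rfl
    rw [this]
    exact ((measurable_pi_apply j).prodMk (measurable_pi_apply (j+1))) (Set.to_countable _).measurableSet
  have key : ∀ x, (Pm μ x).real {ω | adj (ω j) (ω (j+1))} = 1 := by
    induction j with
    | zero =>
      intro x
      rw [first_step hd hμ x (hm 0), avg_eq_sV]
      have : ∀ b, (Pm μ (x + sV b)).real {ω | cns x ω ∈ {ω : ℕ → V d | adj (ω 0) (ω (0+1))}} = 1 := by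
        intro b
        have := Pm_prob hμ (x + sV b)
        rw [real_congr_start hμ (x + sV b) (F := Set.univ)]
        · simp
        · intro ω hω
          simp [cns, hω, adj_sV]
      simp only [this]
      simp
      field_simp
    | succ j ih =>
      intro x
      rw [first_step hd hμ x (hm _)]
      change avg (fun y => (Pm μ y).real {ω | adj (ω j) (ω (j+1))}) x = 1
      simp only [ih]
      exact avg_const hd 1 x
  have := Pm_prob hμ x
  have h := key x
  rw [measureReal_def, ENNReal.toReal_eq_one_iff] at h
  exact (mem_ae_iff_prob_eq_one (hm j)).2 h

lemma meas_stay (t : ℕ) (U : Set (V d)) : MeasurableSet {ω : ℕ → V d | ∀ j ≤ t, ω j ∈ U} := by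
  have : {ω : ℕ → V d | ∀ j ≤ t, ω j ∈ U} = ⋂ j, ⋂ (_ : j ≤ t), {ω | ω j ∈ U} := by ext; simp
  rw [this]
  exact MeasurableSet.iInter fun j => MeasurableSet.iInter fun _ => meas_at j U

lemma prob_qk (hd : 0 < d) (hμ : IsSRWLaw μ 0) (U B : Set (V d)) (t : ℕ) : ∀ x,
    (Pm μ x).real {ω | (∀ j ≤ t, ω j ∈ U) ∧ ω t ∈ B} = qk U (B.indicator 1) t x := by
  induction t with
  | zero =>
    intro x
    have := Pm_prob hμ x
    simp only [qk]
    by_cases h : x ∈ U ∧ x ∈ B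
    · rw [real_congr_start hμ x (F := Set.univ)]
      · simp [h]
      · intro ω hω; simp [hω, h]
    · rw [real_zero_start hμ x]
      · simp only [Set.indicator]
        split_ifs <;> simp_all
      · intro ω hω h'
        simp [hω] at h'
        exact h h'
  | succ t ih =>
    intro x
    simp only [qk]
    split_ifs with hx
    · have hm : MeasurableSet {ω : ℕ → V d | (∀ j ≤ t+1, ω j ∈ U) ∧ ω (t+1) ∈ B} := (meas_stay _ _).inter (meas_at _ _)
      rw [first_step hd hμ x hm]
      congr 1
      funext y
      rw [← ih y]
      congr 1
      ext ω
      simp only [Set.mem_ofPred_eq, cns]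
      refine and_congr_left fun _ => ⟨fun h j hj => h (j+1) (by omega), fun h j hj => ?_⟩
      cases j with
      | zero => exact hx
      | succ j => exact h j (by omega)
    · exact real_zero_start hμ x fun ω h0 h => hx (h0 ▸ h.1 0 (by omega))

lemma dl_eq_ind (y : V d) : ({y} : Set (V d)).indicator 1 = dl y := by
  ext x; simp [dl, Set.indicator]

lemma ae_finite (hd : 5 ≤ d) (hμ : IsSRWLaw μ 0) (x : V d) : ∀ᵐ ω ∂(Pm μ x), ∀ y, {j | ω j = y}.Finite := by
  rw [ae_all_iff]
  intro y
  have hP := Pm_prob hμ x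
  have h1 : ∀ t, (Pm μ x) {ω | ω t = y} = ENNReal.ofReal (qk Set.univ (dl y) t x) := by
    intro t
    rw [← dl_eq_ind, ← prob_qk (by omega) hμ, ofReal_measureReal]
    congr 1; ext ω; simp
  have h2 : ∑' t, (Pm μ x) {ω | ω t = y} ≠ ⊤ := by
    simp_rw [h1]
    rw [← ENNReal.ofReal_tsum_of_nonneg (fun t => qk_nonneg (dl_nonneg y) t x) (green_summable hd _ _ _)]
    exact ENNReal.ofReal_ne_top
  have h3 := measure_setOfPred_frequently_eq_zero h2
  rw [← compl_mem_ae_iff] at h3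
  filter_upwards [h3] with ω hω
  have : ¬ ∃ᶠ n in Filter.atTop, ω n = y := hω
  rw [Nat.frequently_atTop_iff_infinite, Set.not_infinite] at this
  exact this

def DepTo (s : ℕ) (C : Set (ℕ → V d)) : Prop := ∀ ω ω', (∀ j ≤ s, ω j = ω' j) → ω ∈ C → ω' ∈ C

lemma dep_meas {s : ℕ} {C : Set (ℕ → V d)} (h : DepTo s C) : MeasurableSet C := by
  let r : (ℕ → V d) → (Fin (s+1) → V d) := fun ω i => ω i
  have hr : Measurable r := measurable_pi_lambda _ fun i => measurable_pi_apply _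
  have : C = r ⁻¹' (r '' C) := by
    ext ω; constructor
    · exact fun hω => ⟨ω, hω, rfl⟩
    · rintro ⟨ω', h', e⟩
      exact h ω' ω (fun j hj => congrFun e ⟨j, by omega⟩) h'
  rw [this]
  exact hr (Set.to_countable _).measurableSet

lemma meas_shift (s : ℕ) : Measurable (fun (ω : ℕ → V d) (j : ℕ) => ω (s + j)) :=
  measurable_pi_lambda _ fun j => measurable_pi_apply _

lemma markov (hd : 0 < d) (hμ : IsSRWLaw μ 0) {y : V d} {E : Set (ℕ → V d)} (hE : MeasurableSet E) (s : ℕ) :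
    ∀ (C : Set (ℕ → V d)), DepTo s C → (∀ ω ∈ C, ω s = y) → ∀ x,
    (Pm μ x).real (C ∩ {ω | (fun j => ω (s + j)) ∈ E}) = (Pm μ x).real C * (Pm μ y).real E := by
  induction s with
  | zero =>
    intro C hC hy x
    have := Pm_prob hμ x
    by_cases h : (fun _ => x) ∈ C
    · have e : x = y := hy _ h
      have hall : ∀ ω, ω 0 = x → ω ∈ C := fun ω h0 => hC _ ω (fun j hj => by simp at hj; simp [hj, h0]) h
      rw [real_congr_start hμ x (F := E), real_congr_start hμ x (E := C) (F := Set.univ)]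
      · subst e; simp
      · intro ω h0; simp [hall ω h0]
      · intro ω h0; simp [hall ω h0]
    · have hno : ∀ ω, ω 0 = x → ω ∉ C := fun ω h0 hω => h (hC ω _ (fun j hj => by simp at hj; simp [hj, h0]) hω)
      rw [real_zero_start hμ x (E := C) hno, real_zero_start hμ x (fun ω h0 hω => hno ω h0 hω.1)]; simp
  | succ s ih =>
    intro C hC hy x
    have hm := dep_meas hC
    have hm2 : MeasurableSet (C ∩ {ω | (fun j => ω (s+1+j)) ∈ E}) := hm.inter (meas_shift (s+1) hE)
    rw [first_step hd hμ x hm, first_step hd hμ x hm2, mul_comm, ← avg_smul]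
    congr 1
    funext y'
    rw [mul_comm, ← ih {ω | cns x ω ∈ C} ?_ ?_ y']
    · congr 1
      ext ω
      simp only [Set.mem_ofPred_eq, Set.mem_inter_iff]
      have : (fun j => cns x ω (s + 1 + j)) = fun j => ω (s + j) := by
        funext j; rw [show s + 1 + j = (s + j) + 1 by ring]; rfl
      rw [this]
    · intro ω ω' h hω
      refine hC _ _ (fun j hj => ?_) hω
      cases j with
      | zero => rfl
      | succ j => exact h j (by omega)
    · intro ω hω; exact hy _ hω

noncomputable def PS (U : Set (V d)) (u : V d) : ℕ → V d → (Set (V d) → ℝ) → ℝ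
  | 0 => fun x Φ => if x ∈ U ∧ x = u then Φ {x} else 0
  | t+1 => fun x Φ => if x ∈ U then avg (fun y => PS U u t y (fun A => Φ (insert x A))) x else 0

def rng (t : ℕ) (ω : ℕ → V d) : Set (V d) := ω '' {j | j ≤ t}

lemma rng_cns (t : ℕ) (x : V d) (ω : ℕ → V d) : rng (t+1) (cns x ω) = insert x (rng t ω) := by
  ext y; simp only [rng, Set.mem_image, Set.mem_insert_iff, Set.mem_ofPred_eq]
  constructor
  · rintro ⟨j, hj, rfl⟩
    cases j with
    | zero => left; rfl
    | succ j => right; exact ⟨j, by omega, rfl⟩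
  · rintro (rfl | ⟨j, hj, rfl⟩)
    · exact ⟨0, by omega, rfl⟩
    · exact ⟨j+1, by omega, rfl⟩

def evPS (U : Set (V d)) (u : V d) (t : ℕ) (F : Set (V d) → Set (ℕ → V d)) : Set (ℕ → V d) :=
  {ω | (∀ j ≤ t, ω j ∈ U) ∧ ω t = u ∧ (fun j => ω (t + j)) ∈ F (rng t ω)}

lemma meas_evPS (U : Set (V d)) (u : V d) (t : ℕ) (F : Set (V d) → Set (ℕ → V d)) (hF : ∀ A, MeasurableSet (F A)) :
    MeasurableSet (evPS U u t F) := by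
  have : evPS U u t F = ({ω | ∀ j ≤ t, ω j ∈ U} ∩ {ω | ω t ∈ ({u} : Set (V d))}) ∩
      ⋃ γ : Fin (t+1) → V d, ({ω | (fun i : Fin (t+1) => ω i) = γ} ∩ {ω | (fun j => ω (t + j)) ∈ F (Set.range γ)}) := by
    ext ω
    simp only [evPS, Set.mem_ofPred_eq, Set.mem_inter_iff, Set.mem_iUnion, Set.mem_singleton_iff, exists_eq_left', and_assoc]
    have : rng t ω = Set.range (fun i : Fin (t+1) => ω i) := by
      ext y; simp only [rng, Set.mem_image, Set.mem_range, Set.mem_ofPred_eq]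
      constructor
      · rintro ⟨j, hj, rfl⟩; exact ⟨⟨j, by omega⟩, rfl⟩
      · rintro ⟨j, rfl⟩; exact ⟨j, by omega, rfl⟩
    rw [this]
  rw [this]
  refine ((meas_stay t U).inter (meas_at t _)).inter (MeasurableSet.iUnion fun γ => ?_)
  refine MeasurableSet.inter ?_ (meas_shift t (hF _))
  exact dep_meas (s := t) fun ω ω' h hω => by
    have hω : (fun i : Fin (t+1) => ω i) = γ := hω
    show (fun i : Fin (t+1) => ω' i) = γ
    rw [← hω]; funext i; exact (h i (by omega)).symm

lemma prob_PS (hd : 0 < d) (hμ : IsSRWLaw μ 0) (U : Set (V d)) (u : V d) (t : ℕ) :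
    ∀ (F : Set (V d) → Set (ℕ → V d)), (∀ A, MeasurableSet (F A)) → ∀ x,
    (Pm μ x).real (evPS U u t F) = PS U u t x (fun A => (Pm μ u).real (F A)) := by
  induction t with
  | zero =>
    intro F hF x
    simp only [PS]
    split_ifs with h
    · obtain ⟨h1, rfl⟩ := h
      apply real_congr_start hμ
      intro ω h0
      have : rng 0 ω = {x} := by simp [rng, h0]
      simp [evPS, h0, h1, this]
    · apply real_zero_start hμ
      intro ω h0 hω
      exact h ⟨h0 ▸ hω.1 0 le_rfl, h0 ▸ hω.2.1⟩
  | succ t ih =>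
    intro F hF x
    simp only [PS]
    split_ifs with hx
    · rw [first_step hd hμ x (meas_evPS U u _ F hF)]
      congr 1
      funext y
      rw [← ih (fun A => F (insert x A)) (fun A => hF _) y]
      congr 1
      ext ω
      simp only [evPS, Set.mem_ofPred_eq, rng_cns]
      have : (fun j => cns x ω (t + 1 + j)) = fun j => ω (t + j) := by
        funext j; rw [show t + 1 + j = (t + j) + 1 by ring]; rfl
      rw [this]
      refine and_congr_left fun _ => ⟨fun h j hj => h (j+1) (by omega), fun h j hj => ?_⟩
      cases j with
      | zero => exact hx
      | succ j => exact h j (by omega)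
    · exact real_zero_start hμ x fun ω h0 h => hx (h0 ▸ h.1 0 (by omega))

lemma PS_mono (U : Set (V d)) (u : V d) (t : ℕ) : ∀ (x : V d) {Φ Ψ : Set (V d) → ℝ}, (∀ A, Φ A ≤ Ψ A) →
    PS U u t x Φ ≤ PS U u t x Ψ := by
  induction t with
  | zero => intro x Φ Ψ h; simp only [PS]; split_ifs; exacts [h _, le_rfl]
  | succ t ih =>
    intro x Φ Ψ h; simp only [PS]; split_ifs
    · exact avg_mono fun y => ih y fun A => h _
    · exact le_rfl

lemma PS_lin (U : Set (V d)) (u : V d) {ι : Type*} (S : Finset ι) (c : ι → ℝ) (t : ℕ) : ∀ (x : V d) (b : ℝ)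
    (Φ : ι → Set (V d) → ℝ), PS U u t x (fun A => b - ∑ j ∈ S, c j * Φ j A) = b * qk U (dl u) t x - ∑ j ∈ S, c j * PS U u t x (Φ j) := by
  induction t with
  | zero =>
    intro x b Φ; simp only [PS, qk, dl]; split_ifs <;> simp_all
  | succ t ih =>
    intro x b Φ; simp only [PS, qk]; split_ifs
    · simp_rw [ih]
      rw [avg_sub, avg_smul, avg_sum]
      simp_rw [avg_smul]
    · simp

lemma PS_one (U : Set (V d)) (u : V d) (t : ℕ) (x : V d) : PS U u t x (fun _ => 1) = qk U (dl u) t x := by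
  have := PS_lin U u (∅ : Finset ℕ) (fun _ => 0) t x 1 (fun _ _ => 0)
  simpa using this

lemma PS_hit (U : Set (V d)) (u y : V d) (t : ℕ) : ∀ x : V d, PS U u t x (fun A => if y ∈ A then 1 else 0) ≤
    ∑ j ∈ Finset.range (t+1), qk U (dl y) j x * qk U (dl u) (t - j) y := by
  have hnn : ∀ (t j : ℕ) (x : V d), 0 ≤ qk U (dl y) j x * qk U (dl u) (t - j) y := fun t j x =>
    mul_nonneg (qk_nonneg (dl_nonneg y) _ _) (qk_nonneg (dl_nonneg u) _ _)
  have same : ∀ t x, x = y → x ∈ U → PS U u t x (fun A => if y ∈ A then 1 else 0) ≤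
    ∑ j ∈ Finset.range (t+1), qk U (dl y) j x * qk U (dl u) (t - j) y := by
    intro t x e hx
    subst e
    calc _ ≤ PS U u t x (fun _ => 1) := PS_mono U u t x fun A => by split_ifs <;> norm_num
      _ = qk U (dl x) 0 x * qk U (dl u) (t - 0) x := by rw [PS_one]; simp [qk, hx, dl]
      _ ≤ _ := Finset.single_le_sum (f := fun j => qk U (dl x) j x * qk U (dl u) (t - j) x) (fun j _ => hnn t j x) (by simp)
  induction t with
  | zero =>
    intro x
    by_cases hx : x ∈ U
    · by_cases e : x = y
      · exact same 0 x e hx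
      · have : PS U u 0 x (fun A => if y ∈ A then 1 else 0) = 0 := by
          simp [PS, Ne.symm e]
        rw [this]; exact Finset.sum_nonneg fun j _ => hnn 0 j x
    · simp [PS, hx, qk_off hx]
  | succ t ih =>
    intro x
    by_cases hx : x ∈ U
    · by_cases e : x = y
      · exact same _ x e hx
      · rw [Finset.sum_range_succ']
        have h0 : qk U (dl y) 0 x = 0 := by simp [qk, dl, e]
        rw [h0, zero_mul, add_zero]
        simp only [PS, hx, if_true, qk, Set.mem_insert_iff, Ne.symm e, false_or]
        calc _ ≤ avg (fun x => ∑ j ∈ Finset.range (t+1), qk U (dl y) j x * qk U (dl u) (t - j) y) x := avg_mono ih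
          _ = _ := by
            rw [avg_sum]
            refine Finset.sum_congr rfl fun j _ => ?_
            rw [show t + 1 - (j+1) = t - j by omega]
            simp_rw [mul_comm _ (qk U (dl u) (t - j) y)]
            rw [avg_smul]
    · simp [PS, hx, qk_off hx]

noncomputable def av (μ : Measure (ℕ → V d)) (S : Set (V d)) (x : V d) : ℝ := (Pm μ x).real {ω | ∀ j, ω j ∉ S}

lemma meas_av (S : Set (V d)) : MeasurableSet {ω : ℕ → V d | ∀ j, ω j ∉ S} := by
  have : {ω : ℕ → V d | ∀ j, ω j ∉ S} = ⋂ j, {ω | ω j ∈ Sᶜ} := by ext; simp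
  rw [this]
  exact MeasurableSet.iInter fun j => meas_at j _

lemma av_nonneg (S : Set (V d)) (x : V d) : 0 ≤ av μ S x := measureReal_nonneg
lemma av_le_one (hμ : IsSRWLaw μ 0) (S : Set (V d)) (x : V d) : av μ S x ≤ 1 := real_le_one hμ x _
lemma av_zero (hμ : IsSRWLaw μ 0) {S : Set (V d)} {x : V d} (hx : x ∈ S) : av μ S x = 0 :=
  real_zero_start hμ x fun ω h0 h => h 0 (h0 ▸ hx)
lemma av_eq (hd : 0 < d) (hμ : IsSRWLaw μ 0) {S : Set (V d)} {x : V d} (hx : x ∉ S) : av μ S x = avg (av μ S) x := by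
  unfold av
  rw [first_step hd hμ x (meas_av S)]
  congr 1; funext y; congr 1; ext ω
  refine ⟨fun h j => h (j+1), fun h j => ?_⟩
  cases j with
  | zero => exact hx
  | succ j => exact h j
lemma av_anti (hμ : IsSRWLaw μ 0) {S S' : Set (V d)} (h : S ⊆ S') (x : V d) : av μ S' x ≤ av μ S x := by
  have := Pm_prob hμ x
  exact measureReal_mono (fun ω hω j hj => hω j (h hj))

lemma tendsto_av (hd : 0 < d) (hμ : IsSRWLaw μ 0) (S : Set (V d)) (x : V d) :
    Filter.Tendsto (fun T => qk Sᶜ (fun _ => 1) T x) Filter.atTop (nhds (av μ S x)) := by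
  have hP := Pm_prob hμ x
  have e : ∀ T, qk Sᶜ (fun _ => 1) T x = (Pm μ x).real {ω | ∀ j ≤ T, ω j ∈ Sᶜ} := by
    intro T
    have := prob_qk hd hμ Sᶜ Set.univ T x
    rw [show (Set.univ : Set (V d)).indicator (1 : V d → ℝ) = fun _ => 1 by ext; simp] at this
    rw [← this]; simp
  simp_rw [e]
  have : {ω : ℕ → V d | ∀ j, ω j ∉ S} = ⋂ T : ℕ, {ω | ∀ j ≤ T, ω j ∈ Sᶜ} := by
    ext ω; simp only [Set.mem_ofPred_eq, Set.mem_iInter, Set.mem_compl_iff]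
    exact ⟨fun h T j _ => h j, fun h j => h j j le_rfl⟩
  unfold av
  rw [this]
  refine (ENNReal.tendsto_toReal (measure_ne_top _ _)).comp
    (tendsto_measure_iInter_atTop (fun T => (meas_stay T _).nullMeasurableSet) ?_ ⟨0, measure_ne_top _ _⟩)
  exact fun T T' h ω hω j hj => hω j (hj.trans h)

lemma le_av (hd : 0 < d) (hμ : IsSRWLaw μ 0) {S : Set (V d)} {u : V d → ℝ} (h1 : ∀ x, u x ≤ 1) (h2 : ∀ x ∈ S, u x ≤ 0)
    (h3 : ∀ x ∉ S, u x ≤ avg u x) (x : V d) : u x ≤ av μ S x := by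
  refine ge_of_tendsto' (tendsto_av hd hμ S x) fun T => ?_
  induction T generalizing x with
  | zero =>
    simp only [qk]; split_ifs with h
    exacts [h1 x, h2 x (not_not.1 h)]
  | succ T ih =>
    simp only [qk]; split_ifs with h
    exacts [(h3 x h).trans (avg_mono ih), h2 x (not_not.1 h)]

end WalkLemmas

end

section
section GFacts

variable {μ : Measure (ℕ → V d)}

def ht (i : Fin d) (σ : ℤ) (x0 x : V d) : ℤ := σ * (x i - x0 i)

def Rf (i : Fin d) (s : ℤ) (x : V d) : V d := Function.update x i (s - x i)

lemma eV_apply (i j : Fin d) : eV i j = if j = i then (1:ℤ) else 0 := by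
  simp [eV, Pi.single_apply]

lemma Rf_add (i j : Fin d) (s : ℤ) (x : V d) :
    Rf i s (x + eV j) = if j = i then Rf i s x - eV j else Rf i s x + eV j := by
  split_ifs with h
  · subst h
    ext k
    by_cases hk : k = j
    · subst hk; simp [Rf, eV_apply]; ring
    · simp [Rf, eV_apply, hk]
  · ext k
    by_cases hk : k = i
    · subst hk; simp [Rf, eV_apply, Ne.symm h]
    · simp [Rf, eV_apply, hk]

lemma Rf_sub (i j : Fin d) (s : ℤ) (x : V d) :
    Rf i s (x - eV j) = if j = i then Rf i s x + eV j else Rf i s x - eV j := by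
  split_ifs with h
  · subst h
    ext k
    by_cases hk : k = j
    · subst hk; simp [Rf, eV_apply]; ring
    · simp [Rf, eV_apply, hk]
  · ext k
    by_cases hk : k = i
    · subst hk; simp [Rf, eV_apply, Ne.symm h]
    · simp [Rf, eV_apply, hk]

lemma avg_refl (f : V d → ℝ) (i : Fin d) (s : ℤ) (x : V d) : avg (fun y => f (Rf i s y)) x = avg f (Rf i s x) := by
  unfold avg
  congr 1
  refine Finset.sum_congr rfl fun j _ => ?_
  simp only [Rf_add, Rf_sub]
  split_ifs with h
  · rw [add_comm]
  · rfl

lemma avg_mono' {f g : V d → ℝ} {x : V d} (h : ∀ i, f (x + eV i) ≤ g (x + eV i) ∧ f (x - eV i) ≤ g (x - eV i)) :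
    avg f x ≤ avg g x := by
  unfold avg
  gcongr with i
  · exact (h i).1
  · exact (h i).2

lemma ht_nbr {σ : ℤ} (hσ : σ = 1 ∨ σ = -1) (i j : Fin d) (x0 x : V d) :
    (ht i σ x0 (x + eV j) ≤ ht i σ x0 x + 1 ∧ ht i σ x0 x - 1 ≤ ht i σ x0 (x + eV j)) ∧
    (ht i σ x0 (x - eV j) ≤ ht i σ x0 x + 1 ∧ ht i σ x0 x - 1 ≤ ht i σ x0 (x - eV j)) := by
  unfold ht
  simp only [Pi.add_apply, Pi.sub_apply, eV_apply]
  rcases hσ with rfl | rfl <;> split_ifs <;> constructor <;> constructor <;> linarith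

lemma refl_le (hd : 0 < d) (hμ : IsSRWLaw μ 0) {i : Fin d} {σ : ℤ} (hσ : σ = 1 ∨ σ = -1) {x0 : V d} {S : Set (V d)} {t : ℤ}
    (hS : ∀ y ∈ S, ht i σ x0 y ≤ t) (x : V d) (hx : ht i σ x0 x ≤ t) :
    av μ S x ≤ av μ S (Rf i (2 * σ * t + 2 * x0 i) x) := by
  have hR : ∀ x, ht i σ x0 (Rf i (2 * σ * t + 2 * x0 i) x) = 2 * t - ht i σ x0 x := by
    intro x; simp only [ht, Rf, Function.update_self]
    rcases hσ with rfl | rfl <;> ring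
  refine le_of_tendsto_of_tendsto' (tendsto_av hd hμ S x) (tendsto_av hd hμ S _) fun T => ?_
  have self : ∀ x, ht i σ x0 x = t → Rf i (2 * σ * t + 2 * x0 i) x = x := by
    intro x h
    have : 2 * σ * t + 2 * x0 i - x i = x i := by
      unfold ht at h; rw [← h]; rcases hσ with rfl | rfl <;> ring
    unfold Rf; rw [this]; simp
  induction T generalizing x with
  | zero =>
    rcases eq_or_lt_of_le hx with h | h
    · rw [self x h]
    · have : Rf i (2 * σ * t + 2 * x0 i) x ∈ Sᶜ := fun hm => by
        have h1 := hS _ hm; rw [hR] at h1; omega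
      simp only [qk, this, if_true]; split_ifs <;> norm_num
  | succ T ih =>
    rcases eq_or_lt_of_le hx with h | h
    · rw [self x h]
    · have : Rf i (2 * σ * t + 2 * x0 i) x ∈ Sᶜ := fun hm => by
        have h1 := hS _ hm; rw [hR] at h1; omega
      simp only [qk, this, if_true]
      rw [← avg_refl]
      split_ifs
      · refine avg_mono' fun j => ⟨ih _ ?_, ih _ ?_⟩
        · have := (ht_nbr hσ i j x0 x).1.1; omega
        · have := (ht_nbr hσ i j x0 x).2.1; omega
      · exact avg_nonneg fun y => qk_nonneg (fun _ => zero_le_one) _ _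

lemma nsq_le_of_abs {x : V d} {R : ℝ} (h : ∀ i, |(x i : ℝ)| ≤ R) : nsq x ≤ d * R ^ 2 := by
  unfold nsq
  calc ∑ i, (x i : ℝ) ^ 2 ≤ ∑ _i : Fin d, R ^ 2 := Finset.sum_le_sum fun i _ => by
        rw [← sq_abs]; exact pow_le_pow_left₀ (abs_nonneg _) (h i) 2
    _ = _ := by simp

def Below (i : Fin d) (σ : ℤ) (x0 : V d) (S : Set (V d)) : Prop := ∀ y ∈ S, y ≠ x0 → ht i σ x0 y < 0

lemma Below.le {i : Fin d} {σ : ℤ} {x0 : V d} {S : Set (V d)} (h : Below i σ x0 S) : ∀ y ∈ S, ht i σ x0 y ≤ 0 := by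
  intro y hy
  by_cases e : y = x0
  · subst e; simp [ht]
  · exact (h y hy e).le

lemma ht_uIcc {σ : ℤ} (hσ : σ = 1 ∨ σ = -1) {i : Fin d} {x0 x y q : V d} {b : ℤ} (hx : b ≤ ht i σ x0 x) (hy : b ≤ ht i σ x0 y)
    (hq : q i ∈ Set.uIcc (x i) (y i)) : b ≤ ht i σ x0 q := by
  unfold ht at *
  rw [Set.mem_uIcc] at hq
  rcases hσ with rfl | rfl <;> rcases hq with hq | hq <;> linarith

lemma ht_uIcc_le {σ : ℤ} (hσ : σ = 1 ∨ σ = -1) {i : Fin d} {x0 x y q : V d} {b : ℤ} (hx : ht i σ x0 x ≤ b) (hy : ht i σ x0 y ≤ b)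
    (hq : q i ∈ Set.uIcc (x i) (y i)) : ht i σ x0 q ≤ b := by
  unfold ht at *
  rw [Set.mem_uIcc] at hq
  rcases hσ with rfl | rfl <;> rcases hq with hq | hq <;> linarith

lemma ht_sq_le {σ : ℤ} (hσ : σ = 1 ∨ σ = -1) (i : Fin d) (x0 x y : V d) : ((ht i σ x0 x - ht i σ x0 y : ℤ) : ℝ) ^ 2 ≤ nsq (x - y) := by
  refine le_trans (le_of_eq ?_) (sq_le_nsq (x - y) i)
  unfold ht; simp only [Pi.sub_apply]; push_cast
  rcases hσ with rfl | rfl <;> push_cast <;> ring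

lemma gsup (hd : 5 ≤ d) : ∃ C : ℝ, 1 ≤ C ∧ ∀ (μ : Measure (ℕ → V d)), IsSRWLaw μ 0 → ∀ (i : Fin d) (σ : ℤ), (σ = 1 ∨ σ = -1) →
    ∀ (x0 : V d) (S : Set (V d)), Below i σ x0 S → ∀ m : ℕ, 1 ≤ m → ∀ y v : V d, y ∈ cube x0 m →
    (∀ j, j ≠ i → |v j - x0 j| ≤ m) → 1 ≤ ht i σ x0 v → (m : ℤ) ≤ 8 * ht i σ x0 v → av μ S y ≤ C * av μ S v := by
  obtain ⟨C, S0, hC, hS0, H⟩ := harnack_chain hd (4 * d * 10 ^ 2)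
  obtain ⟨M, hM⟩ := exists_nat_gt (10 * S0)
  refine ⟨max C ((2 * d : ℝ) ^ (d * (2 * M))), le_max_of_le_left hC, ?_⟩
  intro μ hμ i σ hσ x0 S hS m hm y v hy hv h1 h8
  have hv0 := av_nonneg (μ := μ) S v
  set h := ht i σ x0 v with hh
  set Hh := max h m with hHh
  set t := (ht i σ x0 y + Hh + 1) / 2 with ht'
  have hyi := hy i
  have hy1 : |ht i σ x0 y| ≤ m := by
    unfold ht; rcases hσ with rfl | rfl <;> simpa [abs_sub_comm] using hyi
  rw [abs_le] at hy1
  have hHm : (m:ℤ) ≤ Hh := le_max_right _ _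
  have hHv : h ≤ Hh := le_max_left _ _
  have hH2 : Hh ≤ h + m := by rw [hHh]; apply max_le <;> omega
  have ht0 : 0 ≤ t := by omega
  have hyt : ht i σ x0 y ≤ t := by omega
  have hr := refl_le (μ := μ) (by omega) hμ hσ (t := t) (fun y hy => (hS.le y hy).trans ht0) y hyt
  set y' := Rf i (2 * σ * t + 2 * x0 i) y with hy'
  have hhy' : ht i σ x0 y' = 2 * t - ht i σ x0 y := by
    rw [hy']; simp only [ht, Rf, Function.update_self]
    rcases hσ with rfl | rfl <;> ring
  have hyb : Hh ≤ ht i σ x0 y' ∧ ht i σ x0 y' ≤ Hh + 1 := by omega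
  refine hr.trans ?_
  have hdif : ∀ j, |y' j - v j| ≤ 2 * m := by
    intro j
    by_cases e : j = i
    · subst e
      have : |ht j σ x0 y' - h| ≤ 2 * m := by rw [abs_le]; constructor <;> omega
      rw [hh] at this
      unfold ht at this
      rw [← mul_sub] at this
      rcases hσ with rfl | rfl
      · simpa using this
      · rw [abs_mul] at this; simpa using this
    · have h1 := hy j
      have h2 := hv j e
      have : y' j = y j := by simp [hy', Rf, e]
      rw [this]
      rw [abs_le] at *; constructor <;> omega
  have hnsq : nsq (y' - v) ≤ 4 * d * (m:ℝ) ^ 2 := by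
    refine (nsq_le_of_abs (R := 2 * m) fun j => ?_).trans (le_of_eq (by ring))
    have := hdif j
    simp only [Pi.sub_apply]
    exact_mod_cast this
  have harm : ∀ z, 1 ≤ ht i σ x0 z → av μ S z = avg (av μ S) z := fun z hz =>
    av_eq (by omega) hμ fun hzS => by have := hS.le z hzS; omega
  have hq1 : ∀ q : V d, (∀ j, q j ∈ Set.uIcc (y' j) (v j)) → h ≤ ht i σ x0 q := fun q hq =>
    ht_uIcc hσ (by omega) le_rfl (hq i)
  by_cases hlarge : M ≤ m
  · have hm0 : (1:ℝ) ≤ m := by exact_mod_cast hm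
    have hmM : (M:ℝ) ≤ m := by exact_mod_cast hlarge
    refine (H ((m/10 : ℝ) ^ 2) ?_ _ (av_nonneg S) y' v ?_ ?_).trans (mul_le_mul_of_nonneg_right (le_max_left _ _) hv0)
    · nlinarith
    · refine hnsq.trans (le_of_eq (by ring))
    · intro q hq z hz
      apply harm
      by_contra hlt
      push Not at hlt
      have h2 := hq1 q hq
      have h3 := ht_sq_le hσ i x0 q z
      rw [nsq_sub_comm] at h3
      have h4 : (m/10:ℝ) ≤ ((ht i σ x0 q - ht i σ x0 z : ℤ) : ℝ) := by
        have : (m:ℤ) ≤ 10 * (ht i σ x0 q - ht i σ x0 z) := by omega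
        have : (m:ℝ) ≤ 10 * ((ht i σ x0 q - ht i σ x0 z : ℤ) : ℝ) := by exact_mod_cast this
        linarith
      have : (m/10:ℝ)^2 ≤ ((ht i σ x0 q - ht i σ x0 z : ℤ) : ℝ)^2 := pow_le_pow_left₀ (by positivity) h4 2
      linarith
  · push Not at hlarge
    have h5 := triv_harnack (h := av μ S) (by omega) (av_nonneg S) y' _ v rfl (fun q hq => (harm q (h1.trans (hq1 q (fun j => by
      rw [Set.uIcc_comm]; exact hq j)))).ge)
    refine h5.trans (mul_le_mul_of_nonneg_right (le_max_of_le_right ?_) hv0)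
    refine pow_le_pow_right₀ (by norm_cast; omega) ?_
    calc ∑ j, (v j - y' j).natAbs ≤ ∑ _j : Fin d, 2 * M := Finset.sum_le_sum fun j _ => by
          have := hdif j; rw [abs_le] at this; omega
      _ = _ := by simp

lemma green_self (hd : 5 ≤ d) (y : V d) : 1 ≤ Green Set.univ y y := by
  rw [green_eq hd (Set.mem_univ y)]
  have : 0 ≤ avg (Green Set.univ y) y := avg_nonneg (green_nonneg _ _)
  simp [dl, this]

lemma ff_shift_super (hd : 5 ≤ d) (x0 x : V d) : avg (fun y => ff (y - x0)) x ≤ ff (x - x0) := by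
  obtain ⟨c, hc, h⟩ := ff_super hd
  rw [avg_shift]
  have := (h (x - x0)).1
  have h2 := mul_nonneg hc.le (dl_nonneg 0 (x - x0))
  linarith

lemma av_union (hd : 5 ≤ d) (hμ : IsSRWLaw μ 0) (S B : Set (V d)) (Y : Finset (V d)) (x0 : V d) {M κ : ℝ} (hκ : 0 < κ) (hM : 0 ≤ M)
    (h1 : ∀ x ∈ B, av μ S x ≤ M) (h2 : ∀ x ∈ B, κ ≤ ff (x - x0)) (x : V d) :
    av μ S x - M / κ * ff (x - x0) - ∑ y ∈ Y, av μ S y * Green Set.univ y x ≤ av μ (S ∪ B ∪ Y) x := by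
  have hsum : ∀ x, 0 ≤ ∑ y ∈ Y, av μ S y * Green Set.univ y x := fun x =>
    Finset.sum_nonneg fun y _ => mul_nonneg (av_nonneg S y) (green_nonneg _ _ _)
  have hb : ∀ x, 0 ≤ M / κ * ff (x - x0) := fun x => mul_nonneg (by positivity) (ff_pos hd _).le
  refine le_av (u := fun x => av μ S x - M / κ * ff (x - x0) - ∑ y ∈ Y, av μ S y * Green Set.univ y x) (by omega) hμ ?_ ?_ ?_ x
  · intro x
    have := av_le_one hμ S x
    have := hsum x
    have := hb x
    linarith
  · rintro x ((hx | hx) | hx)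
    · have := av_zero hμ hx
      have := hsum x
      have := hb x
      linarith
    · have := hsum x
      have : M ≤ M / κ * ff (x - x0) := by
        calc M = M / κ * κ := by field_simp
          _ ≤ _ := mul_le_mul_of_nonneg_left (h2 x hx) (by positivity)
      have := h1 x hx
      linarith
    · have := hb x
      have : av μ S x ≤ ∑ y ∈ Y, av μ S y * Green Set.univ y x := by
        calc av μ S x ≤ av μ S x * Green Set.univ x x := le_mul_of_one_le_right (av_nonneg _ _) (green_self hd x)
          _ ≤ _ := Finset.single_le_sum (f := fun y => av μ S y * Green Set.univ y x)
            (fun y _ => mul_nonneg (av_nonneg S y) (green_nonneg _ _ _)) hx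
      linarith
  · intro x hx
    have hxS : x ∉ S := fun h => hx (Or.inl (Or.inl h))
    rw [avg_sub, avg_sub, avg_smul, avg_sum]
    simp_rw [avg_smul]
    rw [← av_eq (by omega) hμ hxS]
    have h3 : M / κ * avg (fun y => ff (y - x0)) x ≤ M / κ * ff (x - x0) :=
      mul_le_mul_of_nonneg_left (ff_shift_super hd x0 x) (by positivity)
    have h4 : ∑ y ∈ Y, av μ S y * avg (Green Set.univ y) x ≤ ∑ y ∈ Y, av μ S y * Green Set.univ y x := by
      refine Finset.sum_le_sum fun y _ => mul_le_mul_of_nonneg_left ?_ (av_nonneg S y)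
      rw [green_eq hd (Set.mem_univ x)]
      have := dl_nonneg y x
      linarith
    linarith

end GFacts

end

section
section Escape

variable {μ : Measure (ℕ → V d)}

lemma rpow_ratio (hd : 5 ≤ d) {D N X : ℝ} (hD : 0 < D) (hX : 0 < X) (hX1 : X ≤ 1) (h : D ≤ X * N) :
    N ^ (-((d:ℝ)-2)/2) ≤ X * D ^ (-((d:ℝ)-2)/2) := by
  have hd' : (5:ℝ) ≤ d := by exact_mod_cast hd
  have h1 : N ^ (-((d:ℝ)-2)/2) ≤ (D / X) ^ (-((d:ℝ)-2)/2) :=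
    Real.rpow_le_rpow_of_nonpos (by positivity) ((div_le_iff₀ hX).2 (by linarith)) (by linarith)
  refine h1.trans ?_
  rw [Real.div_rpow hD.le hX.le, div_eq_mul_inv, mul_comm]
  refine mul_le_mul_of_nonneg_right ?_ (by positivity)
  rw [← Real.rpow_neg hX.le]
  calc X ^ (-(-((d:ℝ)-2)/2)) ≤ X ^ (1:ℝ) := Real.rpow_le_rpow_of_exponent_ge hX hX1 (by linarith)
    _ = X := Real.rpow_one X

lemma cube_finite (x : V d) (r : ℕ) : (cube x r).Finite := by
  have : cube x r ⊆ Set.Icc (fun i => x i - r) (fun i => x i + r) := by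
    intro y hy
    constructor <;> intro i <;> have := hy i <;> rw [abs_le] at this <;> simp only <;> linarith
  exact (Set.finite_Icc _ _).subset this

lemma cube_nsq {x y : V d} {r : ℕ} (h : y ∈ cube x r) : nsq (y - x) ≤ d * (r:ℝ) ^ 2 := by
  refine nsq_le_of_abs fun i => ?_
  have := h i
  simp only [Pi.sub_apply]; exact_mod_cast this

lemma far_av (hd : 5 ≤ d) : ∃ Λ : ℕ, 5 ≤ Λ ∧ ∀ (μ : Measure (ℕ → V d)), IsSRWLaw μ 0 → ∀ n : ℕ, 1 ≤ n → ∀ S ⊆ cube 0 n,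
    ∀ (x : V d) (j : Fin d), (Λ * n : ℝ) ≤ |(x j : ℝ)| → 1/2 ≤ av μ S x := by
  have hK := KK_ge hd
  obtain ⟨Λ, hΛ⟩ := exists_nat_gt (5 + 2 * (d + KK d))
  have hd' : (5:ℝ) ≤ d := by exact_mod_cast hd
  refine ⟨Λ, ?_, ?_⟩
  · have : (5:ℝ) ≤ Λ := by linarith
    exact_mod_cast this
  intro μ hμ n hn S hS x j hx
  have hn' : (1:ℝ) ≤ n := by exact_mod_cast hn
  set κ : ℝ := (d * (n:ℝ)^2 + KK d) ^ (-((d:ℝ)-2)/2) with hκ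
  have hpos : 0 < d * (n:ℝ)^2 + KK d := by positivity
  have hκ0 : 0 < κ := Real.rpow_pos_of_pos hpos _
  have h1 : 1 - ff x / κ ≤ av μ S x := by
    refine le_av (u := fun x => 1 - ff x / κ) (by omega) hμ ?_ ?_ ?_ x
    · intro x
      have := div_nonneg (ff_pos hd x).le hκ0.le
      linarith
    · intro x hx
      have h2 : κ ≤ ff x := by
        have := cube_nsq (hS hx)
        rw [sub_zero] at this
        have := nsq_nonneg x
        exact Real.rpow_le_rpow_of_nonpos (by linarith) (by linarith) (by linarith)
      have : 1 ≤ ff x / κ := (one_le_div hκ0).2 h2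
      linarith
    · intro x _
      have h3 := ff_shift_super hd 0 x
      simp only [sub_zero] at h3
      rw [avg_sub, avg_const (by omega)]
      have : avg (fun y => ff y / κ) x = avg ff x / κ := by
        simp_rw [div_eq_mul_inv, mul_comm _ κ⁻¹]; rw [avg_smul]
      rw [this]
      have := div_le_div_of_nonneg_right h3 hκ0.le
      linarith
  have h2 : ff x ≤ 1/2 * κ := by
    refine rpow_ratio hd hpos (by norm_num) (by norm_num) ?_
    have h4 := sq_le_nsq x j
    rw [← sq_abs] at h4
    have h5 : (Λ * n : ℝ)^2 ≤ nsq x := (pow_le_pow_left₀ (by positivity) hx 2).trans h4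
    have h6 : 2 * (d + KK d) ≤ (Λ:ℝ)^2 := by nlinarith
    have : 2 * (d + KK d) * (n:ℝ)^2 ≤ (Λ:ℝ)^2 * (n:ℝ)^2 := mul_le_mul_of_nonneg_right h6 (by positivity)
    have h7 : KK d * 1 ≤ KK d * (n:ℝ)^2 := mul_le_mul_of_nonneg_left (by nlinarith) (by linarith)
    rw [mul_pow] at h5
    linarith
  have : ff x / κ ≤ 1/2 := (div_le_iff₀ hκ0).2 h2
  linarith

lemma avg_lin (hd : 0 < d) (j : Fin d) (a b : ℝ) (x : V d) : avg (fun y => a * (y j : ℝ) + b) x = a * (x j : ℝ) + b := by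
  rw [avg_add, avg_const hd, avg_smul]
  congr 2
  unfold avg
  have : ∀ i : Fin d, (((x + eV i) j : ℤ) : ℝ) + (((x - eV i) j : ℤ) : ℝ) = 2 * x j := by
    intro i; simp only [Pi.add_apply, Pi.sub_apply]; push_cast; ring
  simp_rw [this]
  have hd' : (d:ℝ) ≠ 0 := by positivity
  simp; field_simp

lemma mid_av (hd : 5 ≤ d) : ∃ c : ℝ, 0 < c ∧ ∀ (μ : Measure (ℕ → V d)), IsSRWLaw μ 0 → ∀ n : ℕ, 1 ≤ n → ∀ S ⊆ cube 0 n,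
    ∀ (x : V d), x ∉ cube 0 (4 * n - 1) → x ∈ cube 0 (4 * n) → c ≤ av μ S x := by
  obtain ⟨Λ, hΛ5, hΛ⟩ := far_av hd
  have hΛ' : (5:ℝ) ≤ Λ := by exact_mod_cast hΛ5
  refine ⟨1 / (2 * Λ), by positivity, ?_⟩
  intro μ hμ n hn S hS x hx1 hx2
  have hn' : (1:ℝ) ≤ n := by exact_mod_cast hn
  simp only [cube, Set.mem_ofPred_eq, not_forall, not_le, Pi.zero_apply, sub_zero] at hx1 hx2
  obtain ⟨j, hj⟩ := hx1
  obtain ⟨τ, hτ, hτx⟩ : ∃ τ : ℤ, (τ = 1 ∨ τ = -1) ∧ τ * x j = 4 * n := by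
    have h1 := hx2 j
    rcases le_total 0 (x j) with h | h
    · refine ⟨1, Or.inl rfl, ?_⟩
      rw [abs_of_nonneg h] at h1 hj; push_cast at *; omega
    · refine ⟨-1, Or.inr rfl, ?_⟩
      rw [abs_of_nonpos h] at h1 hj; push_cast at *; omega
  set A : ℝ := 1 / (2 * Λ * n) with hA
  have hA0 : 0 < A := by positivity
  let Λs : Set (V d) := {y | n < τ * y j ∧ ∀ i, |y i| < Λ * n}
  have key : ∀ y ∈ Λs, (A * τ) * y j + (-(A * n)) - av μ S y ≤ 0 := by
    refine maxprin (u := fun y => (A * τ) * y j + (-(A * n)) - av μ S y) (by omega) ?_ ?_ ?_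
    · refine (cube_finite 0 (Λ * n)).subset fun y hy i => ?_
      have := hy.2 i; push_cast; simp; exact this.le
    · intro y hy
      rw [avg_sub, avg_lin (by omega), ← av_eq (by omega) hμ]
      intro hyS
      have h1 := hS hyS j
      have h2 := hy.1
      simp only [Pi.zero_apply, sub_zero] at h1
      rw [abs_le] at h1
      rcases hτ with rfl | rfl <;> omega
    · intro y hy hnb
      have hnb' : ∃ y' ∈ Λs, ∀ k, |y k - y' k| ≤ 1 := by
        obtain ⟨i, h | h⟩ := hnb
        · refine ⟨_, h, fun k => ?_⟩
          simp [eV_apply]; split_ifs <;> simp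
        · refine ⟨_, h, fun k => ?_⟩
          simp [eV_apply]; split_ifs <;> simp
      obtain ⟨y', hy', hdist⟩ := hnb'
      have hav := av_nonneg (μ := μ) S y
      by_cases h1 : n < τ * y j
      · have h2 : ∃ i, (Λ * n : ℤ) ≤ |y i| := by
          by_contra hcon
          push Not at hcon
          exact hy ⟨h1, hcon⟩
        obtain ⟨i, hi⟩ := h2
        have h3 := hΛ μ hμ n hn S hS y i (by exact_mod_cast hi)
        have h4 : τ * y j ≤ Λ * n := by
          have h5 := hdist j
          have h6 := hy'.2 j
          rw [abs_le] at h5; rw [abs_lt] at h6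
          rcases hτ with rfl | rfl <;> omega
        have h4' : (τ:ℝ) * y j ≤ Λ * n := by exact_mod_cast h4
        have : A * (τ * y j) ≤ A * (Λ * n) := mul_le_mul_of_nonneg_left h4' hA0.le
        have e : A * (Λ * n) = 1/2 := by rw [hA]; field_simp
        have : 0 ≤ A * n := by positivity
        linarith
      · have h1' : (τ:ℝ) * y j ≤ n := by push Not at h1; exact_mod_cast h1
        have : A * (τ * y j) ≤ A * n := mul_le_mul_of_nonneg_left h1' hA0.le
        linarith
  have hxΛ : x ∈ Λs := by
    refine ⟨by rw [hτx]; omega, fun i => (hx2 i).trans_lt ?_⟩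
    push_cast; nlinarith
  have h := key x hxΛ
  have hτx' : (τ:ℝ) * x j = 4 * n := by exact_mod_cast hτx
  have e : A * τ * x j = A * (4 * n) := by rw [mul_assoc, hτx']
  have e2 : A * n = 1 / (2 * Λ) := by rw [hA]; field_simp
  have : A * (4 * n) = 4 * (A * n) := by ring
  have : 0 < 1 / (2 * (Λ:ℝ)) := by positivity
  linarith

lemma le_exit_iff (D : Set (V d)) (ω : ℕ → V d) (j : ℕ) : (j : ENat) ≤ exitTimeE D ω ↔ ∀ k < j, ω k ∈ D := by
  unfold exitTimeE
  split_ifs with h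
  · rw [Nat.cast_le, Nat.le_find_iff]; simp
  · push Not at h; simp [h]

lemma meas_abe (D S : Set (V d)) : MeasurableSet {ω : ℕ → V d | avoidBeforeExit D S ω} := by
  have : {ω : ℕ → V d | avoidBeforeExit D S ω} = ⋂ j : ℕ, ({ω | ∀ k < j, ω k ∈ D}ᶜ ∪ {ω | ω j ∈ Sᶜ}) := by
    ext ω; simp only [avoidBeforeExit, le_exit_iff, Set.mem_ofPred_eq, Set.mem_iInter, Set.mem_union, Set.mem_compl_iff]
    exact forall_congr' fun j => by tauto
  rw [this]
  refine MeasurableSet.iInter fun j => MeasurableSet.union (MeasurableSet.compl ?_) (meas_at j _)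
  have : {ω : ℕ → V d | ∀ k < j, ω k ∈ D} = ⋂ k, ⋂ (_ : k < j), {ω | ω k ∈ D} := by ext; simp
  rw [this]
  exact MeasurableSet.iInter fun k => MeasurableSet.iInter fun _ => meas_at k _

lemma meas_abep (D S : Set (V d)) : MeasurableSet {ω : ℕ → V d | avoidBeforeExitPos D S ω} := by
  have : {ω : ℕ → V d | avoidBeforeExitPos D S ω} = ⋂ j : ℕ, ⋂ (_ : 1 ≤ j), ({ω | ∀ k < j, ω k ∈ D}ᶜ ∪ {ω | ω j ∈ Sᶜ}) := by
    ext ω; simp only [avoidBeforeExitPos, le_exit_iff, Set.mem_ofPred_eq, Set.mem_iInter, Set.mem_union, Set.mem_compl_iff]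
    exact forall_congr' fun j => by tauto
  rw [this]
  refine MeasurableSet.iInter fun j => MeasurableSet.iInter fun _ => MeasurableSet.union (MeasurableSet.compl ?_) (meas_at j _)
  have : {ω : ℕ → V d | ∀ k < j, ω k ∈ D} = ⋂ k, ⋂ (_ : k < j), {ω | ω k ∈ D} := by ext; simp
  rw [this]
  exact MeasurableSet.iInter fun k => MeasurableSet.iInter fun _ => meas_at k _

lemma esc_bound (hd : 5 ≤ d) : ∃ C : ℝ, 0 < C ∧ ∀ (μ : Measure (ℕ → V d)), IsSRWLaw μ 0 → ∀ n : ℕ, 1 ≤ n → ∀ D : Set (V d), cube 0 (4 * n) ⊆ D →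
    ∀ S ⊆ cube 0 n, ∀ x0 ∈ cube 0 n, (Pm μ x0).real {ω | avoidBeforeExitPos D S ω} ≤ C * avg (av μ S) x0 := by
  obtain ⟨c, hc, hmid⟩ := mid_av hd
  refine ⟨1 / c, by positivity, ?_⟩
  intro μ hμ n hn D hD S hS x0 hx0
  set e : V d → ℝ := fun x => (Pm μ x).real {ω | avoidBeforeExit D S ω} with he
  have he1 : ∀ x, e x ≤ 1 := fun x => real_le_one hμ x _
  have heS : ∀ x ∈ S, e x = 0 := fun x hx => real_zero_start hμ x fun ω h0 h => by
    have := h 0 (by simp); rw [h0] at this; exact this hx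
  have heq : ∀ x ∈ D, x ∉ S → e x = avg e x := by
    intro x hx hxS
    rw [he]; simp only
    rw [first_step (by omega) hμ x (meas_abe D S)]
    congr 1; funext y; congr 1; ext ω
    simp only [Set.mem_ofPred_eq, avoidBeforeExit, le_exit_iff]
    constructor
    · intro h j hj
      exact h (j+1) fun k hk => by
        cases k with
        | zero => exact hx
        | succ k => exact hj k (by omega)
    · intro h j hj
      cases j with
      | zero => exact hxS
      | succ j => exact h j fun k hk => hj (k+1) (by omega)
  have hsub : cube (0 : V d) (4 * n - 1) ⊆ cube 0 (4 * n) := fun y hy i => (hy i).trans (by exact_mod_cast Nat.sub_le _ _)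
  have key : ∀ x ∈ cube 0 (4 * n - 1) \ S, e x - 1 / c * av μ S x ≤ 0 := by
    refine maxprin (u := fun x => e x - 1 / c * av μ S x) (by omega) ((cube_finite _ _).subset Set.sdiff_subset) ?_ ?_
    · intro x hx
      rw [avg_sub, avg_smul, ← av_eq (by omega) hμ hx.2, ← heq x (hD (hsub hx.1)) hx.2]
    · intro x hx hnb
      by_cases hxS : x ∈ S
      · rw [heS x hxS, av_zero hμ hxS]; simp
      · have hx4 : x ∉ cube 0 (4 * n - 1) := fun h => hx ⟨h, hxS⟩
        have hx5 : x ∈ cube 0 (4 * n) := by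
          intro k
          have : ∃ y' ∈ cube (0 : V d) (4 * n - 1), ∀ k, |x k - y' k| ≤ 1 := by
            obtain ⟨i, h | h⟩ := hnb
            · refine ⟨_, h.1, fun k => ?_⟩
              simp [eV_apply]; split_ifs <;> simp
            · refine ⟨_, h.1, fun k => ?_⟩
              simp [eV_apply]; split_ifs <;> simp
          obtain ⟨y', hy', hdist⟩ := this
          have h1 := hy' k
          have h2 := hdist k
          simp only [Pi.zero_apply, sub_zero] at *
          rw [abs_le] at *
          omega
        have := hmid μ hμ n hn S hS x hx4 hx5
        have h3 : 1 ≤ 1 / c * av μ S x := by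
          rw [one_div, ← div_eq_inv_mul, one_le_div hc]; exact this
        linarith [he1 x]
  have hnb : ∀ y, (∀ k, |y k - x0 k| ≤ 1) → e y ≤ 1 / c * av μ S y := by
    intro y hy
    by_cases hyS : y ∈ S
    · rw [heS y hyS]; exact mul_nonneg (by positivity) (av_nonneg _ _)
    · have := key y ⟨fun k => ?_, hyS⟩
      · linarith
      · have h1 := hx0 k
        have h2 := hy k
        simp only [Pi.zero_apply, sub_zero] at *
        rw [abs_le] at *
        omega
  rw [first_step (by omega) hμ x0 (meas_abep D S), ← avg_smul]
  have hx0D : x0 ∈ D := hD fun k => (hx0 k).trans (by push_cast; omega)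
  have : avg (fun y => (Pm μ y).real {ω | cns x0 ω ∈ {ω | avoidBeforeExitPos D S ω}}) x0 = avg e x0 := by
    congr 1; funext y; rw [he]; simp only; congr 1; ext ω
    simp only [Set.mem_ofPred_eq, avoidBeforeExit, avoidBeforeExitPos, le_exit_iff]
    constructor
    · intro h j hj
      exact h (j+1) (by omega) fun k hk => by
        cases k with
        | zero => exact hx0D
        | succ k => exact hj k (by omega)
    · intro h j hj1 hj
      cases j with
      | zero => omega
      | succ j => exact h j fun k hk => hj (k+1) (by omega)
  rw [this]
  refine avg_mono' fun i => ⟨hnb _ fun k => ?_, hnb _ fun k => ?_⟩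
  · simp [eV_apply]; split_ifs <;> simp
  · simp [eV_apply]; split_ifs <;> simp

end Escape

end

section
section GLsec

variable {μ : Measure (ℕ → V d)}

def G3 (S B Q : Set (V d)) (z : V d) : Set (ℕ → V d) :=
  {ω | ∃ s, ω s = z ∧ (∀ j ≤ s, ω j ∉ S ∧ ω j ∈ Q) ∧ ∀ l > s, ω l ∉ B ∧ ω l ∉ S ∧ ∀ j ≤ s, ω l ≠ ω j}

def G0 (S Q : Set (V d)) (z : V d) : Set (ℕ → V d) :=
  {ω | ∃ s, ω s = z ∧ (∀ j, 1 ≤ j → j ≤ s → ω j ∉ S ∧ ω j ∈ Q) ∧ ∀ l > s, ω l ∉ S ∧ ∀ j ≤ s, ω l ≠ ω j}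

lemma mm_at (j : ℕ) (A : Set (V d)) : Measurable fun ω : ℕ → V d => ω j ∈ A := measurableSet_setOfPred.1 (meas_at j A)
lemma mm_ne (l j : ℕ) : Measurable fun ω : ℕ → V d => ω l ≠ ω j := by
  have : {ω : ℕ → V d | ω l ≠ ω j} = (fun ω : ℕ → V d => (ω l, ω j)) ⁻¹' {q | q.1 ≠ q.2} := rfl
  refine measurableSet_setOfPred.1 ?_
  rw [this]
  exact ((measurable_pi_apply l).prodMk (measurable_pi_apply j)) (Set.to_countable _).measurableSet
lemma mm_imp {p : Prop} {f : (ℕ → V d) → Prop} (h : Measurable f) : Measurable fun ω => p → f ω := by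
  by_cases hp : p <;> simp [hp, h]

lemma meas_G3 (S B Q : Set (V d)) (z : V d) : MeasurableSet (G3 S B Q z) := by
  refine measurableSet_setOfPred.2 (Measurable.exists fun s => ?_)
  refine (mm_at s {z}).and ?_
  refine Measurable.and (Measurable.forall fun j => mm_imp (Measurable.and (mm_at j Sᶜ) (mm_at j Q))) ?_
  refine Measurable.forall fun l => mm_imp ?_
  exact (mm_at l Bᶜ).and ((mm_at l Sᶜ).and (Measurable.forall fun j => mm_imp (mm_ne l j)))

lemma meas_G0 (S Q : Set (V d)) (z : V d) : MeasurableSet (G0 S Q z) := by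
  refine measurableSet_setOfPred.2 (Measurable.exists fun s => ?_)
  refine (mm_at s {z}).and ?_
  refine Measurable.and (Measurable.forall fun j => mm_imp (mm_imp (Measurable.and (mm_at j Sᶜ) (mm_at j Q)))) ?_
  refine Measurable.forall fun l => mm_imp ?_
  exact (mm_at l Sᶜ).and (Measurable.forall fun j => mm_imp (mm_ne l j))

lemma prob_cyl_av (hd : 0 < d) (hμ : IsSRWLaw μ 0) (γ : ℕ → V d) (hγ : ∀ j, adj (γ j) (γ (j+1))) (k : ℕ) (S : Set (V d)) :
    (Pm μ (γ 0)).real {ω | (∀ j ≤ k, ω j = γ j) ∧ ∀ l, ω (k + l) ∉ S} = ((2 * d : ℝ)⁻¹) ^ k * av μ S (γ k) := by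
  have h1 := markov hd hμ (y := γ k) (meas_av S) k (cyl γ k) (fun ω ω' h hω j hj => by rw [← h j hj]; exact hω j hj)
    (fun ω hω => hω k le_rfl) (γ 0)
  have h2 : (Pm μ (γ 0)).real (cyl γ k) = ((2 * d : ℝ)⁻¹) ^ k := by
    have := (Pm_law hμ (γ 0)).2 k γ rfl (fun i _ => hγ i)
    rw [measureReal_def, cyl, this]
    simp
  rw [h2] at h1
  exact h1

lemma glow (hd : 5 ≤ d) (hμ : IsSRWLaw μ 0) {S B Q : Set (V d)} {U : Finset (V d)} (hU : ∀ y ∈ U, y ∉ S ∧ y ∈ Q) {γ : ℕ → V d}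
    (hγ : ∀ j, adj (γ j) (γ (j+1))) {k1 k2 : ℕ} (hk : k1 ≤ k2) (h1 : ∀ j ≤ k1, γ j ∉ S ∧ γ j ∈ Q)
    (h2 : ∀ j, k1 < j → j ≤ k2 → γ j ∉ B ∧ γ j ∉ S ∧ ∀ j' ≤ k1, γ j ≠ γ j') {x0 : V d}
    {M κ : ℝ} (hκ : 0 < κ) (hM : 0 ≤ M)
    (hM1 : ∀ x ∈ B, av μ S x ≤ M) (hM2 : ∀ x ∈ B, κ ≤ ff (x - x0)) (w : V d) :
    ((2 * d : ℝ)⁻¹) ^ k2 * ((av μ S (γ k2) - M / κ * ff (γ k2 - x0) - ∑ j ∈ Finset.range (k1+1), av μ S (γ j) * Green Set.univ (γ j) (γ k2)) * Green U (γ 0) w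
      - ∑ y ∈ U, ((if y ∈ (Finset.Ioc k1 k2).image γ then av μ S (γ k2) else 0) + av μ S y * Green Set.univ y (γ k2)) * (Green U y w * Green U (γ 0) y))
      ≤ (Pm μ w).real (G3 S B Q (γ k1)) := by
  have hP := Pm_prob hμ w
  set D2 : ℝ := ((2 * d : ℝ)⁻¹) ^ k2 with hD2
  have hD20 : 0 ≤ D2 := by positivity
  set v := γ k2 with hv
  set b : ℝ := av μ S v - M / κ * ff (v - x0) - ∑ j ∈ Finset.range (k1+1), av μ S (γ j) * Green Set.univ (γ j) v with hb
  set c : V d → ℝ := fun y => (if y ∈ (Finset.Ioc k1 k2).image γ then av μ S v else 0) + av μ S y * Green Set.univ y v with hc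
  have hc0 : ∀ y, 0 ≤ c y := fun y => by
    rw [hc]; refine add_nonneg ?_ (mul_nonneg (av_nonneg S y) (green_nonneg _ _ _))
    split_ifs; exacts [av_nonneg _ _, le_rfl]
  have hbv : b ≤ av μ S v := by
    have : 0 ≤ M / κ * ff (v - x0) := mul_nonneg (by positivity) (ff_pos hd _).le
    have : 0 ≤ ∑ j ∈ Finset.range (k1+1), av μ S (γ j) * Green Set.univ (γ j) v :=
      Finset.sum_nonneg fun y _ => mul_nonneg (av_nonneg S _) (green_nonneg _ _ _)
    linarith
  let ℓ1 : Finset (V d) := (Finset.range (k1+1)).image γ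
  let YY : Set (V d) → Finset (V d) := fun A => ℓ1 ∪ U.filter (· ∈ A)
  let F : Set (V d) → Set (ℕ → V d) := fun A =>
    if (∀ j, k1 < j → j ≤ k2 → ¬ (γ j ∈ U ∧ γ j ∈ A)) then {ω | (∀ j ≤ k2, ω j = γ j) ∧ ∀ l, ω (k2 + l) ∉ S ∪ B ∪ YY A} else ∅
  have hF : ∀ A, MeasurableSet (F A) := by
    intro A
    simp only [F]; split_ifs
    · refine measurableSet_setOfPred.2 (Measurable.and (Measurable.forall fun j => mm_imp (mm_at j {γ j})) ?_)
      exact Measurable.forall fun l => mm_at _ (S ∪ B ∪ YY A)ᶜ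
    · exact MeasurableSet.empty
  have hΦ : ∀ A, D2 * b - ∑ y ∈ U, D2 * c y * (if y ∈ A then 1 else 0) ≤ (Pm μ (γ 0)).real (F A) := by
    intro A
    have hsum : ∑ y ∈ U, D2 * c y * (if y ∈ A then 1 else 0) = D2 * ∑ y ∈ U, c y * (if y ∈ A then 1 else 0) := by
      rw [Finset.mul_sum]; exact Finset.sum_congr rfl fun y _ => by ring
    rw [hsum, ← mul_sub]
    simp only [F]; split_ifs with hcase
    · rw [prob_cyl_av (by omega) hμ γ hγ]
      refine mul_le_mul_of_nonneg_left ?_ hD20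
      refine le_trans ?_ (av_union hd hμ S B (YY A) x0 hκ hM hM1 hM2 v)
      have e1 : ∑ y ∈ YY A, av μ S y * Green Set.univ y v ≤ ∑ y ∈ ℓ1, av μ S y * Green Set.univ y v
          + ∑ y ∈ U.filter (· ∈ A), av μ S y * Green Set.univ y v := by
        have := Finset.sum_union_inter (s₁ := ℓ1) (s₂ := U.filter (· ∈ A)) (f := fun y => av μ S y * Green Set.univ y v)
        have h3 : 0 ≤ ∑ y ∈ ℓ1 ∩ U.filter (· ∈ A), av μ S y * Green Set.univ y v :=
          Finset.sum_nonneg fun y _ => mul_nonneg (av_nonneg S _) (green_nonneg _ _ _)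
        simp only [YY]; linarith
      have e2 : ∑ y ∈ ℓ1, av μ S y * Green Set.univ y v ≤ ∑ j ∈ Finset.range (k1+1), av μ S (γ j) * Green Set.univ (γ j) v :=
        Finset.sum_image_le_of_nonneg fun j _ => mul_nonneg (av_nonneg S _) (green_nonneg _ _ _)
      have e3 : ∑ y ∈ U.filter (· ∈ A), av μ S y * Green Set.univ y v ≤ ∑ y ∈ U, c y * (if y ∈ A then 1 else 0) := by
        rw [Finset.sum_filter]
        refine Finset.sum_le_sum fun y _ => ?_
        split_ifs
        · rw [hc, mul_one]; simp only
          refine le_add_of_nonneg_left ?_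
          split_ifs; exacts [av_nonneg _ _, le_rfl]
        · simp
      linarith
    · push Not at hcase
      obtain ⟨j, hj1, hj2, hjU, hjA⟩ := hcase
      rw [measureReal_empty]
      refine mul_nonpos_of_nonneg_of_nonpos hD20 ?_
      have : c (γ j) * (if γ j ∈ A then 1 else 0) ≤ ∑ y ∈ U, c y * (if y ∈ A then 1 else 0) :=
        Finset.single_le_sum (f := fun y => c y * (if y ∈ A then (1:ℝ) else 0))
          (fun y _ => mul_nonneg (hc0 y) (by split_ifs <;> norm_num)) hjU
      rw [if_pos hjA, mul_one] at this
      have h4 : av μ S v ≤ c (γ j) := by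
        rw [hc]; simp only
        rw [if_pos (Finset.mem_image.2 ⟨j, Finset.mem_Ioc.2 ⟨hj1, hj2⟩, rfl⟩)]
        have := mul_nonneg (av_nonneg (μ := μ) S (γ j)) (green_nonneg Set.univ (γ j) v)
        linarith
      linarith
  let E : ℕ → Set (ℕ → V d) := fun t => evPS (U : Set (V d)) (γ 0) t F
  have hEm : ∀ t, MeasurableSet (E t) := fun t => meas_evPS _ _ _ _ hF
  have hEdesc : ∀ t, ∀ ω ∈ E t, ω (t + k1) = γ k1 ∧ (∀ j ≤ t + k1, ω j ∉ S ∧ ω j ∈ Q) ∧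
      ∀ l > t + k1, ω l ∉ B ∧ ω l ∉ S ∧ ∀ j ≤ t + k1, ω l ≠ ω j := by
    rintro t ω ⟨ha, hb', hF'⟩
    simp only [F] at hF'
    split_ifs at hF' with hcase
    · obtain ⟨hp, hq⟩ := hF'
      have hmem : ∀ j ≤ t + k1, ω j ∈ YY (rng t ω) := by
        intro j hj
        simp only [YY, Finset.mem_union, Finset.mem_filter, ℓ1, Finset.mem_image, Finset.mem_range]
        by_cases hjt : j ≤ t
        · right; exact ⟨ha j hjt, ⟨j, hjt, rfl⟩⟩
        · left; refine ⟨j - t, by omega, ?_⟩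
          have := hp (j - t) (by omega)
          simp only [show t + (j - t) = j by omega] at this
          exact this.symm
      refine ⟨hp k1 hk, ?_, ?_⟩
      · intro j hj
        by_cases hjt : j ≤ t
        · exact hU _ (ha j hjt)
        · have := hp (j - t) (by omega)
          simp only [show t + (j - t) = j by omega] at this
          rw [this]; exact h1 _ (by omega)
      · intro l hl
        by_cases hl2 : l ≤ t + k2
        · have e := hp (l - t) (by omega)
          simp only [show t + (l - t) = l by omega] at e
          have h5 := h2 (l - t) (by omega) (by omega)
          rw [e]
          refine ⟨h5.1, h5.2.1, fun j hj => ?_⟩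
          have := hmem j hj
          simp only [YY, Finset.mem_union, Finset.mem_filter, ℓ1, Finset.mem_image, Finset.mem_range] at this
          rcases this with ⟨j', hj', e'⟩ | h6
          · rw [← e']; exact h5.2.2 j' (by omega)
          · intro e'
            rw [← e'] at h6
            exact hcase (l - t) (by omega) (by omega) h6
        · have := hq (l - t - k2)
          simp only [show t + (k2 + (l - t - k2)) = l by omega] at this
          simp only [Set.mem_union, not_or] at this
          exact ⟨this.1.2, this.1.1, fun j hj e => this.2 (e ▸ hmem j hj)⟩
    · exact absurd hF' (by simp)
  have hsub : ∀ t, E t ⊆ G3 S B Q (γ k1) := fun t ω hω => ⟨t + k1, hEdesc t ω hω⟩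
  have hdisj : Pairwise (Function.onFun Disjoint E) := by
    intro t t' hne
    rw [Function.onFun, Set.disjoint_left]
    intro ω h3 h4
    have a1 := hEdesc t ω h3
    have a2 := hEdesc t' ω h4
    rcases lt_or_gt_of_ne hne with h | h
    · exact (a1.2.2 (t' + k1) (by omega)).2.2 (t + k1) le_rfl (by rw [a1.1, a2.1])
    · exact (a2.2.2 (t + k1) (by omega)).2.2 (t' + k1) le_rfl (by rw [a1.1, a2.1])
  have hlow : ∀ t, D2 * b * qk U (dl (γ 0)) t w - ∑ y ∈ U, D2 * c y * ∑ j ∈ Finset.range (t+1), qk U (dl y) j w * qk U (dl (γ 0)) (t - j) y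
      ≤ (Pm μ w).real (E t) := by
    intro t
    rw [prob_PS (by omega) hμ _ _ _ F hF]
    refine le_trans ?_ (PS_mono _ _ t w hΦ)
    rw [PS_lin]
    refine sub_le_sub_left (Finset.sum_le_sum fun y _ => mul_le_mul_of_nonneg_left (PS_hit _ _ _ t w) (mul_nonneg hD20 (hc0 y))) _
  have hs1 := (green_summable hd (U : Set (V d)) (γ 0) w).hasSum
  have hs2 : ∀ y, HasSum (fun t => ∑ j ∈ Finset.range (t+1), qk U (dl y) j w * qk U (dl (γ 0)) (t - j) y) (Green U y w * Green U (γ 0) y) := by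
    intro y
    have n1 : Summable fun t => ‖qk (U : Set (V d)) (dl y) t w‖ := (green_summable hd (U : Set (V d)) y w).norm
    have n2 : Summable fun t => ‖qk (U : Set (V d)) (dl (γ 0)) t y‖ := (green_summable hd (U : Set (V d)) (γ 0) y).norm
    have := tsum_mul_tsum_eq_tsum_sum_range_of_summable_norm n1 n2
    unfold Green GF
    rw [this]
    exact (summable_norm_sum_mul_range_of_summable_norm n1 n2).of_norm.hasSum
  have htot := (hs1.mul_left (D2 * b)).sub (hasSum_sum (s := U) fun y _ => (hs2 y).mul_left (D2 * c y))
  have hfin : D2 * (b * Green U (γ 0) w - ∑ y ∈ U, c y * (Green U y w * Green U (γ 0) y)) =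
      D2 * b * (∑' t, qk U (dl (γ 0)) t w) - ∑ y ∈ U, D2 * c y * (Green U y w * Green U (γ 0) y) := by
    rw [mul_sub, Finset.mul_sum, ← mul_assoc]; congr 1
    exact Finset.sum_congr rfl fun y _ => by ring
  rw [hfin]
  refine le_of_tendsto' htot.tendsto_sum_nat fun T => ?_
  calc _ ≤ ∑ t ∈ Finset.range T, (Pm μ w).real (E t) := Finset.sum_le_sum fun t _ => hlow t
    _ = (Pm μ w).real (⋃ t ∈ Finset.range T, E t) := by
      rw [measureReal_biUnion_finset (fun t _ t' _ h => hdisj h) (fun t _ => hEm t)]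
    _ ≤ _ := measureReal_mono (Set.iUnion₂_subset fun t _ => hsub t)

end GLsec

end

section
section Est

lemma abs_lt_of_nsq {x y : V d} {R : ℝ} (hR : 0 ≤ R) (h : nsq (x - y) < R ^ 2) (j : Fin d) : |(x j : ℝ) - y j| < R := by
  have h1 := sq_le_nsq (x - y) j
  simp only [Pi.sub_apply] at h1
  push_cast at h1
  exact abs_lt_of_sq_lt_sq (by linarith) hR

lemma rpow_sq_nat (hd : 5 ≤ d) {ρ : ℝ} (hρ : 0 < ρ) : (ρ ^ 2) ^ (-((d:ℝ)-2)/2) = (ρ ^ (d-2))⁻¹ := by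
  rw [← Real.rpow_natCast ρ 2, ← Real.rpow_mul hρ.le, ← Real.rpow_natCast ρ (d-2), ← Real.rpow_neg hρ.le]
  congr 1
  rw [Nat.cast_sub (by omega)]; push_cast; ring

lemma rpow_sq_nat1 (hd : 5 ≤ d) {ρ : ℝ} (hρ : 0 < ρ) : (ρ ^ 2) ^ (-((d:ℝ)-4)/2) = (ρ ^ (d-4))⁻¹ := by
  rw [← Real.rpow_natCast ρ 2, ← Real.rpow_mul hρ.le, ← Real.rpow_natCast ρ (d-4), ← Real.rpow_neg hρ.le]
  congr 1
  rw [Nat.cast_sub (by omega)]; push_cast; ring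

lemma ff_le (hd : 5 ≤ d) {ρ : ℝ} (hρ : 0 < ρ) {x : V d} (h : ρ ^ 2 ≤ nsq x) : ff x ≤ (ρ ^ (d-2))⁻¹ := by
  rw [← rpow_sq_nat hd hρ]
  have hd' : (5:ℝ) ≤ d := by exact_mod_cast hd
  exact Real.rpow_le_rpow_of_nonpos (by positivity) (by linarith [KK_ge hd]) (by linarith)

lemma ff1_le (hd : 5 ≤ d) {ρ : ℝ} (hρ : 0 < ρ) {x : V d} (h : ρ ^ 2 ≤ nsq x) : ff1 x ≤ (ρ ^ (d-4))⁻¹ := by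
  rw [← rpow_sq_nat1 hd hρ]
  have hd' : (5:ℝ) ≤ d := by exact_mod_cast hd
  exact Real.rpow_le_rpow_of_nonpos (by positivity) (by linarith [KK_ge hd]) (by linarith)

def gam (i : Fin d) (σ : ℤ) (u : V d) (t : ℤ) : V d := fun k => u k + if k = i then t * σ else 0

lemma ht_gam {σ : ℤ} (hσ : σ = 1 ∨ σ = -1) (i : Fin d) (x0 u : V d) (t : ℤ) : ht i σ x0 (gam i σ u t) = ht i σ x0 u + t := by
  simp only [ht, gam, if_true]; rcases hσ with rfl | rfl <;> ring

lemma gam_ne {i j : Fin d} (h : j ≠ i) (σ : ℤ) (u : V d) (t : ℤ) : gam i σ u t j = u j := by simp [gam, h]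

lemma gam_gam (i : Fin d) (σ : ℤ) (u : V d) (s t : ℤ) : gam i σ (gam i σ u s) t = gam i σ u (s + t) := by
  ext k; simp only [gam]; split_ifs <;> ring

lemma gam_zero (i : Fin d) (σ : ℤ) (u : V d) : gam i σ u 0 = u := by ext k; simp [gam]

lemma nsq_gam {σ : ℤ} (hσ : σ = 1 ∨ σ = -1) (i : Fin d) (u : V d) (s t : ℤ) : nsq (gam i σ u s - gam i σ u t) = ((s - t : ℤ) : ℝ) ^ 2 := by
  unfold nsq
  rw [Finset.sum_eq_single i]
  · simp only [Pi.sub_apply, gam, if_true]; push_cast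
    rcases hσ with rfl | rfl <;> push_cast <;> ring
  · intro j _ hj; simp [gam, hj]
  · simp

lemma adj_gam {σ : ℤ} (hσ : σ = 1 ∨ σ = -1) (i : Fin d) (u : V d) (t : ℤ) : adj (gam i σ u t) (gam i σ u (t + 1)) := by
  unfold adj
  rw [Finset.sum_eq_single i]
  · simp only [gam, if_true]; rcases hσ with rfl | rfl <;> ring_nf <;> norm_num
  · intro j _ hj; simp [gam, hj]
  · simp

lemma ht_abs {σ : ℤ} (hσ : σ = 1 ∨ σ = -1) (i : Fin d) (x y : V d) : |ht i σ x y| = |y i - x i| := by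
  unfold ht; rcases hσ with rfl | rfl <;> simp [abs_sub_comm]

lemma ht_sub {σ : ℤ} (hσ : σ = 1 ∨ σ = -1) (i : Fin d) (x0 x y : V d) : |((ht i σ x0 x : ℤ) : ℝ) - (ht i σ x0 y : ℤ)| = |(x i : ℝ) - y i| := by
  unfold ht; push_cast
  rw [← mul_sub, abs_mul]
  rcases hσ with rfl | rfl <;> simp

lemma mem_cube_iff {σ : ℤ} (hσ : σ = 1 ∨ σ = -1) (i : Fin d) (x y : V d) (r : ℕ) :
    y ∈ cube x r ↔ |ht i σ x y| ≤ r ∧ ∀ j, j ≠ i → |y j - x j| ≤ r := by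
  rw [ht_abs hσ]
  refine ⟨fun h => ⟨h i, fun j _ => h j⟩, fun h j => ?_⟩
  by_cases e : j = i
  · subst e; exact h.1
  · exact h.2 j e

def Ub (i : Fin d) (σ : ℤ) (x0 : V d) (m : ℕ) : Set (V d) := {y | y ∈ cube x0 (m-1) ∧ 1 ≤ ht i σ x0 y}

lemma greenU_lower (hd : 5 ≤ d) (D : ℕ) (hD : 32 ≤ D) : ∃ (c1 : ℝ) (M1 : ℕ), 0 < c1 ∧ ∀ (i : Fin d) (σ : ℤ), (σ = 1 ∨ σ = -1) → ∀ (x0 w u : V d) (m : ℕ),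
    M1 ≤ m → w ∈ cube x0 (m / D + 1) → ((m / D + 1 : ℕ) : ℤ) ≤ 4 * d * ht i σ x0 w → (∀ j, j ≠ i → 4 * |u j - x0 j| ≤ m) →
    (m : ℤ) ≤ 8 * ht i σ x0 u → 4 * ht i σ x0 u ≤ 3 * m → c1 * ((m:ℝ) ^ (d-2))⁻¹ ≤ Green (Ub i σ x0 m) u w := by
  obtain ⟨c, S0, hc, hS0, hG⟩ := green_lower hd
  obtain ⟨C, S1, hC, hS1, hH⟩ := harnack_chain hd (4 * d * (200 * d * D) ^ 2)
  obtain ⟨M1, hM1⟩ := exists_nat_gt (1000 * S0 + 200 * d * D * S1 + 1000)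
  refine ⟨c / C, M1, by positivity, ?_⟩
  intro i σ hσ x0 w u m hm hw hw2 hu hu1 hu2
  have hdD : (160:ℝ) ≤ d * D := by
    have h1 : (5:ℝ) ≤ d := by exact_mod_cast hd
    have h2 : (32:ℝ) ≤ D := by exact_mod_cast hD
    nlinarith
  have hm' : 1000 * S0 + 200 * d * D * S1 + 1000 < m := lt_of_lt_of_le hM1 (by exact_mod_cast hm)
  have hdDS : 0 ≤ 200 * d * D * S1 := by positivity
  have hm1000 : 1000 < m := by
    have : (1000:ℝ) < m := by linarith
    exact_mod_cast this
  have hm0 : (0:ℝ) < m := by linarith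
  have hmD : m / D ≤ m / 32 := Nat.div_le_div_left hD (by norm_num)
  rw [mem_cube_iff hσ i] at hw
  have hw1 := abs_le.1 hw.1
  obtain ⟨k, hk⟩ : ∃ k, k = m / 100 := ⟨_, rfl⟩
  set y0 := gam i σ u (-(k:ℤ)) with hy0
  have hhy0 : ht i σ x0 y0 = ht i σ x0 u - k := by rw [hy0, ht_gam hσ]; ring
  have hkR : (m:ℝ)/200 ≤ k := by
    have : m ≤ 200 * k := by omega
    have : (m:ℝ) ≤ 200 * k := by exact_mod_cast this
    linarith
  have hk0 : 0 < (k:ℝ) := by linarith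
  have hu1R : (m:ℝ) ≤ 8 * (ht i σ x0 u : ℝ) := by exact_mod_cast hu1
  have hu2R : 4 * (ht i σ x0 u : ℝ) ≤ 3 * m := by exact_mod_cast hu2
  have hkm : (k:ℝ) ≤ m/100 := by
    have : 100 * k ≤ m := by omega
    have : (100 * k:ℝ) ≤ m := by exact_mod_cast this
    linarith
  have g1 : c * ((m:ℝ) ^ (d-2))⁻¹ ≤ Green (Ub i σ x0 m) u y0 := by
    have h1 := hG ((2 * k:ℝ)^2) (by nlinarith) (Ub i σ x0 m) u ?_ y0 ?_
    · rw [rpow_sq_nat hd (by positivity)] at h1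
      refine le_trans ?_ h1
      gcongr
      linarith
    · intro x hx
      have hx' := abs_lt_of_nsq (by positivity) hx
      have hi := hx' i
      rw [← ht_sub hσ i x0, abs_lt] at hi
      refine ⟨(mem_cube_iff hσ i _ _ _).2 ⟨?_, fun j hj => ?_⟩, ?_⟩
      · have : |(ht i σ x0 x : ℝ)| ≤ ((m - 1 : ℕ) : ℝ) := by
          rw [Nat.cast_sub (by omega), abs_le]; push_cast; constructor <;> linarith
        exact_mod_cast this
      · have h2 := hx' j
        have h3 : 4 * |(u j : ℝ) - x0 j| ≤ m := by exact_mod_cast hu j hj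
        have : |(x j : ℝ) - x0 j| ≤ ((m - 1 : ℕ) : ℝ) := by
          have := abs_sub_le (x j : ℝ) (u j) (x0 j)
          rw [Nat.cast_sub (by omega)]; push_cast; linarith
        exact_mod_cast this
      · have : (0:ℝ) < ht i σ x0 x := by linarith
        have : (0:ℤ) < ht i σ x0 x := by exact_mod_cast this
        omega
    · have := nsq_gam hσ i u (-(k:ℤ)) 0
      rw [gam_zero] at this
      rw [hy0, this]; push_cast; apply le_of_eq; ring
  have hR0 : 0 < (m:ℝ) / (200 * d * D) := by positivity
  have hRm : (m:ℝ) / (200 * d * D) ≤ m / 200 := by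
    apply div_le_div_of_nonneg_left hm0.le (by norm_num); nlinarith
  have hwR : (m:ℝ) / (4 * d * D) ≤ ht i σ x0 w := by
    have h1 : ((m / D + 1 : ℕ) : ℝ) ≤ 4 * d * (ht i σ x0 w : ℝ) := by
      have := (Int.cast_le (R := ℝ)).2 hw2
      push_cast at this ⊢
      exact this
    have h2 : (m:ℝ) ≤ D * ((m / D + 1 : ℕ) : ℝ) := by
      have := Nat.lt_div_mul_add (a := m) (b := D) (by omega)
      have : m ≤ D * (m / D + 1) := by rw [mul_add, mul_comm]; omega
      exact_mod_cast this
    rw [div_le_iff₀ (by positivity)]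
    have : (D:ℝ) * ((m / D + 1 : ℕ) : ℝ) ≤ D * (4 * d * (ht i σ x0 w : ℝ)) := by gcongr
    linarith
  have hRw : (m:ℝ) / (200 * d * D) ≤ m / (4 * d * D) := by
    apply div_le_div_of_nonneg_left hm0.le (by positivity); nlinarith
  have hwhi : ht i σ x0 w ≤ ht i σ x0 u - k := by omega
  have g2 : Green (Ub i σ x0 m) u y0 ≤ C * Green (Ub i σ x0 m) u w := by
    refine hH (((m:ℝ) / (200 * d * D))^2) ?_ _ (green_nonneg _ _) y0 w ?_ ?_
    · have h1 : S1 ≤ (m:ℝ) / (200 * d * D) := by rw [le_div_iff₀ (by positivity)]; linarith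
      nlinarith
    · have : nsq (y0 - w) ≤ d * (2 * m : ℝ)^2 := by
        refine nsq_le_of_abs fun j => ?_
        have : |y0 j - w j| ≤ 2 * m := by
          by_cases e : j = i
          · subst e
            have h1 : |ht j σ w y0| = |ht j σ x0 y0 - ht j σ x0 w| := by unfold ht; congr 1; ring
            rw [← ht_abs hσ, h1, abs_le]; omega
          · have h1 := hw.2 j e
            have h2 := hu j e
            rw [hy0, gam_ne e]
            rw [abs_le] at *
            have := abs_le.1 (show |u j - x0 j| ≤ m by omega)
            omega
        simp only [Pi.sub_apply]; exact_mod_cast this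
      refine this.trans (le_of_eq ?_)
      have : (d:ℝ) * D ≠ 0 := by positivity
      have : (d:ℝ) ≠ 0 := by positivity
      have : (D:ℝ) ≠ 0 := by intro h; rw [h] at hdD; simp at hdD; linarith
      field_simp; try ring
    · intro q hq x hx
      have hx' := abs_lt_of_nsq hR0.le hx
      have hi := hx' i
      rw [← ht_sub hσ i x0, abs_lt] at hi
      have q1 : ht i σ x0 q ≤ ht i σ x0 u - k := ht_uIcc_le hσ (by omega) hwhi (hq i)
      have q2 : (m:ℝ) / (4 * d * D) ≤ ht i σ x0 q := by
        have : min (ht i σ x0 y0) (ht i σ x0 w) ≤ ht i σ x0 q := ht_uIcc hσ (min_le_left _ _) (min_le_right _ _) (hq i)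
        have h3 : (m:ℝ) / (4 * d * D) ≤ ht i σ x0 y0 := by
          rw [hhy0]; push_cast
          have : (m:ℝ) / (4 * d * D) ≤ m / 16 := by
            apply div_le_div_of_nonneg_left hm0.le (by norm_num); nlinarith
          linarith
        rcases min_le_iff.1 this with h | h
        · have : (ht i σ x0 y0 : ℝ) ≤ ht i σ x0 q := by exact_mod_cast h
          linarith
        · have : (ht i σ x0 w : ℝ) ≤ ht i σ x0 q := by exact_mod_cast h
          linarith
      have q1R : (ht i σ x0 q : ℝ) ≤ ht i σ x0 u - k := by exact_mod_cast q1
      have hxU : x ∈ Ub i σ x0 m := by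
        refine ⟨(mem_cube_iff hσ i _ _ _).2 ⟨?_, fun j hj => ?_⟩, ?_⟩
        · have : |(ht i σ x0 x : ℝ)| ≤ ((m - 1 : ℕ) : ℝ) := by
            rw [Nat.cast_sub (by omega), abs_le]; push_cast; constructor <;> linarith
          exact_mod_cast this
        · have h2 := hx' j
          have h3 := hu j hj
          have h4 := hw.2 j hj
          have h5 := hq j
          have h6 : |q j - x0 j| ≤ m / 4 := by
            rw [hy0, gam_ne hj, Set.mem_uIcc] at h5
            have h7 := abs_le.1 (show |u j - x0 j| ≤ m / 4 by omega)
            rw [abs_le] at *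
            omega
          have h6' : 4 * |(q j : ℝ) - x0 j| ≤ m := by
            have : 4 * |q j - x0 j| ≤ m := by omega
            exact_mod_cast this
          have : |(x j : ℝ) - x0 j| ≤ ((m - 1 : ℕ) : ℝ) := by
            have := abs_sub_le (x j : ℝ) (q j) (x0 j)
            rw [Nat.cast_sub (by omega)]; push_cast; linarith
          exact_mod_cast this
        · have : (0:ℝ) < ht i σ x0 x := by linarith
          have : (0:ℤ) < ht i σ x0 x := by exact_mod_cast this
          omega
      rw [green_eq hd hxU]
      have : x ≠ u := by
        rintro rfl
        linarith
      simp [dl, this]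
  rw [div_mul_eq_mul_div, div_le_iff₀ (by positivity), mul_comm _ C]
  exact g1.trans g2

end Est

end

section
section Qlow

lemma inv_pow_le {x : ℝ} (hx : 1 ≤ x) {k : ℕ} (hk : k ≠ 0) : (x ^ k)⁻¹ ≤ x⁻¹ :=
  inv_anti₀ (by linarith) (le_self_pow₀ hx hk)

lemma ht_nsq {σ : ℤ} (hσ : σ = 1 ∨ σ = -1) (i : Fin d) (x0 x y : V d) {R : ℝ} (hR : 0 ≤ R) (h : R ≤ |(ht i σ x0 x : ℝ) - ht i σ x0 y|) : R ^ 2 ≤ nsq (x - y) := by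
  have := ht_sq_le hσ i x0 x y
  push_cast at this
  refine le_trans ?_ this
  rw [← sq_abs ((ht i σ x0 x : ℝ) - ht i σ x0 y)]
  exact pow_le_pow_left₀ hR h 2

lemma ff_ht (hd : 5 ≤ d) {σ : ℤ} (hσ : σ = 1 ∨ σ = -1) (i : Fin d) (x0 x y : V d) {R : ℝ} (hR : 0 < R) (h : R ≤ |(ht i σ x0 x : ℝ) - ht i σ x0 y|) :
    ff (x - y) ≤ (R ^ (d-2))⁻¹ := ff_le hd hR (ht_nsq hσ i x0 x y hR.le h)

lemma ff1_ht (hd : 5 ≤ d) {σ : ℤ} (hσ : σ = 1 ∨ σ = -1) (i : Fin d) (x0 x y : V d) {R : ℝ} (hR : 1 ≤ R) (h : R ≤ |(ht i σ x0 x : ℝ) - ht i σ x0 y|) :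
    ff1 (x - y) ≤ R⁻¹ := (ff1_le hd (by linarith) (ht_nsq hσ i x0 x y (by linarith) h)).trans (inv_pow_le hR (by omega))

lemma err2 (hd : 5 ≤ d) {C C2 : ℝ} (hC : 0 < C) (hG : ∀ (U : Set (V d)) (y x : V d), Green U y x ≤ C * ff (x - y)) (_hC2 : 0 < C2)
    (hconv : ∀ (U : Set (V d)) (S : Finset (V d)) (x v : V d), ∑ y ∈ S, ff (y - v) * Green U y x ≤ C2 * ff1 (x - v))
    {σ : ℤ} (hσ : σ = 1 ∨ σ = -1) {i : Fin d} {x0 w u v : V d} {m : ℝ} (hm : 0 < m) (U : Finset (V d))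
    (hwu : m / 16 ≤ ht i σ x0 u - ht i σ x0 w) :
    ∑ y ∈ U, Green Set.univ y v * (Green U y w * Green U u y) ≤ C ^ 2 * 32 ^ (d-2) * (m ^ (d-2))⁻¹ * (C2 * (ff1 (v - u) + ff1 (v - w))) := by
  have hb : ((m/32)^(d-2))⁻¹ = 32 ^ (d-2) * (m ^ (d-2))⁻¹ := by rw [div_pow, inv_div, div_eq_mul_inv]
  have key : ∀ y, Green Set.univ y v * (Green U y w * Green U u y) ≤
      C ^ 2 * 32 ^ (d-2) * (m ^ (d-2))⁻¹ * ((ff (y - u) + ff (y - w)) * Green Set.univ y v) := by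
    intro y
    have f1 := ff_pos hd (y - u)
    have f2 := ff_pos hd (y - w)
    have h1 : Green U y w * Green U u y ≤ (C * ff (y - w)) * (C * ff (y - u)) := by
      refine mul_le_mul ?_ (hG _ _ _) (green_nonneg _ _ _) (by positivity)
      rw [ff_sub_comm]; exact hG _ _ _
    have h2 : ff (y - w) * ff (y - u) ≤ 32 ^ (d-2) * (m ^ (d-2))⁻¹ * (ff (y - u) + ff (y - w)) := by
      have hp : 0 ≤ 32 ^ (d-2) * (m ^ (d-2))⁻¹ := by positivity
      by_cases h : m / 32 ≤ |(ht i σ x0 y : ℝ) - ht i σ x0 w|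
      · have := ff_ht hd hσ i x0 y w (by positivity) h
        rw [hb] at this
        nlinarith
      · have h' : m / 32 ≤ |(ht i σ x0 y : ℝ) - ht i σ x0 u| := by
          push Not at h
          rw [abs_lt] at h
          rw [le_abs]; right; linarith
        have := ff_ht hd hσ i x0 y u (by positivity) h'
        rw [hb] at this
        nlinarith
    have h3 := green_nonneg Set.univ y v
    calc _ ≤ Green Set.univ y v * ((C * ff (y - w)) * (C * ff (y - u))) := by gcongr
      _ = Green Set.univ y v * C ^ 2 * (ff (y - w) * ff (y - u)) := by ring
      _ ≤ Green Set.univ y v * C ^ 2 * (32 ^ (d-2) * (m ^ (d-2))⁻¹ * (ff (y - u) + ff (y - w))) := by gcongr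
      _ = _ := by ring
  refine (Finset.sum_le_sum fun y _ => key y).trans ?_
  rw [← Finset.mul_sum]
  refine mul_le_mul_of_nonneg_left ?_ (by positivity)
  simp only [add_mul, Finset.sum_add_distrib, mul_add]
  exact add_le_add (hconv _ _ _ _) (hconv _ _ _ _)

lemma err1 (hd : 5 ≤ d) {C : ℝ} (hC : 0 < C) (hG : ∀ (U : Set (V d)) (y x : V d), Green U y x ≤ C * ff (x - y))
    {σ : ℤ} (hσ : σ = 1 ∨ σ = -1) {i : Fin d} {x0 w u : V d} {m : ℝ} (hm : 0 < m) (U : Finset (V d))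
    (hwu : m / 16 ≤ ht i σ x0 u - ht i σ x0 w) {K : ℕ} (hK : 1 ≤ K) :
    ∑ y ∈ U, (if y ∈ (Finset.Ioc K (2*K)).image (fun j : ℕ => gam i σ u j) then 1 else 0) * (Green U y w * Green U u y) ≤ C ^ 2 * 32 ^ (d-2) * (m ^ (d-2))⁻¹ * (K:ℝ)⁻¹ := by
  have hK' : (1:ℝ) ≤ K := by exact_mod_cast hK
  have hb : ((m/32)^(d-2))⁻¹ = 32 ^ (d-2) * (m ^ (d-2))⁻¹ := by rw [div_pow, inv_div, div_eq_mul_inv]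
  have nn : ∀ y, 0 ≤ Green U y w * Green U u y := fun y => mul_nonneg (green_nonneg _ _ _) (green_nonneg _ _ _)
  simp only [ite_mul, one_mul, zero_mul]
  rw [← Finset.sum_filter]
  calc _ ≤ ∑ y ∈ (Finset.Ioc K (2*K)).image (fun j : ℕ => gam i σ u j), Green U y w * Green U u y := by
        refine Finset.sum_le_sum_of_subset_of_nonneg (fun y hy => (Finset.mem_filter.1 hy).2) fun y _ _ => nn y
    _ ≤ ∑ j ∈ Finset.Ioc K (2*K), Green U (gam i σ u (j:ℤ)) w * Green U u (gam i σ u (j:ℤ)) := Finset.sum_image_le_of_nonneg fun y _ => nn _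
    _ ≤ ∑ j ∈ Finset.Ioc K (2*K), C ^ 2 * 32 ^ (d-2) * (m ^ (d-2))⁻¹ * ((K:ℝ)^2)⁻¹ := by
        refine Finset.sum_le_sum fun j hj => ?_
        have hj1 := (Finset.mem_Ioc.1 hj).1
        have hj' : (K:ℝ) ≤ j := by exact_mod_cast hj1.le
        have a1 : Green U (gam i σ u (j:ℤ)) w ≤ C * (32 ^ (d-2) * (m ^ (d-2))⁻¹) := by
          refine (hG _ _ _).trans (mul_le_mul_of_nonneg_left ?_ hC.le)
          rw [← hb]
          refine ff_ht hd hσ i x0 _ _ (by positivity) ?_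
          rw [ht_gam hσ, le_abs]; right; push_cast; linarith
        have a2 : Green U u (gam i σ u (j:ℤ)) ≤ C * ((K:ℝ)^2)⁻¹ := by
          refine (hG _ _ _).trans (mul_le_mul_of_nonneg_left ?_ hC.le)
          refine (ff_ht hd hσ i x0 _ _ (R := K) (by linarith) ?_).trans ?_
          · rw [ht_gam hσ, le_abs]; left; push_cast; linarith
          · exact inv_anti₀ (by positivity) (pow_le_pow_right₀ hK' (by omega))
        calc _ ≤ (C * (32 ^ (d-2) * (m ^ (d-2))⁻¹)) * (C * ((K:ℝ)^2)⁻¹) :=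
              mul_le_mul a1 a2 (green_nonneg _ _ _) (by positivity)
          _ = _ := by ring
    _ = _ := by
        rw [Finset.sum_const, Nat.card_Ioc, nsmul_eq_mul, show 2 * K - K = K by omega]
        field_simp

lemma kap_arith {dd Cg K m D r n : ℝ} (hCg : 1 ≤ Cg) (hd : 5 ≤ dd) (hD : 1024 * dd * Cg + 32 < D) (hr : 0 ≤ r) (hrm : D * r ≤ m) (hm1 : 1 ≤ m)
    (hK : 1024 * Cg * K ≤ m) (hn : (m/8)^2 ≤ n) (hK0 : 0 ≤ K) : dd * r ^ 2 + K ≤ 1 / (8 * Cg) * (n + K) := by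
  have hdc : 0 ≤ 1024 * dd * Cg := by positivity
  have q2 : D * (D * r^2) ≤ m^2 := by
    have : (D * r)^2 ≤ m^2 := pow_le_pow_left₀ (mul_nonneg (by linarith) hr) hrm 2
    linarith [this, (by ring : (D * r)^2 = D * (D * r^2))]
  have h5 : (1024 * dd * Cg) * r^2 ≤ D * r^2 := mul_le_mul_of_nonneg_right (by linarith) (by positivity)
  have h6 : 1 * (D * r^2) ≤ D * (D * r^2) := mul_le_mul_of_nonneg_right (by linarith) (mul_nonneg (by linarith) (by positivity))
  have q4 : m ≤ m^2 := by nlinarith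
  rw [div_mul_eq_mul_div, one_mul, le_div_iff₀ (by positivity)]
  have e1 : (dd * r^2 + K) * (8 * Cg) = (1024 * dd * Cg * r^2 + 1024 * Cg * K) / 128 := by ring
  have e2 : (m/8)^2 = m^2/64 := by ring
  linarith

lemma gam_sum {a b : ℝ} (ha : 1 ≤ a) (hb : 0 ≤ b) (h : 16 * b ≤ a) : (a + 1) * (a ^ 2)⁻¹ * b ≤ 1 / 8 := by
  rw [← div_eq_mul_inv, div_mul_eq_mul_div, div_le_iff₀ (by positivity)]
  nlinarith

set_option maxHeartbeats 1000000 in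
lemma Qlow (hd : 5 ≤ d) : ∃ (Cg c : ℝ) (D M0 : ℕ), 1 ≤ Cg ∧ 0 < c ∧ 32 ≤ D ∧ ∀ (μ : Measure (ℕ → V d)), IsSRWLaw μ 0 → ∀ (i : Fin d) (σ : ℤ), (σ = 1 ∨ σ = -1) →
    ∀ (x0 : V d) (S : Set (V d)), Below i σ x0 S → ∀ m : ℕ, M0 ≤ m → ∀ z : V d, (∀ j, j ≠ i → 4 * |z j - x0 j| ≤ m) → (m:ℤ) - 2 ≤ 4 * ht i σ x0 z →
    4 * ht i σ x0 z ≤ 3 * m → ∃ v : V d, (∀ y ∈ cube x0 m, av μ S y ≤ Cg * av μ S v) ∧ ∀ w ∈ cube x0 (m / D + 1), ((m / D + 1 : ℕ) : ℤ) ≤ 4 * d * ht i σ x0 w →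
      c * ((m:ℝ) ^ (d-2))⁻¹ * av μ S v ≤ (Pm μ w).real (G3 S (cube x0 (m / D)) (cube x0 (m-1)) z) := by
  obtain ⟨Cg, hCg, hgs⟩ := gsup hd
  obtain ⟨C, hC, hGf⟩ := green_facts hd
  have hG : ∀ (U : Set (V d)) (y x : V d), Green U y x ≤ C * ff (x - y) := fun U y x => (hGf U y x).2
  obtain ⟨C2, hC2, hconv⟩ := green_conv hd
  obtain ⟨D, hDgt⟩ := exists_nat_gt (1024 * d * Cg + 32)
  have hd' : (5:ℝ) ≤ d := by exact_mod_cast hd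
  have hdc : 0 < d * Cg := by positivity
  have hD32 : 32 ≤ D := by
    have : (32:ℝ) ≤ D := by nlinarith
    exact_mod_cast this
  have hD32' : (32:ℝ) ≤ D := by exact_mod_cast hD32
  obtain ⟨c1, M1, hc1, hGl⟩ := greenU_lower hd D hD32
  set E : ℝ := C ^ 2 * 32 ^ (d-2) * (1 + 2 * Cg * C2) with hE
  have hE0 : 0 < E := by positivity
  obtain ⟨K, hKgt⟩ := exists_nat_gt (16 * Cg * C + 4 * E / c1 + 1)
  have hE1 : 0 < 4 * E / c1 := by positivity
  have hK1 : (1:ℝ) ≤ K := by have : 0 < 16 * Cg * C := by positivity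
                             linarith
  have hK1n : 1 ≤ K := by exact_mod_cast hK1
  have hK2 : 16 * Cg * C ≤ K := by linarith
  have hK3 : E * (K:ℝ)⁻¹ ≤ c1 / 4 := by
    have : 4 * E / c1 ≤ K := by have : 0 < 16 * Cg * C := by positivity
                                linarith
    rw [div_le_iff₀ hc1] at this
    rw [← div_eq_mul_inv, div_le_iff₀ (by linarith)]; linarith
  have hKK := KK_ge hd
  obtain ⟨M2, hM2⟩ := exists_nat_gt (1024 * Cg * KK d)
  refine ⟨Cg, ((2 * d : ℝ)⁻¹) ^ (2*K) * (c1 / 4), D, M1 + M2 + 1000 * (K + 1), hCg, by positivity, hD32, ?_⟩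
  intro μ hμ i σ hσ x0 S hS m hm z hz hz1 hz2
  have hmD : m / D ≤ m / 32 := Nat.div_le_div_left hD32 (by norm_num)
  have hmK : 1000 * (K + 1) ≤ m := le_trans (Nat.le_add_left _ _) hm
  have hm0 : (0:ℝ) < m := by have : 0 < m := by omega
                             exact_mod_cast this
  set u := gam i σ z (-(K:ℤ)) with hu
  set v := gam i σ z (K:ℤ) with hv
  let γ : ℕ → V d := fun j => gam i σ u (j:ℤ)
  have hhu : ht i σ x0 u = ht i σ x0 z - K := by rw [hu, ht_gam hσ]; ring
  have hhv : ht i σ x0 v = ht i σ x0 z + K := by rw [hv, ht_gam hσ]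
  have hhγ : ∀ j : ℕ, ht i σ x0 (γ j) = ht i σ x0 z - K + j := fun j => by simp only [γ]; rw [ht_gam hσ, hhu]
  have hγne : ∀ (j : ℕ) (k : Fin d), k ≠ i → γ j k = z k := fun j k hk => by simp only [γ]; rw [gam_ne hk, hu, gam_ne hk]
  have hγ0 : γ 0 = u := by simp only [γ]; exact gam_zero _ _ _
  have hγ1 : γ K = z := by simp only [γ]; rw [hu, gam_gam]; simp [gam_zero]
  have hγ2 : γ (2*K) = v := by simp only [γ]; rw [hu, gam_gam, hv]; congr 1; push_cast; ring
  set a := av μ S v with ha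
  have ha0 : 0 ≤ a := av_nonneg S v
  have hga : ∀ y ∈ cube x0 m, av μ S y ≤ Cg * a := by
    intro y hy
    refine hgs μ hμ i σ hσ x0 S hS m (by omega) y v hy ?_ (by omega) (by omega)
    intro j hj; rw [hv, gam_ne hj]; have := hz j hj; have := abs_nonneg (z j - x0 j); omega
  refine ⟨v, hga, ?_⟩
  intro w hw hw2
  have hwh := abs_le.1 ((mem_cube_iff hσ i _ _ _).1 hw).1
  have hcm : ∀ r : ℕ, r ≤ m → cube x0 r ⊆ cube x0 m := fun r hr y hy j => (hy j).trans (by exact_mod_cast hr)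
  have hUf : (Ub i σ x0 m).Finite := (cube_finite x0 (m-1)).subset fun y hy => hy.1
  set U := hUf.toFinset with hUdef
  have hUc : (U : Set (V d)) = Ub i σ x0 m := hUf.coe_toFinset
  have hUm : ∀ y, y ∈ U ↔ y ∈ Ub i σ x0 m := fun y => hUf.mem_toFinset
  have hnS : ∀ y, 1 ≤ ht i σ x0 y → y ∉ S := fun y hy hyS => by have := hS.le y hyS; omega
  set r := m / D with hr
  have hrR : (r:ℝ) ≤ m / D := Nat.cast_div_le
  set κ : ℝ := (d * (r:ℝ)^2 + KK d) ^ (-((d:ℝ)-2)/2) with hκ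
  have hκ0 : 0 < κ := Real.rpow_pos_of_pos (by positivity) _
  have hgl := glow hd hμ (S := S) (B := cube x0 r) (Q := cube x0 (m-1)) (U := U) (γ := γ) (k1 := K) (k2 := 2 * K) (x0 := x0)
    (M := Cg * a) (κ := κ) ?_ (fun j => by simp only [γ]; push_cast; exact adj_gam hσ i u j) (by omega) ?_ ?_ hκ0 (by positivity) ?_ ?_ w
  rotate_left
  · intro y hy; rw [hUm] at hy; exact ⟨hnS y hy.2, hy.1⟩
  · intro j hj
    have h1 := hhγ j
    refine ⟨hnS _ (by omega), (mem_cube_iff hσ i _ _ _).2 ⟨by rw [h1, abs_le]; omega, fun k hk => ?_⟩⟩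
    rw [hγne j k hk]; have := hz k hk; omega
  · intro j hj1 hj2
    have h1 := hhγ j
    refine ⟨fun h => ?_, hnS _ (by omega), fun j' hj' e => ?_⟩
    · have := abs_le.1 ((mem_cube_iff hσ i _ _ _).1 h).1
      omega
    · have h2 := hhγ j'
      rw [e] at h1; omega
  · intro x hx; exact hga x (hcm r (by omega) hx)
  · intro x hx
    have := cube_nsq hx
    exact Real.rpow_le_rpow_of_nonpos (by have := nsq_nonneg (x - x0); linarith) (by linarith) (by linarith)
  rw [hγ0, hγ1, hγ2] at hgl
  refine le_trans ?_ hgl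
  rw [show ((2 * d : ℝ)⁻¹) ^ (2*K) * (c1 / 4) * ((m:ℝ) ^ (d-2))⁻¹ * a = ((2 * d : ℝ)⁻¹) ^ (2*K) * (c1 / 4 * ((m:ℝ) ^ (d-2))⁻¹ * a) by ring]
  refine mul_le_mul_of_nonneg_left ?_ (by positivity)
  set P := ((m:ℝ) ^ (d-2))⁻¹ with hP
  have hP0 : 0 < P := by positivity
  have hzR1 : (m:ℝ) - 2 ≤ 4 * ht i σ x0 z := by exact_mod_cast hz1
  have hmKR : 1000 * ((K:ℝ) + 1) ≤ m := by exact_mod_cast hmK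
  have hwu : (m:ℝ) / 16 ≤ ht i σ x0 u - ht i σ x0 w := by
    have h1 : (m:ℤ) ≤ 16 * (ht i σ x0 u - ht i σ x0 w) := by omega
    have : (m:ℝ) ≤ 16 * (ht i σ x0 u - ht i σ x0 w) := by exact_mod_cast h1
    linarith
  have e0 : Cg * a / κ * ff (v - x0) ≤ a / 8 := by
    have hnv : ((m:ℝ)/8)^2 ≤ nsq (v - x0) := by
      refine ht_nsq hσ i x0 _ _ (by positivity) ?_
      have h0 : ht i σ x0 x0 = 0 := by simp [ht]
      rw [h0, hhv, le_abs]; left; push_cast; linarith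
    have h1 : ff (v - x0) ≤ 1 / (8 * Cg) * κ := by
      refine rpow_ratio hd (by positivity) (by positivity) ?_ ?_
      · rw [div_le_one (by positivity)]; linarith
      · have hM2' : 1024 * Cg * KK d ≤ m := hM2.le.trans (by exact_mod_cast (by linarith : M2 ≤ m))
        refine kap_arith hCg hd' hDgt (by positivity) ?_ (by linarith) hM2' hnv (by linarith)
        have := hrR; rw [le_div_iff₀ (by linarith)] at this; linarith
    calc _ ≤ Cg * a / κ * (1 / (8 * Cg) * κ) := by gcongr
      _ = a / 8 := by field_simp
  have eS : ∑ j ∈ Finset.range (K+1), av μ S (γ j) * Green Set.univ (γ j) v ≤ a / 8 := by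
    calc _ ≤ ∑ j ∈ Finset.range (K+1), (Cg * a) * (C * ((K:ℝ)^2)⁻¹) := by
          refine Finset.sum_le_sum fun j hj => ?_
          have hj' : j ≤ K := by have := Finset.mem_range.1 hj; omega
          refine mul_le_mul (hga _ ?_) ?_ (green_nonneg _ _ _) (by positivity)
          · refine (mem_cube_iff hσ i _ _ _).2 ⟨by rw [hhγ j, abs_le]; omega, fun k hk => ?_⟩
            rw [hγne j k hk]; have := hz k hk; omega
          · refine (hG _ _ _).trans (mul_le_mul_of_nonneg_left ?_ hC.le)
            refine (ff_ht hd hσ i x0 _ _ (R := K) (by linarith) ?_).trans ?_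
            · rw [hhγ j, hhv, le_abs]; left; push_cast
              have : (j:ℝ) ≤ K := by exact_mod_cast hj'
              linarith
            · exact inv_anti₀ (by positivity) (pow_le_pow_right₀ hK1 (by omega))
      _ = ((K:ℝ)+1) * ((K:ℝ)^2)⁻¹ * (Cg * C) * a := by
          rw [Finset.sum_const, Finset.card_range, nsmul_eq_mul]; push_cast; ring
      _ ≤ 1 / 8 * a := by
          refine mul_le_mul_of_nonneg_right ?_ ha0
          exact gam_sum hK1 (by positivity) (by linarith)
      _ = _ := by ring
  have eG : c1 * P ≤ Green U u w := by
    rw [hUc]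
    refine hGl i σ hσ x0 w u m (by omega) hw hw2 ?_ (by omega) (by omega)
    intro j hj; rw [hu, gam_ne hj]; exact hz j hj
  have eB := err1 hd hC hG hσ hm0 U hwu hK1n
  have eC := err2 hd hC hG hC2 hconv hσ (v := v) hm0 U hwu
  have eSum : ∑ y ∈ U, ((if y ∈ (Finset.Ioc K (2*K)).image γ then a else 0) + av μ S y * Green Set.univ y v) * (Green U y w * Green U u y)
      ≤ a * ∑ y ∈ U, (if y ∈ (Finset.Ioc K (2*K)).image (fun j : ℕ => gam i σ u j) then 1 else 0) * (Green U y w * Green U u y)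
        + Cg * a * ∑ y ∈ U, Green Set.univ y v * (Green U y w * Green U u y) := by
    rw [Finset.mul_sum, Finset.mul_sum, ← Finset.sum_add_distrib]
    refine Finset.sum_le_sum fun y hy => ?_
    have h1 : 0 ≤ Green U y w * Green U u y := mul_nonneg (green_nonneg _ _ _) (green_nonneg _ _ _)
    have h2 := green_nonneg Set.univ y v
    have h3 := hga y (hcm (m-1) (by omega) ((hUm y).1 hy).1)
    have h4 : av μ S y * Green Set.univ y v * (Green U y w * Green U u y) ≤ Cg * a * (Green Set.univ y v * (Green U y w * Green U u y)) := by
      rw [mul_assoc]; exact mul_le_mul_of_nonneg_right h3 (by positivity)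
    rw [add_mul]
    refine add_le_add (le_of_eq ?_) h4
    simp only [γ]; split_ifs <;> ring
  have f1 : ff1 (v - u) ≤ (K:ℝ)⁻¹ := by
    refine ff1_ht hd hσ i x0 _ _ hK1 ?_
    rw [hhv, hhu, le_abs]; left; push_cast; linarith
  have f2 : ff1 (v - w) ≤ (K:ℝ)⁻¹ := by
    refine ff1_ht hd hσ i x0 _ _ hK1 ?_
    rw [hhu] at hwu; push_cast at hwu
    rw [hhv, le_abs]; left; push_cast; linarith
  have eC' : ∑ y ∈ U, Green Set.univ y v * (Green U y w * Green U u y) ≤ C ^ 2 * 32 ^ (d-2) * P * (C2 * ((K:ℝ)⁻¹ + (K:ℝ)⁻¹)) :=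
    eC.trans (by gcongr)
  have hb : a / 2 ≤ a - Cg * a / κ * ff (v - x0) - ∑ j ∈ Finset.range (K+1), av μ S (γ j) * Green Set.univ (γ j) v := by linarith
  have t1 : a / 2 * (c1 * P) ≤ (a - Cg * a / κ * ff (v - x0) - ∑ j ∈ Finset.range (K+1), av μ S (γ j) * Green Set.univ (γ j) v) * Green U u w :=
    mul_le_mul hb eG (by positivity) (by linarith)
  have t2 : a * ∑ y ∈ U, (if y ∈ (Finset.Ioc K (2*K)).image (fun j : ℕ => gam i σ u j) then 1 else 0) * (Green U y w * Green U u y)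
        + Cg * a * ∑ y ∈ U, Green Set.univ y v * (Green U y w * Green U u y) ≤ a * P * (c1 / 4) := by
    calc _ ≤ a * (C ^ 2 * 32 ^ (d-2) * P * (K:ℝ)⁻¹) + Cg * a * (C ^ 2 * 32 ^ (d-2) * P * (C2 * ((K:ℝ)⁻¹ + (K:ℝ)⁻¹))) := by gcongr
      _ = a * P * (E * (K:ℝ)⁻¹) := by rw [hE]; ring
      _ ≤ _ := by gcongr
  linarith

end Qlow

end

section
section Core

lemma avg_sqc (hd : 0 < d) (j : Fin d) (a : ℝ) (x : V d) : avg (fun y => ((y j : ℝ) - a) ^ 2) x = ((x j : ℝ) - a) ^ 2 + 1 / d := by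
  unfold avg
  have : ∀ i : Fin d, ((((x + eV i) j : ℤ) : ℝ) - a)^2 + ((((x - eV i) j : ℤ) : ℝ) - a)^2 = 2 * ((x j : ℝ) - a)^2 + (if j = i then 2 else 0) := by
    intro i; simp only [Pi.add_apply, Pi.sub_apply, eV_apply]; push_cast; split_ifs <;> ring
  simp_rw [this]
  have hd' : (d:ℝ) ≠ 0 := by positivity
  rw [Finset.sum_add_distrib]; simp; field_simp

lemma avg_nsqs (hd : 0 < d) (x0 x : V d) : avg (fun y => nsq (y - x0)) x = nsq (x - x0) + 1 := by
  unfold nsq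
  rw [avg_sum]
  have : ∀ j ∈ (Finset.univ : Finset (Fin d)), avg (fun y => (((y - x0) j : ℤ) : ℝ) ^ 2) x = (((x - x0) j : ℤ) : ℝ) ^ 2 + 1 / d := by
    intro j _
    have := avg_sqc hd j (x0 j : ℝ) x
    simp only [Pi.sub_apply]; push_cast; exact this
  rw [Finset.sum_congr rfl this, Finset.sum_add_distrib]
  have hd' : (d:ℝ) ≠ 0 := by positivity
  simp; field_simp

noncomputable def phi (i : Fin d) (σ : ℤ) (x0 : V d) (r : ℝ) (x : V d) : ℝ := d * r * ht i σ x0 x + d * (ht i σ x0 x : ℝ) ^ 2 - nsq (x - x0)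

lemma avg_phi (hd : 0 < d) {σ : ℤ} (hσ : σ = 1 ∨ σ = -1) (i : Fin d) (x0 : V d) (r : ℝ) (x : V d) : avg (phi i σ x0 r) x = phi i σ x0 r x := by
  have hs : ∀ y : V d, (ht i σ x0 y : ℝ) ^ 2 = ((y i : ℝ) - x0 i) ^ 2 := by
    intro y; unfold ht; rcases hσ with rfl | rfl <;> push_cast <;> ring
  have e : phi i σ x0 r = fun y => ((d * r * σ) * (y i : ℝ) + (- d * r * σ * x0 i)) + d * ((y i : ℝ) - x0 i) ^ 2 - nsq (y - x0) := by
    funext y; unfold phi; rw [hs]; unfold ht; push_cast; ring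
  rw [e, avg_sub, avg_nsqs hd, avg_add, avg_lin hd, avg_smul, avg_sqc hd]
  have hd' : (d:ℝ) ≠ 0 := by positivity
  field_simp; ring

lemma avg_G3 (hd : 0 < d) {μ : Measure (ℕ → V d)} (hμ : IsSRWLaw μ 0) {S B Q : Set (V d)} {z x : V d} (hB : x ∈ B) (hS : x ∉ S) (hQ : x ∈ Q) :
    avg (fun y => (Pm μ y).real (G3 S B Q z)) x ≤ (Pm μ x).real (G3 S B Q z) := by
  rw [first_step hd hμ x (meas_G3 S B Q z)]
  refine avg_mono fun y => ?_
  have := Pm_prob hμ y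
  refine measureReal_mono ?_
  rintro ω ⟨s, h1, h2, h3⟩
  refine ⟨s+1, h1, ?_, ?_⟩
  · rintro (_ | j) hj
    · exact ⟨hS, hQ⟩
    · exact h2 j (by omega)
  · rintro (_ | l) hl
    · omega
    · obtain ⟨a1, a2, a3⟩ := h3 l (by omega)
      refine ⟨a1, a2, ?_⟩
      rintro (_ | j) hj
      · rintro (e : ω l = x); exact a1 (e ▸ hB)
      · exact a3 j (by omega)

lemma avg_G0 (hd : 0 < d) {μ : Measure (ℕ → V d)} (hμ : IsSRWLaw μ 0) {S B Q : Set (V d)} {z x : V d} (hB : x ∈ B) :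
    avg (fun y => (Pm μ y).real (G3 S B Q z)) x ≤ (Pm μ x).real (G0 S Q z) := by
  rw [first_step hd hμ x (meas_G0 S Q z)]
  refine avg_mono fun y => ?_
  have := Pm_prob hμ y
  refine measureReal_mono ?_
  rintro ω ⟨s, h1, h2, h3⟩
  refine ⟨s+1, h1, ?_, ?_⟩
  · rintro (_ | j) hj0 hj
    · omega
    · exact h2 j (by omega)
  · rintro (_ | l) hl
    · omega
    · obtain ⟨a1, a2, a3⟩ := h3 l (by omega)
      refine ⟨a2, ?_⟩
      rintro (_ | j) hj
      · rintro (e : ω l = x); exact a1 (e ▸ hB)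
      · exact a3 j (by omega)

lemma cube_nbr {x0 x : V d} {r : ℕ} (h : x ∈ cube x0 r) (i : Fin d) : x + eV i ∈ cube x0 (r+1) ∧ x - eV i ∈ cube x0 (r+1) := by
  constructor <;> intro j <;> have h1 := abs_le.1 (h j) <;> simp only [Pi.add_apply, Pi.sub_apply, eV_apply] <;> rw [abs_le] <;> push_cast <;>
    split_ifs <;> constructor <;> linarith

lemma phi_neg {dd r h n : ℝ} (hd : 1 ≤ dd) (hr : 0 ≤ r) (h0 : h ≤ 0) (h1 : -r ≤ h) (hn : h ^ 2 ≤ n) : dd * r * h + dd * h ^ 2 - n ≤ 0 := by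
  nlinarith [mul_nonneg (by linarith : 0 ≤ -h) (by linarith : 0 ≤ h + r), mul_nonneg (mul_nonneg (by linarith : 0 ≤ -h) (by linarith : 0 ≤ h + r)) (by linarith : 0 ≤ dd - 1)]

lemma phi_bad1 {dd r h n : ℝ} (h1 : h = -r) (hn : h ^ 2 ≤ n) : dd * r * h + dd * h ^ 2 - n ≤ - r ^ 2 / 2 := by
  subst h1; nlinarith [sq_nonneg r]

lemma phi_bad2 {dd r h n : ℝ} (hd : 1 ≤ dd) (hr : 0 ≤ r) (h1 : -r ≤ h) (h2 : 4 * dd * h ≤ r) (hn : h ^ 2 + r ^ 2 ≤ n) : dd * r * h + dd * h ^ 2 - n ≤ - r ^ 2 / 2 := by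
  by_cases h0 : h ≤ 0
  · have := phi_neg hd hr h0 h1 le_rfl
    nlinarith [sq_nonneg r]
  · push Not at h0
    have a1 : dd * r * h ≤ r ^ 2 / 4 := by nlinarith
    have a2 : dd * h ^ 2 ≤ r ^ 2 / 4 := by
      have : h ≤ r := by nlinarith
      nlinarith
    nlinarith [sq_nonneg h]

lemma phi_good {dd r h n : ℝ} (hd : 1 ≤ dd) (hr : 0 ≤ r) (h1 : |h| ≤ r) (hn : 0 ≤ n) : dd * r * h + dd * h ^ 2 - n ≤ 2 * dd * r ^ 2 := by
  have h2 := abs_le.1 h1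
  have : h ^ 2 ≤ r ^ 2 := by nlinarith
  have : dd * r * h ≤ dd * r * r := mul_le_mul_of_nonneg_left h2.2 (by positivity)
  nlinarith

lemma two_sq_le_nsq {i j : Fin d} (h : j ≠ i) (x : V d) : (x i : ℝ) ^ 2 + (x j : ℝ) ^ 2 ≤ nsq x := by
  unfold nsq
  rw [← Finset.sum_pair (f := fun k => (x k : ℝ)^2) h.symm]
  exact Finset.sum_le_sum_of_subset_of_nonneg (Finset.subset_univ _) fun _ _ _ => sq_nonneg _

set_option maxHeartbeats 1000000 in
lemma coreLarge (hd : 5 ≤ d) : ∃ (c : ℝ) (M0 : ℕ), 0 < c ∧ ∀ (μ : Measure (ℕ → V d)), IsSRWLaw μ 0 → ∀ (i : Fin d) (σ : ℤ), (σ = 1 ∨ σ = -1) →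
    ∀ (x0 : V d) (S : Set (V d)), Below i σ x0 S → ∀ m : ℕ, M0 ≤ m → ∀ z : V d, (∀ j, j ≠ i → 4 * |z j - x0 j| ≤ m) → (m:ℤ) - 2 ≤ 4 * ht i σ x0 z →
    4 * ht i σ x0 z ≤ 3 * m → c * ((m:ℝ) ^ (d-2))⁻¹ * avg (av μ S) x0 ≤ (Pm μ x0).real (G0 S (cube x0 (m-1)) z) := by
  obtain ⟨Cg, c, D, M0, hCg, hc, hD, hQ⟩ := Qlow hd
  have hd0 : 0 < d := by omega
  have hd' : (5:ℝ) ≤ d := by exact_mod_cast hd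
  refine ⟨c / (Cg * (1 + 4 * d)), M0 + 2, by positivity, ?_⟩
  intro μ hμ i σ hσ x0 S hS m hm z hz hz1 hz2
  obtain ⟨v, hv, hQ⟩ := hQ μ hμ i σ hσ x0 S hS m (by omega) z hz hz1 hz2
  set Q := cube x0 (m-1) with hQdef
  obtain ⟨r, hr⟩ : ∃ r, r = m / D := ⟨_, rfl⟩
  rw [← hr] at hQ
  have hrm : r + 1 ≤ m - 1 ∨ r = 0 := by
    have : r ≤ m / 32 := hr ▸ Nat.div_le_div_left hD (by norm_num)
    omega
  have hrm' : r ≤ m - 1 ∧ r + 1 ≤ m := by omega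
  have hcm : ∀ {s t : ℕ}, s ≤ t → cube x0 s ⊆ cube x0 t := fun hst y hy j => (hy j).trans (by exact_mod_cast hst)
  set B := cube x0 r with hB
  have hx0B : x0 ∈ B := fun j => by simp
  set g := av μ S with hg
  set P := ((m:ℝ) ^ (d-2))⁻¹ with hP
  have hP0 : 0 < P := by have : 0 < m := by omega
                         positivity
  have hgn : ∀ x, 0 ≤ g x := fun x => av_nonneg S x
  rcases (hgn v).eq_or_lt with hg0 | hg0
  · have h1 : avg g x0 ≤ 0 := by
      rw [← avg_const hd0 0 x0]
      refine avg_mono' fun j => ?_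
      have := cube_nbr hx0B j
      have h2 := hv _ (hcm hrm'.2 this.1)
      have h3 := hv _ (hcm hrm'.2 this.2)
      rw [← hg0, mul_zero] at h2 h3
      exact ⟨h2, h3⟩
    exact (mul_nonpos_of_nonneg_of_nonpos (by positivity) h1).trans measureReal_nonneg
  set M := Cg * g v with hM
  have hM0 : 0 < M := by positivity
  set k' := c * P * g v with hk
  have hk0 : 0 < k' := by positivity
  let Qf : V d → ℝ := fun x => (Pm μ x).real (G3 S B Q z)
  have hQf0 : ∀ x, 0 ≤ Qf x := fun x => measureReal_nonneg
  set R : ℝ := (r:ℝ) + 1 with hR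
  have hR0 : 0 < R := by positivity
  let u : V d → ℝ := fun x => M⁻¹ * g x + 2 / R ^ 2 * phi i σ x0 R x - (1 + 4 * d) / k' * Qf x
  have havg : ∀ x, avg u x = M⁻¹ * avg g x + 2 / R ^ 2 * phi i σ x0 R x - (1 + 4 * d) / k' * avg Qf x := by
    intro x
    simp only [u]
    rw [avg_sub, avg_add, avg_smul, avg_smul, avg_smul, avg_phi hd0 hσ]
  have hgM : ∀ x ∈ cube x0 (r+1), M⁻¹ * g x ≤ 1 := by
    intro x hx
    rw [inv_mul_le_iff₀ hM0, mul_one]; exact hv x (hcm hrm'.2 hx)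
  have hcoef : 0 ≤ (1 + 4 * d) / k' := by positivity
  have hcoef2 : 0 ≤ 2 / R ^ 2 := by positivity
  have hout : ∀ x ∈ cube x0 (r+1), x ∉ B \ S → u x ≤ 0 := by
    intro x hx hxn
    have hq := mul_nonneg hcoef (hQf0 x)
    have hcb := (mem_cube_iff hσ i _ _ _).1 hx
    have habs : |(ht i σ x0 x : ℝ)| ≤ R := by rw [hR]; exact_mod_cast hcb.1
    have habs' := abs_le.1 habs
    have hh : (ht i σ x0 x : ℝ) ^ 2 = (((x - x0) i : ℤ) : ℝ)^2 := by
      unfold ht; rcases hσ with rfl | rfl <;> push_cast <;> simp only [Pi.sub_apply] <;> push_cast <;> ring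
    have hsq : (ht i σ x0 x : ℝ) ^ 2 ≤ nsq (x - x0) := by rw [hh]; exact sq_le_nsq _ _
    by_cases hxS : x ∈ S
    · have h1 : g x = 0 := av_zero hμ hxS
      have h2 : phi i σ x0 R x ≤ 0 := phi_neg (by linarith) hR0.le (by exact_mod_cast hS.le x hxS) habs'.1 hsq
      have := mul_nonpos_of_nonneg_of_nonpos hcoef2 h2
      simp only [u]; rw [h1]; linarith
    · have hxB : x ∉ B := fun h => hxn ⟨h, hxS⟩
      have h1 := hgM x hx
      by_cases hgood : ((r + 1 : ℕ) : ℤ) ≤ 4 * d * ht i σ x0 x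
      · have h2 := hQ x hx hgood
        have h3 : phi i σ x0 R x ≤ 2 * d * R ^ 2 := phi_good (by linarith) hR0.le habs (nsq_nonneg _)
        have h4 : 2 / R ^ 2 * phi i σ x0 R x ≤ 4 * d := by
          calc _ ≤ 2 / R ^ 2 * (2 * d * R ^ 2) := mul_le_mul_of_nonneg_left h3 hcoef2
            _ = _ := by field_simp; ring
        have h5 : (1 + 4 * d : ℝ) ≤ (1 + 4 * d) / k' * Qf x := by
          rw [div_mul_eq_mul_div, le_div_iff₀ hk0]
          exact mul_le_mul_of_nonneg_left h2 (by positivity)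
        simp only [u]; linarith
      · have hb : 4 * d * (ht i σ x0 x : ℝ) ≤ R := by
          have h6 : 4 * d * ht i σ x0 x ≤ ((r + 1 : ℕ) : ℤ) := by omega
          have := (Int.cast_le (R := ℝ)).2 h6
          push_cast at this; rw [hR]; exact this
        have h3 : phi i σ x0 R x ≤ - R ^ 2 / 2 := by
          have : ∃ j, ¬ |x j - x0 j| ≤ (r:ℤ) := by
            by_contra! hcon
            exact hxB hcon
          obtain ⟨j, hj⟩ := this
          have hj' : |x j - x0 j| = ((r + 1 : ℕ):ℤ) := le_antisymm (hx j) (by push_cast; omega)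
          have hjsq : (((x - x0) j : ℤ) : ℝ)^2 = R ^ 2 := by
            rw [← sq_abs]; congr 1; simp only [Pi.sub_apply]
            rw [← Int.cast_abs, hj']; push_cast; rfl
          by_cases hji : j = i
          · subst hji
            rw [← ht_abs hσ] at hj'
            have : ht j σ x0 x = -((r + 1 : ℕ):ℤ) := by
              rcases abs_eq (by positivity) |>.1 hj' with h | h
              · exfalso; apply hgood; rw [h]
                have : (0:ℤ) ≤ ((r+1 : ℕ):ℤ) := by positivity
                have : (1:ℤ) ≤ d := by exact_mod_cast hd0
                nlinarith
              · exact h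
            refine phi_bad1 ?_ hsq
            rw [this, hR]; push_cast; ring
          · refine phi_bad2 (by linarith) hR0.le habs'.1 hb ?_
            rw [hh, ← hjsq]; exact two_sq_le_nsq hji _
        have h4 : 2 / R ^ 2 * phi i σ x0 R x ≤ -1 := by
          calc _ ≤ 2 / R ^ 2 * (- R ^ 2 / 2) := mul_le_mul_of_nonneg_left h3 hcoef2
            _ = _ := by field_simp
        simp only [u]; linarith
  have hmax : ∀ x ∈ B \ S, u x ≤ 0 := by
    refine maxprin hd0 ((cube_finite x0 r).subset Set.sdiff_subset) ?_ ?_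
    · intro x hx
      rw [havg]
      have h1 : avg Qf x ≤ Qf x := avg_G3 hd0 hμ hx.1 hx.2 (hcm hrm'.1 hx.1)
      have h2 : g x = avg g x := av_eq hd0 hμ hx.2
      have := mul_le_mul_of_nonneg_left h1 hcoef
      simp only [u]; rw [← h2]; linarith
    · rintro x hx ⟨j, hj | hj⟩
      · refine hout x ?_ hx
        have := (cube_nbr hj.1 j).2
        simpa using this
      · refine hout x ?_ hx
        have := (cube_nbr hj.1 j).1
        simpa using this
  have hall : ∀ x ∈ cube x0 (r+1), u x ≤ 0 := fun x hx => by
    by_cases h : x ∈ B \ S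
    · exact hmax x h
    · exact hout x hx h
  have hfin : avg u x0 ≤ 0 := by
    rw [← avg_const hd0 0 x0]
    exact avg_mono' fun j => ⟨hall _ (cube_nbr hx0B j).1, hall _ (cube_nbr hx0B j).2⟩
  have hphi0 : phi i σ x0 R x0 = 0 := by simp [phi, ht, nsq]
  rw [havg, hphi0, mul_zero, add_zero] at hfin
  have h0 : avg Qf x0 ≤ (Pm μ x0).real (G0 S Q z) := avg_G0 hd0 hμ hx0B
  refine le_trans ?_ h0
  have h7 : M⁻¹ * avg g x0 ≤ (1 + 4 * d) / k' * avg Qf x0 := by linarith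
  rw [inv_mul_le_iff₀ hM0, hM, hk] at h7
  have e : Cg * g v * ((1 + 4 * d) / (c * P * g v) * avg Qf x0) = (Cg * (1 + 4 * d) / (c * P)) * avg Qf x0 := by field_simp
  rw [e, div_mul_eq_mul_div, le_div_iff₀ (by positivity)] at h7
  rw [div_mul_eq_mul_div, div_mul_eq_mul_div, div_le_iff₀ (by positivity)]
  linarith

end Core

end

section
section CoreS

lemma cube_eq_Icc (x : V d) (r : ℕ) : cube x r = ((Finset.Icc (fun i => x i - (r:ℤ)) (fun i => x i + (r:ℤ)) : Finset (V d)) : Set (V d)) := by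
  ext y
  simp only [Finset.coe_Icc, Set.mem_Icc, Pi.le_def, cube, Set.mem_ofPred_eq, abs_le]
  constructor
  · intro h; exact ⟨fun i => by linarith [(h i).1], fun i => by linarith [(h i).2]⟩
  · intro h i; constructor <;> linarith [h.1 i, h.2 i]

lemma cube_card (x : V d) (r : ℕ) : (Finset.Icc (fun i => x i - (r:ℤ)) (fun i => x i + (r:ℤ)) : Finset (V d)).card = (2 * r + 1) ^ d := by
  rw [Pi.card_Icc]
  have : ∀ i ∈ (Finset.univ : Finset (Fin d)), (Finset.Icc (x i - (r:ℤ)) (x i + r)).card = 2 * r + 1 := by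
    intro i _; rw [Int.card_Icc]; omega
  rw [Finset.prod_congr rfl this]; simp

lemma gam_one_eV {σ : ℤ} (hσ : σ = 1 ∨ σ = -1) (i : Fin d) (x : V d) : gam i σ x 1 = x + eV i ∨ gam i σ x 1 = x - eV i := by
  rcases hσ with rfl | rfl
  · left; ext k; simp [gam, eV_apply]
  · right; ext k; simp only [gam, Pi.sub_apply, eV_apply]; split_ifs <;> ring

set_option maxHeartbeats 1000000 in
lemma coreSmall (hd : 5 ≤ d) (M0 : ℕ) : ∃ (c : ℝ), 0 < c ∧ ∀ (μ : Measure (ℕ → V d)), IsSRWLaw μ 0 → ∀ (i : Fin d) (σ : ℤ), (σ = 1 ∨ σ = -1) →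
    ∀ (x0 : V d) (S : Set (V d)), Below i σ x0 S → ∀ m : ℕ, 2 ≤ m → m ≤ M0 → ∀ z : V d, (∀ j, j ≠ i → 4 * |z j - x0 j| ≤ m) → (m:ℤ) - 2 ≤ 4 * ht i σ x0 z →
    4 * ht i σ x0 z ≤ 3 * m → 1 ≤ ht i σ x0 z → c * avg (av μ S) x0 ≤ (Pm μ x0).real (G0 S (cube x0 (m-1)) z) := by
  obtain ⟨Cg, hCg, hgs⟩ := gsup hd
  obtain ⟨C, hC, hGf⟩ := green_facts hd
  have hG : ∀ (U : Set (V d)) (y x : V d), Green U y x ≤ C * ff (x - y) := fun U y x => (hGf U y x).2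
  have hd0 : 0 < d := by omega
  have hd' : (5:ℝ) ≤ d := by exact_mod_cast hd
  set N0 : ℝ := (((2 * M0 + 1) ^ d : ℕ) : ℝ) with hN0
  obtain ⟨K, hKgt⟩ := exists_nat_gt (2 * Cg * C * N0 + 1)
  have hN0' : 0 ≤ N0 := by positivity
  have hK1 : (1:ℝ) ≤ K := by have : 0 ≤ 2 * Cg * C * N0 := by positivity
                             linarith
  have hK1n : 1 ≤ K := by exact_mod_cast hK1
  refine ⟨(2 * d : ℝ)⁻¹ * ((2 * d : ℝ) ^ (d * (2 * M0)))⁻¹ * ((2 * d : ℝ)⁻¹) ^ K * (1 / 2) * Cg⁻¹, by positivity, ?_⟩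
  intro μ hμ i σ hσ x0 S hS m hm2 hmM z hz hz1 hz2 hz3
  set g := av μ S with hg
  set Q := cube x0 (m-1) with hQdef
  have hcm : ∀ {s t : ℕ}, s ≤ t → cube x0 s ⊆ cube x0 t := fun hst y hy j => (hy j).trans (by exact_mod_cast hst)
  set v := gam i σ z (K:ℤ) with hv
  have hhv : ht i σ x0 v = ht i σ x0 z + K := by rw [hv, ht_gam hσ]
  have hga : ∀ y ∈ cube x0 m, g y ≤ Cg * g v := by
    intro y hy
    refine hgs μ hμ i σ hσ x0 S hS m (by omega) y v hy ?_ (by omega) (by omega)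
    intro j hj; rw [hv, gam_ne hj]; have := hz j hj; have := abs_nonneg (z j - x0 j); omega
  have hgv : 0 ≤ g v := av_nonneg S v
  have hgn : ∀ x, 0 ≤ g x := fun x => av_nonneg S x
  let Y : Finset (V d) := (Finset.Icc (fun i => x0 i - ((m-1:ℕ):ℤ)) (fun i => x0 i + ((m-1:ℕ):ℤ)) : Finset (V d)).filter (fun y => ht i σ x0 y ≤ ht i σ x0 z)
  have hYm : ∀ y, y ∈ Y ↔ y ∈ Q ∧ ht i σ x0 y ≤ ht i σ x0 z := by
    intro y; simp only [Y, Finset.mem_filter]; rw [hQdef, cube_eq_Icc]; rfl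
  have hYc : (Y.card : ℝ) ≤ N0 := by
    have h1 : Y.card ≤ (2 * (m-1) + 1)^d := (Finset.card_filter_le _ _).trans (cube_card x0 (m-1)).le
    have h2 : (2 * (m-1) + 1)^d ≤ (2 * M0 + 1)^d := Nat.pow_le_pow_left (by omega) d
    rw [hN0]; exact_mod_cast h1.trans h2
  set B : Set (V d) := (Y : Set (V d)) with hB
  have hnS : ∀ y, 1 ≤ ht i σ x0 y → y ∉ S := fun y hy hyS => by have := hS.le y hyS; omega
  have hx0B : x0 ∈ B := by
    rw [hB, Finset.mem_coe, hYm]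
    refine ⟨fun j => by simp, ?_⟩
    have : ht i σ x0 x0 = 0 := by simp [ht]
    omega
  have hzQ : z ∈ Q := by
    refine (mem_cube_iff hσ i _ _ _).2 ⟨by rw [abs_le]; omega, fun k hk => ?_⟩
    have := hz k hk; have := abs_nonneg (z k - x0 k); omega
  have hzB : z ∈ B := by rw [hB, Finset.mem_coe, hYm]; exact ⟨hzQ, le_rfl⟩
  let Qf : V d → ℝ := fun x => (Pm μ x).real (G3 S B Q z)
  have hQf0 : ∀ x, 0 ≤ Qf x := fun x => measureReal_nonneg
  have s1 : ((2 * d : ℝ)⁻¹) ^ K * (1 / 2 * g v) ≤ Qf z := by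
    have hav : 1 / 2 * g v ≤ av μ (S ∪ B) v := by
      have h1 := av_union hd hμ S ∅ Y x0 (M := 0) (κ := 1) one_pos le_rfl (by simp) (by simp) v
      rw [Set.union_empty] at h1
      refine le_trans ?_ h1
      have h2 : ∑ y ∈ Y, g y * Green Set.univ y v ≤ ∑ y ∈ Y, (Cg * g v) * (C * (K:ℝ)⁻¹) := by
        refine Finset.sum_le_sum fun y hy => ?_
        rw [hYm] at hy
        refine mul_le_mul (hga y (hcm (by omega) hy.1)) ?_ (green_nonneg _ _ _) (by positivity)
        refine (hG _ _ _).trans (mul_le_mul_of_nonneg_left ?_ hC.le)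
        refine (ff_ht hd hσ i x0 _ _ (R := K) (by linarith) ?_).trans (inv_pow_le hK1 (by omega))
        have : (ht i σ x0 y : ℝ) ≤ ht i σ x0 z := by exact_mod_cast hy.2
        rw [hhv, le_abs]; left; push_cast; linarith
      rw [Finset.sum_const, nsmul_eq_mul] at h2
      have h3 : (Y.card : ℝ) * ((Cg * g v) * (C * (K:ℝ)⁻¹)) ≤ 1 / 2 * g v := by
        calc _ ≤ N0 * ((Cg * g v) * (C * (K:ℝ)⁻¹)) := by gcongr
          _ = (Cg * C * N0 * (K:ℝ)⁻¹) * g v := by ring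
          _ ≤ 1 / 2 * g v := by
            refine mul_le_mul_of_nonneg_right ?_ hgv
            rw [← div_eq_mul_inv, div_le_iff₀ (by linarith)]; linarith
      simp only [zero_div, zero_mul, sub_zero]
      linarith
    have h4 := prob_cyl_av hd0 hμ (fun j : ℕ => gam i σ z (j:ℤ)) (fun j => by push_cast; exact adj_gam hσ i z j) K (S ∪ B)
    simp only [Nat.cast_zero, gam_zero] at h4
    calc _ ≤ ((2 * d : ℝ)⁻¹) ^ K * av μ (S ∪ B) v := by gcongr
      _ = _ := h4.symm
      _ ≤ Qf z := by
        have := Pm_prob hμ z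
        refine measureReal_mono ?_
        rintro ω ⟨h5, h6⟩
        have h50 : ω 0 = z := by rw [h5 0 (by omega)]; simp [gam_zero]
        refine ⟨0, h50, ?_, ?_⟩
        · intro j hj; rw [show j = 0 by omega, h50]; exact ⟨hnS z hz3, hzQ⟩
        · intro l hl
          have key : ω l ∉ B ∧ ω l ∉ S := by
            by_cases hlK : l ≤ K
            · rw [h5 l hlK]
              have hh : ht i σ x0 (gam i σ z (l:ℤ)) = ht i σ x0 z + l := ht_gam hσ _ _ _ _
              refine ⟨fun h => ?_, hnS _ (by omega)⟩
              rw [hB, Finset.mem_coe, hYm] at h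
              omega
            · have := h6 (l - K)
              rw [show K + (l - K) = l by omega] at this
              exact ⟨fun h => this (Or.inr h), fun h => this (Or.inl h)⟩
          refine ⟨key.1, key.2, fun j hj => ?_⟩
          rw [show j = 0 by omega, h50]
          intro e; exact key.1 (e ▸ hzB)
  set x1 := gam i σ x0 1 with hx1
  have s2 : Qf z ≤ (2 * d : ℝ) ^ (d * (2 * M0)) * Qf x1 := by
    have h1 := triv_harnack hd0 hQf0 z _ x1 rfl ?_
    · refine h1.trans (mul_le_mul_of_nonneg_right ?_ (hQf0 _))
      refine pow_le_pow_right₀ (by linarith) ?_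
      calc _ ≤ ∑ j : Fin d, 2 * M0 := by
            refine Finset.sum_le_sum fun j _ => ?_
            have h2 := abs_le.1 (hzQ j)
            have h3 : |x1 j - x0 j| ≤ 1 := by
              simp only [hx1, gam]; rcases hσ with rfl | rfl <;> split_ifs <;> simp
            rw [abs_le] at h3
            omega
        _ = _ := by simp
    · intro q hq
      have hx1h : ht i σ x0 x1 = 1 := by rw [hx1, ht_gam hσ]; simp [ht]
      have q1 : 1 ≤ ht i σ x0 q := ht_uIcc hσ (by omega) hz3 (hq i)
      have q2 : ht i σ x0 q ≤ ht i σ x0 z := ht_uIcc_le hσ (by omega) le_rfl (hq i)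
      have hqQ : q ∈ Q := by
        refine (mem_cube_iff hσ i _ _ _).2 ⟨by rw [abs_le]; omega, fun k hk => ?_⟩
        have h2 := abs_le.1 (hzQ k)
        have h3 := hq k
        rw [hx1, gam_ne hk, Set.mem_uIcc] at h3
        rw [abs_le]; omega
      exact avg_G3 hd0 hμ (by rw [hB, Finset.mem_coe, hYm]; exact ⟨hqQ, q2⟩) (hnS q q1) hqQ
  have s3 : Qf x1 ≤ 2 * d * avg Qf x0 := by
    have := le_avg_mul hd0 hQf0 x0 i
    rcases gam_one_eV hσ i x0 with h | h
    · rw [hx1, h]; exact this.1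
    · rw [hx1, h]; exact this.2
  have s4 : avg Qf x0 ≤ (Pm μ x0).real (G0 S Q z) := avg_G0 hd0 hμ hx0B
  have s5 : avg g x0 ≤ Cg * g v := by
    rw [← avg_const hd0 (Cg * g v) x0]
    have hx00 : x0 ∈ cube x0 1 := fun j => by simp
    refine avg_mono' fun j => ⟨hga _ (hcm (by omega) (cube_nbr hx00 j).1), hga _ (hcm (by omega) (cube_nbr hx00 j).2)⟩
  refine le_trans ?_ s4
  have t1 : ((2 * d : ℝ) ^ (d * (2 * M0)))⁻¹ * Qf z ≤ Qf x1 := by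
    rw [inv_mul_le_iff₀ (by positivity)]; exact s2
  have t2 : (2 * d : ℝ)⁻¹ * Qf x1 ≤ avg Qf x0 := by
    rw [inv_mul_le_iff₀ (by positivity)]; exact s3
  have t3 : Cg⁻¹ * avg g x0 ≤ g v := by
    rw [inv_mul_le_iff₀ (by positivity)]; exact s5
  calc _ = (2 * d : ℝ)⁻¹ * (((2 * d : ℝ) ^ (d * (2 * M0)))⁻¹ * (((2 * d : ℝ)⁻¹) ^ K * (1 / 2 * (Cg⁻¹ * avg g x0)))) := by ring
    _ ≤ (2 * d : ℝ)⁻¹ * (((2 * d : ℝ) ^ (d * (2 * M0)))⁻¹ * (((2 * d : ℝ)⁻¹) ^ K * (1 / 2 * g v))) := by gcongr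
    _ ≤ (2 * d : ℝ)⁻¹ * (((2 * d : ℝ) ^ (d * (2 * M0)))⁻¹ * Qf z) := by gcongr
    _ ≤ (2 * d : ℝ)⁻¹ * Qf x1 := by gcongr
    _ ≤ _ := t2

lemma core (hd : 5 ≤ d) : ∃ (c : ℝ), 0 < c ∧ ∀ (μ : Measure (ℕ → V d)), IsSRWLaw μ 0 → ∀ (i : Fin d) (σ : ℤ), (σ = 1 ∨ σ = -1) →
    ∀ (x0 : V d) (S : Set (V d)), Below i σ x0 S → ∀ m : ℕ, 2 ≤ m → ∀ z : V d, (∀ j, j ≠ i → 4 * |z j - x0 j| ≤ m) → (m:ℤ) - 2 ≤ 4 * ht i σ x0 z →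
    4 * ht i σ x0 z ≤ 3 * m → 1 ≤ ht i σ x0 z → c * ((m:ℝ) ^ (d-2))⁻¹ * avg (av μ S) x0 ≤ (Pm μ x0).real (G0 S (cube x0 (m-1)) z) := by
  obtain ⟨c1, M0, hc1, h1⟩ := coreLarge hd
  obtain ⟨c2, hc2, h2⟩ := coreSmall hd M0
  refine ⟨min c1 c2, lt_min hc1 hc2, ?_⟩
  intro μ hμ i σ hσ x0 S hS m hm z hz hz1 hz2 hz3
  have ha : 0 ≤ avg (av μ S) x0 := avg_nonneg fun y => av_nonneg S y
  have hm1 : (1:ℝ) ≤ m := by exact_mod_cast (by omega : 1 ≤ m)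
  have hP1 : ((m:ℝ) ^ (d-2))⁻¹ ≤ 1 := inv_le_one_of_one_le₀ (one_le_pow₀ hm1)
  by_cases hmM : M0 ≤ m
  · refine le_trans ?_ (h1 μ hμ i σ hσ x0 S hS m hmM z hz hz1 hz2)
    gcongr; exact min_le_left _ _
  · refine le_trans ?_ (h2 μ hμ i σ hσ x0 S hS m hm (by omega) z hz hz1 hz2 hz3)
    calc _ ≤ c2 * 1 * avg (av μ S) x0 := by gcongr; exact min_le_right _ _
      _ = _ := by ring

end CoreS

end

section
def Nice (ω : ℕ → V d) : Prop :=
  ω 0 = 0 ∧ (∀ j, adj (ω j) (ω (j + 1))) ∧ ∀ y, {j | ω j = y}.Finite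

lemma stop_eq {D : Set (V d)} {ω : ℕ → V d} {j : ℕ} (h : ∀ k < j, ω k ∈ D) :
    stopAt D ω j = ω j := if_pos ((le_exit_iff D ω j).2 h)

lemma stop_form {D : Set (V d)} {ω : ℕ → V d} {s l : ℕ} (h : ∀ j ≤ s, ω j ∈ D) (hl : s < l) :
    ∃ j, s < j ∧ j ≤ l ∧ stopAt D ω l = ω j ∧ (∀ k < j, ω k ∈ D) ∧ (j < l → ω j ∉ D) := by
  by_cases hk : ∀ k < l, ω k ∈ D
  · exact ⟨l, hl, le_rfl, stop_eq hk, hk, fun h => absurd h (lt_irrefl _)⟩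
  · have hx : stopAt D ω l = ω (exitTime D ω) :=
      if_neg (fun h' => hk ((le_exit_iff D ω l).1 h'))
    push Not at hk
    obtain ⟨k, hkl, hkD⟩ := hk
    have hex : ∃ j, ω j ∉ D := ⟨k, hkD⟩
    have he : exitTime D ω = Nat.find hex := by
      unfold exitTime exitTimeE
      rw [dif_pos hex]; rfl
    rw [he] at hx
    refine ⟨Nat.find hex, ?_, (Nat.find_le hkD).trans hkl.le, hx, ?_, fun _ => Nat.find_spec hex⟩
    · by_contra hc
      exact Nat.find_spec hex (h _ (by omega))
    · intro j hj
      by_contra hc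
      exact Nat.find_min hex hj hc

lemma lastVisit_eq {X : ℕ → V d} {t u : ℕ} (h1 : t ≤ u) (h2 : X u = X t)
    (h3 : ∀ l > u, X l ≠ X t) : lastVisit X t = u := by
  apply IsGreatest.csSup_eq
  refine ⟨⟨h1, h2⟩, fun j hj => ?_⟩
  by_contra hc
  exact h3 j (by omega) hj.2

lemma lv {D : Set (V d)} {ω : ℕ → V d} (hf : ∀ y, {j | ω j = y}.Finite) {t : ℕ}
    (ht : ∀ j ≤ t, ω j ∈ D) :
    t ≤ lastVisit (stopAt D ω) t ∧ (∀ j ≤ lastVisit (stopAt D ω) t, ω j ∈ D) ∧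
      ω (lastVisit (stopAt D ω) t) = ω t ∧
      ∀ l > lastVisit (stopAt D ω) t, stopAt D ω l ≠ ω t := by
  have hXt : stopAt D ω t = ω t := stop_eq (fun k hk => ht k hk.le)
  have key : ∀ j ∈ {j | t ≤ j ∧ stopAt D ω j = stopAt D ω t}, ω j = ω t ∧ ∀ k ≤ j, ω k ∈ D := by
    rintro j ⟨h1, h2⟩
    rcases h1.eq_or_lt with h1 | h1
    · subst h1; exact ⟨rfl, ht⟩
    · obtain ⟨j', h3, h4, h5, h6, h7⟩ := stop_form ht h1
      rw [h2, hXt] at h5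
      have : j' = j := by
        by_contra hne
        exact h7 (by omega) (h5 ▸ ht t le_rfl)
      subst this
      refine ⟨h5.symm, fun k hk => ?_⟩
      rcases hk.eq_or_lt with hk | hk
      · rw [hk, ← h5]; exact ht t le_rfl
      · exact h6 k hk
  have hb : BddAbove {j | t ≤ j ∧ stopAt D ω j = stopAt D ω t} :=
    ((hf (ω t)).subset (fun j hj => (key j hj).1)).bddAbove
  have hm := Nat.sSup_mem (s := {j | t ≤ j ∧ stopAt D ω j = stopAt D ω t}) ⟨t, le_rfl, rfl⟩ hb
  refine ⟨hm.1, (key _ hm).2, (key _ hm).1, fun l hl he => ?_⟩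
  have h0 : l ≤ lastVisit (stopAt D ω) t := le_csSup hb ⟨hm.1.trans (le_of_lt hl), he.trans hXt.symm⟩
  omega

def Rg (D : Set (V d)) (ω : ℕ → V d) (k : ℕ) : Prop :=
  (∀ j ≤ leTime (stopAt D ω) k, ω j ∈ D) ∧
    ∀ l > leTime (stopAt D ω) k, stopAt D ω l ≠ ω (leTime (stopAt D ω) k)

lemma Rg.eq {D : Set (V d)} {ω : ℕ → V d} {k : ℕ} (h : Rg D ω k) :
    lerw D ω k = ω (leTime (stopAt D ω) k) := stop_eq (fun j hj => h.1 j hj.le)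

lemma reg_zero {D : Set (V d)} {ω : ℕ → V d} (hn : Nice ω) (h0 : (0 : V d) ∈ D) :
    Rg D ω 0 ∧ lerw D ω 0 = 0 := by
  have h := lv (D := D) hn.2.2 (t := 0) (by
    intro j hj
    rw [Nat.le_zero.1 hj, hn.1]; exact h0)
  have hr : Rg D ω 0 := by
    refine ⟨h.2.1, fun l hl => ?_⟩
    have := h.2.2.2 l hl
    rwa [← h.2.2.1] at this
  refine ⟨hr, ?_⟩
  rw [hr.eq]
  exact h.2.2.1.trans hn.1

lemma reg_step {D : Set (V d)} {ω : ℕ → V d} (hn : Nice ω) {R k : ℕ}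
    (hD : cube 0 (R + 1) ⊆ D) (h : Rg D ω k) (hk : lerw D ω k ∈ cube 0 R) :
    leTime (stopAt D ω) k < leTime (stopAt D ω) (k + 1) ∧ Rg D ω (k + 1) ∧
      lerw D ω (k + 1) = ω (leTime (stopAt D ω) k + 1) ∧
      adj (lerw D ω k) (lerw D ω (k + 1)) := by
  have ha := hn.2.1 (leTime (stopAt D ω) k)
  have hin : ω (leTime (stopAt D ω) k + 1) ∈ D := by
    apply hD
    rw [h.eq] at hk
    obtain ⟨i, hi | hi⟩ := adj_iff.1 ha
    · rw [hi]; exact (cube_nbr hk i).1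
    · rw [hi]; exact (cube_nbr hk i).2
  have h' := lv (D := D) hn.2.2 (t := leTime (stopAt D ω) k + 1) (by
    intro j hj
    rcases hj.eq_or_lt with hj | hj
    · rw [hj]; exact hin
    · exact h.1 j (by omega))
  have hr : Rg D ω (k + 1) := by
    refine ⟨h'.2.1, fun l hl => ?_⟩
    have := h'.2.2.2 l hl
    rwa [← h'.2.2.1] at this
  have he : lerw D ω (k + 1) = ω (leTime (stopAt D ω) k + 1) := by
    rw [hr.eq]; exact h'.2.2.1
  refine ⟨h'.1, hr, he, ?_⟩
  rw [he, h.eq]; exact ha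

lemma reg {D : Set (V d)} {ω : ℕ → V d} (hn : Nice ω) {R : ℕ}
    (hD : cube 0 (R + 1) ⊆ D) (k : ℕ) (hk : ∀ j < k, lerw D ω j ∈ cube 0 R) : Rg D ω k := by
  induction k with
  | zero =>
    refine (reg_zero hn (hD ?_)).1
    intro i; simp; positivity
  | succ k ih =>
    exact (reg_step hn hD (ih fun j hj => hk j (by omega)) (hk k (by omega))).2.1

lemma reg_mono {D : Set (V d)} {ω : ℕ → V d} (hn : Nice ω) {R : ℕ}
    (hD : cube 0 (R + 1) ⊆ D) (k : ℕ) (hk : ∀ j < k, lerw D ω j ∈ cube 0 R) {i : ℕ} (hi : i < k) :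
    leTime (stopAt D ω) i < leTime (stopAt D ω) k := by
  induction k with
  | zero => omega
  | succ k ih =>
    have h1 := (reg_step hn hD (reg hn hD k fun j hj => hk j (by omega)) (hk k (by omega))).1
    rcases Nat.lt_succ_iff_lt_or_eq.1 hi with h | h
    · exact (ih (fun j hj => hk j (by omega)) h).trans h1
    · rw [h]; exact h1

lemma lerw_leaves {D : Set (V d)} {ω : ℕ → V d} (hn : Nice ω) {R : ℕ}
    (hD : cube 0 (R + 1) ⊆ D) : ∃ j, lerw D ω j ∉ cube 0 R := by
  by_contra hc
  push Not at hc
  have hinj : ∀ i k, i < k → lerw D ω i ≠ lerw D ω k := by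
    intro i k hik he
    have h1 := reg hn hD i (fun j _ => hc j)
    rw [h1.eq] at he
    exact h1.2 _ (reg_mono hn hD k (fun j _ => hc j) hik) he.symm
  refine Set.infinite_of_injective_forall_mem (f := lerw D ω) ?_ hc (cube_finite 0 R)
  intro i k he
  rcases lt_trichotomy i k with h | h | h
  · exact absurd he (hinj i k h)
  · exact h
  · exact absurd he.symm (hinj k i h)

lemma lerw_hits {D : Set (V d)} {ω : ℕ → V d} (hn : Nice ω) {R : ℕ}
    (hD : cube 0 (R + 1) ⊆ D) {x : V d} {r k0 : ℕ} (hx : cube x r ⊆ cube 0 R)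
    (h0 : lerw D ω k0 ∈ cube x r) (hk : ∀ i < k0, lerw D ω i ∈ cube 0 R) :
    ∃ j ≥ k0, lerw D ω j ∈ innerBdry (cube x r) ∧
      ∀ i, k0 ≤ i → i ≤ j → lerw D ω i ∈ cube x r := by
  have hex : ∃ j, k0 ≤ j ∧ lerw D ω j ∉ cube x r := by
    obtain ⟨j, hj⟩ := lerw_leaves hn hD
    refine ⟨j, ?_, fun h => hj (hx h)⟩
    by_contra hc
    exact hj (hk j (by omega))
  obtain ⟨h1, h2⟩ := Nat.find_spec hex
  have h3 : ∀ i, k0 ≤ i → i < Nat.find hex → lerw D ω i ∈ cube x r := by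
    intro i hi hlt
    by_contra hc
    exact Nat.find_min hex hlt ⟨hi, hc⟩
  generalize Nat.find hex = j at h1 h2 h3
  have h4 : k0 < j := by
    rcases h1.eq_or_lt with h | h
    · rw [← h] at h2; exact absurd h0 h2
    · exact h
  obtain ⟨p, rfl⟩ : ∃ p, j = p + 1 := ⟨j - 1, by omega⟩
  have h5 := h3 p (by omega) (by omega)
  have h6 := reg_step hn hD (reg hn hD p (fun i hi => by
    by_cases hik : i < k0
    · exact hk i hik
    · exact hx (h3 i (by omega) (by omega)))) (hx h5)
  exact ⟨p, by omega, ⟨h5, _, h6.2.2.2, h2⟩, fun i hi hip => h3 i hi (by omega)⟩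

lemma not_ib {x y : V d} {r : ℕ} (h : y ∈ cube x r) : y ∉ innerBdry (cube x (r + 1)) := by
  rintro ⟨_, w, hw, hw'⟩
  obtain ⟨i, hi | hi⟩ := adj_iff.1 hw
  · exact hw' (hi ▸ (cube_nbr h i).1)
  · exact hw' (hi ▸ (cube_nbr h i).2)

lemma ib_of {y : V d} {n : ℕ} (h : y ∈ cube 0 n) {i : Fin d} (hi : |y i| = (n : ℤ)) :
    y ∈ innerBdry (cube 0 n) := by
  refine ⟨h, ?_⟩
  rcases le_total 0 (y i) with h0 | h0
  · refine ⟨y + eV i, adj_iff.2 ⟨i, Or.inl rfl⟩, fun hc => ?_⟩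
    have := hc i
    rw [abs_of_nonneg h0] at hi
    simp [eV_apply] at this
    have := le_abs_self (y i + 1)
    omega
  · refine ⟨y - eV i, adj_iff.2 ⟨i, Or.inr rfl⟩, fun hc => ?_⟩
    have := hc i
    rw [abs_of_nonpos h0] at hi
    simp [eV_apply] at this
    have := neg_le_abs (y i - 1)
    omega

lemma ib_face {y : V d} {n : ℕ} (hn : 1 ≤ n) (h : y ∈ innerBdry (cube 0 n)) :
    ∃ i, |y i| = (n : ℤ) := by
  by_contra hc
  push Not at hc
  obtain ⟨r, rfl⟩ : ∃ r, n = r + 1 := ⟨n - 1, by omega⟩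
  refine not_ib (x := 0) (fun i => ?_) h
  have h1 := h.1 i
  have h2 := hc i
  simp only [Pi.zero_apply, sub_zero] at h1 ⊢
  push_cast at h1 h2
  omega

lemma hitIdx_eq {A : Set (V d)} {γ : ℕ → V d} {k : ℕ} (h : γ k ∈ A) (h' : ∀ i < k, γ i ∉ A) :
    hitIdx A γ = k := by
  have hex : ∃ j, γ j ∈ A := ⟨k, h⟩
  have : Nat.find hex = k := (Nat.find_eq_iff hex).2 ⟨h, h'⟩
  unfold hitIdx hitTimeE
  rw [dif_pos hex, this]; rfl

lemma alpha_facts {D : Set (V d)} {ω : ℕ → V d} (hn : Nice ω) {n : ℕ}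
    (hD : cube 0 (n + 1) ⊆ D) :
    ∃ k, hitIdx (innerBdry (cube 0 n)) (lerw D ω) = k ∧ lerw D ω k ∈ innerBdry (cube 0 n) ∧
      (∀ i < k, lerw D ω i ∉ innerBdry (cube 0 n)) ∧ ∀ i ≤ k, lerw D ω i ∈ cube 0 n := by
  have h0 : (0 : V d) ∈ cube 0 n := by intro i; simp
  have h00 : (0 : V d) ∈ D := by
    apply hD; intro i; simp; positivity
  obtain ⟨j, _, hj, hj'⟩ := lerw_hits hn hD (x := 0) (r := n) (k0 := 0) subset_rfl
    (by rw [(reg_zero hn h00).2]; exact h0) (by intro i hi; omega)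
  have hex : ∃ j, lerw D ω j ∈ innerBdry (cube 0 n) := ⟨j, hj⟩
  have hm : ∀ i < Nat.find hex, lerw D ω i ∉ innerBdry (cube 0 n) :=
    fun i hi => Nat.find_min hex hi
  exact ⟨Nat.find hex, hitIdx_eq (Nat.find_spec hex) hm, Nat.find_spec hex, hm,
    fun i hi => hj' i (Nat.zero_le _) (hi.trans (Nat.find_le hj))⟩

def Cyl (D : Set (V d)) (b : ℕ → V d) (k s : ℕ) : Set (ℕ → V d) :=
  {ω | (∀ j ≤ s, ω j ∈ D) ∧ ω 0 = b 0 ∧ ∃ t : ℕ → ℕ, t k = s ∧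
    (∀ i ≤ k, t i ≤ s ∧ ω (t i) = b i ∧ ∀ j, t i < j → j ≤ s → ω j ≠ b i) ∧
    ∀ i < k, t i < s ∧ ω (t i + 1) = b (i + 1)}

lemma Cyl_dep (D : Set (V d)) (b : ℕ → V d) (k s : ℕ) : DepTo s (Cyl D b k s) := by
  rintro ω ω' h ⟨h1, h2, t, h3, h4, h5⟩
  refine ⟨fun j hj => h j hj ▸ h1 j hj, h 0 (Nat.zero_le _) ▸ h2, t, h3, fun i hi => ?_,
    fun i hi => ?_⟩
  · obtain ⟨a1, a2, a3⟩ := h4 i hi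
    exact ⟨a1, h _ a1 ▸ a2, fun j hj hj' => h j hj' ▸ a3 j hj hj'⟩
  · obtain ⟨a1, a2⟩ := h5 i hi
    exact ⟨a1, h _ a1 ▸ a2⟩

lemma Cyl_end {D : Set (V d)} {b : ℕ → V d} {k s : ℕ} {ω : ℕ → V d} (h : ω ∈ Cyl D b k s) :
    ω s = b k := by
  obtain ⟨h1, h2, t, h3, h4, h5⟩ := h
  rw [← h3]; exact (h4 k le_rfl).2.1

lemma dir1 {D : Set (V d)} {ω : ℕ → V d} (hn : Nice ω) {n k : ℕ} (hD : cube 0 (n + 1) ⊆ D)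
    {b : ℕ → V d} (hb : ∀ i ≤ k, lerw D ω i = b i) (hbn : ∀ i ≤ k, b i ∈ cube 0 n) (hb0 : b 0 = 0) :
    ∃ s, ω ∈ Cyl D b k s ∧
      (fun j => ω (s + j)) ∈ {ω | avoidBeforeExitPos D {y | ∃ i ≤ k, y = b i} ω} := by
  have hin : ∀ i ≤ k, lerw D ω i ∈ cube 0 n := fun i hi => hb i hi ▸ hbn i hi
  have hR : ∀ i ≤ k, Rg D ω i := fun i hi => reg hn hD i (fun j hj => hin j (by omega))
  have hmono : ∀ i < k, leTime (stopAt D ω) i < leTime (stopAt D ω) k := fun i hi =>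
    reg_mono hn hD k (fun j hj => hin j (by omega)) hi
  have hmono' : ∀ i ≤ k, leTime (stopAt D ω) i ≤ leTime (stopAt D ω) k := fun i hi => by
    rcases hi.eq_or_lt with h | h
    · rw [h]
    · exact (hmono i h).le
  have hbe : ∀ i ≤ k, ω (leTime (stopAt D ω) i) = b i := fun i hi => by
    rw [← (hR i hi).eq, hb i hi]
  refine ⟨leTime (stopAt D ω) k, ⟨(hR k le_rfl).1, hn.1.trans hb0.symm, leTime (stopAt D ω), rfl,
    fun i hi => ⟨hmono' i hi, hbe i hi, fun j hj hj' => ?_⟩, fun i hi => ⟨hmono i hi, ?_⟩⟩, ?_⟩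
  · have := (hR i hi).2 j hj
    rw [stop_eq (fun l hl => (hR k le_rfl).1 l (by omega)), hbe i hi] at this
    exact this
  · rw [← (reg_step hn hD (hR i hi.le) (hin i hi.le)).2.2.1, hb (i + 1) hi]
  · rintro j hj hje ⟨i, hi, he⟩
    rw [le_exit_iff] at hje
    refine (hR i hi).2 (leTime (stopAt D ω) k + j) (by have := hmono' i hi; omega) ?_
    rw [hbe i hi, ← he]
    apply stop_eq
    intro l hl
    by_cases hls : l ≤ leTime (stopAt D ω) k
    · exact (hR k le_rfl).1 l hls
    · have := hje (l - leTime (stopAt D ω) k) (by omega)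
      rwa [show leTime (stopAt D ω) k + (l - leTime (stopAt D ω) k) = l by omega] at this

lemma cyl_past {D : Set (V d)} {ω : ℕ → V d} {n k s : ℕ}
    {b : ℕ → V d} (hbk : b k ∈ innerBdry (cube 0 n))
    (hbi : ∀ i < k, b i ∉ innerBdry (cube 0 n)) (hC : ω ∈ Cyl D b k s)
    (hS : ∀ l > s, ∀ i ≤ k, stopAt D ω l ≠ b i) :
    leTime (stopAt D ω) k = s ∧ (∀ i ≤ k, lerw D ω i = b i) ∧
      hitIdx (innerBdry (cube 0 n)) (lerw D ω) = k ∧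
      alphaList D n ω = (List.range (k + 1)).map b := by
  obtain ⟨c1, c2, t, c3, c4, c5⟩ := hC
  have hXu : ∀ j ≤ s, stopAt D ω j = ω j := fun j hj => stop_eq fun l hl => c1 l (by omega)
  have hlast : ∀ i ≤ k, ∀ l > t i, stopAt D ω l ≠ b i := by
    intro i hi l hl
    by_cases hls : l ≤ s
    · rw [hXu l (by omega)]; exact (c4 i hi).2.2 l hl hls
    · exact hS l (by omega) i hi
  have hT : ∀ i ≤ k, leTime (stopAt D ω) i = t i := by
    intro i
    induction i with
    | zero =>
      intro hi
      have h1 := (c4 0 hi).1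
      have h2 := (c4 0 hi).2.1
      refine lastVisit_eq (Nat.zero_le _) ?_ ?_
      · rw [hXu _ (by omega), hXu _ (by omega), h2, c2]
      · rw [hXu 0 (by omega), c2]; exact hlast 0 hi
    | succ i ih =>
      intro hi
      have h1 := (c4 (i + 1) hi).1
      have h2 := (c4 (i + 1) hi).2
      have h3 := c5 i hi
      change lastVisit (stopAt D ω) (leTime (stopAt D ω) i + 1) = _
      rw [ih (by omega)]
      refine lastVisit_eq ?_ ?_ ?_
      · by_contra hc
        exact h2.2 (t i + 1) (by omega) (by omega) h3.2
      · rw [hXu _ (by omega), hXu _ (by omega), h2.1, h3.2]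
      · rw [hXu _ (by omega), h3.2]; exact hlast (i + 1) hi
  have hL : ∀ i ≤ k, lerw D ω i = b i := by
    intro i hi
    change stopAt D ω (leTime (stopAt D ω) i) = _
    rw [hT i hi, hXu _ (by have := (c4 i hi).1; omega)]
    exact (c4 i hi).2.1
  have hk : hitIdx (innerBdry (cube 0 n)) (lerw D ω) = k :=
    hitIdx_eq (hL k le_rfl ▸ hbk) (fun i hi => hL i hi.le ▸ hbi i hi)
  refine ⟨(hT k le_rfl).trans c3, hL, hk, ?_⟩
  unfold alphaList
  rw [hk]
  apply List.map_congr_left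
  intro i hi
  exact hL i (by have := List.mem_range.1 hi; omega)

lemma dir3 {D : Set (V d)} {ω : ℕ → V d} {n k s : ℕ}
    {b : ℕ → V d} (hbk : b k ∈ innerBdry (cube 0 n))
    (hbi : ∀ i < k, b i ∉ innerBdry (cube 0 n)) (hC : ω ∈ Cyl D b k s)
    (hA : (fun j => ω (s + j)) ∈ {ω | avoidBeforeExitPos D {y | ∃ i ≤ k, y = b i} ω}) :
    alphaList D n ω = (List.range (k + 1)).map b := by
  refine (cyl_past hbk hbi hC fun l hl i hi he => ?_).2.2.2
  obtain ⟨j, hj1, _, hj3, hj4, _⟩ := stop_form hC.1 hl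
  rw [hj3] at he
  have := hA (j - s) (by omega) ((le_exit_iff _ _ _).2 fun l hl => hj4 _ (by omega))
  beta_reduce at this
  rw [show s + (j - s) = j by omega] at this
  exact this ⟨i, hi, he⟩

lemma dir2 {D : Set (V d)} {ω : ℕ → V d} (hn : Nice ω) {n k m s : ℕ} (hm : 1 ≤ m)
    (hD : cube 0 (n + m + 1) ⊆ D)
    {b : ℕ → V d} (hbn : ∀ i ≤ k, b i ∈ cube 0 n) (hbk : b k ∈ innerBdry (cube 0 n))
    (hbi : ∀ i < k, b i ∉ innerBdry (cube 0 n)) {z : V d}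
    (hC : ω ∈ Cyl D b k s)
    (hG : (fun j => ω (s + j)) ∈ G0 {y | ∃ i ≤ k, y = b i} (cube (b k) (m - 1)) z) :
    alphaList D n ω = (List.range (k + 1)).map b ∧ z ∈ betaList D n m ω := by
  have hend := Cyl_end hC
  have c1 := hC.1
  obtain ⟨s', g1, g2, g3⟩ := hG
  beta_reduce at g1 g2 g3
  have hsub : cube (b k) m ⊆ cube 0 (n + m) := by
    intro y hy i
    have h1 := hy i
    have h2 := hbn k le_rfl i
    simp only [Pi.zero_apply, sub_zero] at h2 ⊢
    have := abs_add_le (y i - b k i) (b k i)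
    rw [sub_add_cancel] at this
    push_cast; omega
  have hin : ∀ l, s ≤ l → l ≤ s + s' → ω l ∈ cube (b k) (m - 1) := by
    intro l h1 h2
    rcases h1.eq_or_lt with h | h
    · rw [← h, hend]; intro i; simp
    · have := (g2 (l - s) (by omega) (by omega)).2
      rwa [show s + (l - s) = l by omega] at this
  have hcm : cube (b k) (m - 1) ⊆ cube (b k) m := by
    intro y hy i; have := hy i; push_cast [Nat.cast_sub hm] at this; omega
  have hnD : cube (0 : V d) (n + m) ⊆ D := by
    intro y hy; apply hD; intro i; have := hy i; push_cast at this ⊢; omega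
  have hDu : ∀ j ≤ s + s', ω j ∈ D := by
    intro j hj
    by_cases hjs : j ≤ s
    · exact c1 j hjs
    · exact hnD (hsub (hcm (hin j (by omega) hj)))
  have hXu : ∀ j ≤ s + s', stopAt D ω j = ω j := fun j hj => stop_eq fun l hl => hDu l (by omega)
  have hS : ∀ l > s, ∀ i ≤ k, stopAt D ω l ≠ b i := by
    intro l hl i hi he
    obtain ⟨j, hj1, _, hj3, _⟩ := stop_form c1 hl
    rw [hj3] at he
    by_cases hjs : j ≤ s + s'
    · have := (g2 (j - s) (by omega) (by omega)).1
      rw [show s + (j - s) = j by omega] at this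
      exact this ⟨i, hi, he⟩
    · have := (g3 (j - s) (by omega)).1
      rw [show s + (j - s) = j by omega] at this
      exact this ⟨i, hi, he⟩
  have hU : ∀ l > s + s', ∀ j, s ≤ j → j ≤ s + s' → stopAt D ω l ≠ ω j := by
    intro l hl j hj hj' he
    obtain ⟨p, hp1, _, hp3, _⟩ := stop_form hDu hl
    rw [hp3] at he
    have := (g3 (p - s) (by omega)).2 (j - s) (by omega)
    rw [show s + (p - s) = p by omega, show s + (j - s) = j by omega] at this
    exact this he
  obtain ⟨hTk, hL, hk, hα⟩ := cyl_past hbk hbi hC hS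
  refine ⟨hα, ?_⟩
  have hq : ∀ v j, s ≤ leTime (stopAt D ω) j → leTime (stopAt D ω) j ≤ s + s' →
      s + s' - leTime (stopAt D ω) j ≤ v → ∃ q ≥ j, leTime (stopAt D ω) q = s + s' ∧
        ∀ i, j ≤ i → i ≤ q → s ≤ leTime (stopAt D ω) i ∧ leTime (stopAt D ω) i ≤ s + s' := by
    intro v
    induction v with
    | zero =>
      intro j h1 h2 h3
      refine ⟨j, le_rfl, by omega, fun i hi hi' => ?_⟩
      rw [show i = j by omega]; exact ⟨h1, h2⟩
    | succ v ih =>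
      intro j h1 h2 h3
      rcases h2.eq_or_lt with h | h
      · refine ⟨j, le_rfl, h, fun i hi hi' => ?_⟩
        rw [show i = j by omega]; exact ⟨h1, h2⟩
      · have h4 := lv (D := D) hn.2.2 (t := leTime (stopAt D ω) j + 1)
          (fun l hl => hDu l (by omega))
        change _ ≤ leTime (stopAt D ω) (j + 1) ∧ (∀ l ≤ leTime (stopAt D ω) (j + 1), _) ∧
          ω (leTime (stopAt D ω) (j + 1)) = _ ∧ _ at h4
        have h5 : leTime (stopAt D ω) (j + 1) ≤ s + s' := by
          by_contra hc
          apply hU _ (not_le.1 hc) (leTime (stopAt D ω) j + 1) (by omega) (by omega)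
          rw [← h4.2.2.1]
          exact stop_eq fun l hl => h4.2.1 l hl.le
        obtain ⟨q, hq1, hq2, hq3⟩ := ih (j + 1) (by omega) h5 (by omega)
        refine ⟨q, by omega, hq2, fun i hi hi' => ?_⟩
        rcases hi.eq_or_lt with h6 | h6
        · rw [← h6]; exact ⟨h1, h2⟩
        · exact hq3 i h6 hi'
  obtain ⟨q, hqk, hqT, hqi⟩ := hq s' k (by omega) (by omega) (by omega)
  have hnot : ∀ i, k ≤ i → i ≤ q → lerw D ω i ∉ innerBdry (cube (b k) m) := by
    intro i hi hi'
    have h1 := hqi i hi hi'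
    have h2 : lerw D ω i ∈ cube (b k) (m - 1) := by
      change stopAt D ω (leTime (stopAt D ω) i) ∈ _
      rw [hXu _ h1.2]; exact hin _ h1.1 h1.2
    have := not_ib h2
    rwa [show m - 1 + 1 = m by omega] at this
  have hz : lerw D ω q = z := by
    change stopAt D ω (leTime (stopAt D ω) q) = _
    rw [hqT, hXu _ le_rfl]; exact g1
  obtain ⟨j, hj1, hj2, _⟩ := lerw_hits hn hD hsub (k0 := k) (by
    rw [hL k le_rfl]; intro i; simp) (fun i hi => by
      rw [hL i hi.le]; intro l; have := hbn i hi.le l; push_cast; omega)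
  have hex : ∃ j, k ≤ j ∧ lerw D ω j ∈ innerBdry (cube (b k) m) := ⟨j, hj1, hj2⟩
  have hk2 : hitIdxFrom (innerBdry (cube (b k) m)) k (lerw D ω) = Nat.find hex := dif_pos hex
  have hqf : q < Nat.find hex := by
    by_contra hc
    exact hnot _ (Nat.find_spec hex).1 (not_lt.1 hc) (Nat.find_spec hex).2
  unfold betaList
  simp only [hk, hL k le_rfl, hk2]
  refine List.mem_map.2 ⟨q - k, List.mem_range.2 (by omega), ?_⟩
  rw [show k + (q - k) = q by omega, hz]

end

section
variable {μ : Measure (ℕ → V d)}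

lemma ae_nice (hd : 5 ≤ d) (hμ : IsSRWLaw μ 0) : ∀ᵐ ω ∂μ, Nice ω := by
  have h1 := ae_start hμ 0
  have h2 := ae_adj (by omega) hμ 0
  have h3 := ae_finite hd hμ 0
  rw [Pm_zero] at h1 h2 h3
  filter_upwards [h1, h2, h3] with ω a b c
  exact ⟨a, b, c⟩

lemma markovE (hd : 0 < d) (hμ : IsSRWLaw μ 0) {y : V d} {E : Set (ℕ → V d)}
    (hE : MeasurableSet E) (s : ℕ) (C : Set (ℕ → V d)) (h1 : DepTo s C) (h2 : ∀ ω ∈ C, ω s = y) :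
    μ (C ∩ {ω | (fun j => ω (s + j)) ∈ E}) = μ C * (Pm μ y) E := by
  have h := markov hd hμ hE s C h1 h2 0
  have := Pm_prob hμ y
  have := hμ.1
  rw [Pm_zero] at h
  rw [measureReal_def, measureReal_def, measureReal_def, ← ENNReal.toReal_mul] at h
  exact (ENNReal.toReal_eq_toReal_iff' (measure_ne_top _ _)
    (ENNReal.mul_ne_top (measure_ne_top _ _) (measure_ne_top _ _))).1 h

def EvU (D : Set (V d)) (b : ℕ → V d) (k : ℕ) (F : Set (ℕ → V d)) : Set (ℕ → V d) :=
  ⋃ s, (Cyl D b k s ∩ {ω | (fun j => ω (s + j)) ∈ F})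

lemma meas_EvU (D : Set (V d)) (b : ℕ → V d) (k : ℕ) {F : Set (ℕ → V d)} (hF : MeasurableSet F) :
    MeasurableSet (EvU D b k F) :=
  MeasurableSet.iUnion fun s => (dep_meas (Cyl_dep D b k s)).inter (meas_shift s hF)

lemma EvU_le (hd : 0 < d) (hμ : IsSRWLaw μ 0) {D : Set (V d)} {b : ℕ → V d} {k : ℕ}
    {F : Set (ℕ → V d)} (hF : MeasurableSet F) :
    μ (EvU D b k F) ≤ ∑' s, μ (Cyl D b k s) * (Pm μ (b k)) F := by
  refine (measure_iUnion_le _).trans (ENNReal.tsum_le_tsum fun s => ?_)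
  rw [markovE hd hμ hF s _ (Cyl_dep D b k s) fun ω h => Cyl_end h]

lemma EvU_eq (hd : 0 < d) (hμ : IsSRWLaw μ 0) {D : Set (V d)} {b : ℕ → V d} {k : ℕ}
    {F : Set (ℕ → V d)} (hF : MeasurableSet F) (hav : ∀ ω ∈ F, ∀ l ≥ 1, ω l ≠ b k) :
    μ (EvU D b k F) = ∑' s, μ (Cyl D b k s) * (Pm μ (b k)) F := by
  unfold EvU
  rw [measure_iUnion]
  · refine tsum_congr fun s => ?_
    rw [markovE hd hμ hF s _ (Cyl_dep D b k s) fun ω h => Cyl_end h]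
  · have key : ∀ s s', s < s' → Disjoint (Cyl D b k s ∩ {ω | (fun j => ω (s + j)) ∈ F})
        (Cyl D b k s' ∩ {ω | (fun j => ω (s' + j)) ∈ F}) := by
      intro s s' hlt
      rw [Set.disjoint_left]
      rintro ω ⟨h1, h2⟩ ⟨h3, h4⟩
      have h5 := hav _ h2 (s' - s) (by omega)
      beta_reduce at h5
      rw [show s + (s' - s) = s' by omega] at h5
      exact h5 (Cyl_end h3)
    intro s s' hne
    rcases lt_or_gt_of_ne hne with h | h
    · exact key s s' h
    · exact (key s' s h).symm
  · exact fun s => (dep_meas (Cyl_dep D b k s)).inter (meas_shift s hF)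

lemma param (hd : 5 ≤ d) (hμ : IsSRWLaw μ 0) {D : Set (V d)} {n : ℕ} (hD : cube 0 (n + 1) ⊆ D)
    {a : List (V d)} (ha : μ {ω | alphaList D n ω = a} ≠ 0) :
    ∃ (b : ℕ → V d) (k : ℕ), a = (List.range (k + 1)).map b ∧ endPt a = b k ∧ b 0 = 0 ∧
      b k ∈ innerBdry (cube 0 n) ∧ (∀ i < k, b i ∉ innerBdry (cube 0 n)) ∧
      ∀ i ≤ k, b i ∈ cube 0 n := by
  obtain ⟨ω, hω, hn⟩ : ∃ ω, alphaList D n ω = a ∧ Nice ω := by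
    by_contra hc
    push Not at hc
    exact ha (measure_mono_null (fun ω h => hc ω h) (ae_iff.1 (ae_nice hd hμ)))
  obtain ⟨k, h1, h2, h3, h4⟩ := alpha_facts hn hD
  have h0 : (0 : V d) ∈ D := by
    apply hD; intro i; simp; positivity
  refine ⟨lerw D ω, k, ?_, ?_, (reg_zero hn h0).2, h2, h3, h4⟩
  · rw [← hω]; unfold alphaList; rw [h1]
  · rw [← hω]; unfold alphaList endPt; rw [h1]; simp [List.range_succ]

lemma alpha_inv {D : Set (V d)} {n k : ℕ} {ω b : ℕ → V d}
    (h : alphaList D n ω = (List.range (k + 1)).map b) :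
    hitIdx (innerBdry (cube 0 n)) (lerw D ω) = k ∧ ∀ i ≤ k, lerw D ω i = b i := by
  unfold alphaList at h
  have hl := congrArg List.length h
  simp only [List.length_map, List.length_range] at hl
  have hk : hitIdx (innerBdry (cube 0 n)) (lerw D ω) = k := by omega
  rw [hk] at h
  refine ⟨hk, fun i hi => ?_⟩
  exact List.map_inj_left.1 h i (List.mem_range.2 (by omega))

lemma box_geom {n m : ℕ} {x0 z : V d} (hx : ∃ i, |x0 i| = (n : ℤ)) (hm : 2 ≤ m)
    (hz : z ∈ boxA x0 n m) :
    ∃ (i : Fin d) (σ : ℤ), (σ = 1 ∨ σ = -1) ∧ σ * x0 i = n ∧ (∀ j ≠ i, 4 * |z j - x0 j| ≤ m) ∧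
      (m : ℤ) - 2 ≤ 4 * ht i σ x0 z ∧ 4 * ht i σ x0 z ≤ 3 * m ∧ 1 ≤ ht i σ x0 z := by
  have hsp := Classical.choose_spec hx
  have hf : faceDir x0 n = fun j => if j = Classical.choose hx then
      (if 0 ≤ x0 (Classical.choose hx) then 1 else -1) else 0 := dif_pos hx
  generalize Classical.choose hx = i at hsp hf
  have hz' : ∀ j, |z j - (x0 j + ((m / 2 : ℕ) : ℤ) * faceDir x0 n j)| ≤ ((m / 4 : ℕ) : ℤ) := hz
  have hlat : ∀ j ≠ i, 4 * |z j - x0 j| ≤ m := by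
    intro j hj
    have := hz' j
    rw [hf] at this
    simp only [hj, if_false, mul_zero, add_zero] at this
    omega
  have hi := hz' i
  rw [hf] at hi
  simp only [if_true] at hi
  by_cases h0 : 0 ≤ x0 i
  · rw [abs_of_nonneg h0] at hsp
    rw [if_pos h0] at hi
    have := abs_le.1 hi
    refine ⟨i, 1, Or.inl rfl, by omega, hlat, ?_, ?_, ?_⟩ <;> unfold ht <;> omega
  · rw [abs_of_neg (by omega)] at hsp
    rw [if_neg h0] at hi
    have := abs_le.1 hi
    refine ⟨i, -1, Or.inr rfl, by omega, hlat, ?_, ?_, ?_⟩ <;> unfold ht <;> omega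

lemma box_one {n : ℕ} {x0 z : V d} (hz : z ∈ boxA x0 n 1) : z = x0 := by
  have hz' : ∀ j, |z j - (x0 j + ((1 / 2 : ℕ) : ℤ) * faceDir x0 n j)| ≤ ((1 / 4 : ℕ) : ℤ) := hz
  funext j
  have := hz' j
  norm_num at this
  omega

lemma key_event (hd : 5 ≤ d) : ∃ c : ℝ, 0 < c ∧ ∀ (N n m : ℕ) (D : Set (V d)),
    cube 0 (4 * N) ⊆ D → 16 ≤ n → 1 ≤ m → n + m ≤ N →
    ∀ μ : Measure (ℕ → V d), IsSRWLaw μ 0 →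
    ∀ a : List (V d), μ { ω | alphaList D n ω = a } ≠ 0 →
    ∀ z ∈ boxA (endPt a) n m, ∃ E : Set (ℕ → V d), MeasurableSet E ∧
      (∀ᵐ ω ∂μ, ω ∈ E → alphaList D n ω = a ∧ z ∈ betaList D n m ω) ∧
      ENNReal.ofReal (c * ((m : ℝ) ^ (d - 2))⁻¹) * μ { ω | alphaList D n ω = a } ≤ μ E := by
  obtain ⟨c, hc, hcore⟩ := core hd
  obtain ⟨C, hC, hesc⟩ := esc_bound hd
  refine ⟨min (c / C) 1, by positivity, ?_⟩
  intro N n m D hD hn hm hN μ hμ a ha z hz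
  have hcub : ∀ r, r ≤ 4 * N → cube (0 : V d) r ⊆ D := by
    intro r hr y hy
    apply hD
    intro i
    have := hy i
    omega
  have hD1 := hcub (n + 1) (by omega)
  obtain ⟨b, k, rfl, hend, hb0, hbk, hbi, hbn⟩ := param hd hμ hD1 ha
  rw [hend] at hz
  set S : Set (V d) := {y | ∃ i ≤ k, y = b i} with hS
  have hAv := meas_abep D S
  have hnice := ae_nice hd hμ
  have hle : μ {ω | alphaList D n ω = (List.range (k + 1)).map b} ≤
      μ (EvU D b k {ω | avoidBeforeExitPos D S ω}) := by
    refine measure_mono_ae ?_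
    filter_upwards [hnice] with ω hω hα
    obtain ⟨s, h⟩ := dir1 hω hD1 (alpha_inv hα).2 hbn hb0
    exact Set.mem_iUnion.2 ⟨s, h⟩
  rcases Nat.lt_or_ge m 2 with hm2 | hm2
  · obtain rfl : m = 1 := by omega
    have hzx := box_one hz
    refine ⟨_, meas_EvU D b k hAv, Filter.Eventually.of_forall fun ω hω => ?_, ?_⟩
    · obtain ⟨s, h1, h2⟩ := Set.mem_iUnion.1 hω
      have h3 := dir3 hbk hbi h1 h2
      refine ⟨h3, ?_⟩
      obtain ⟨h4, h5⟩ := alpha_inv h3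
      unfold betaList
      simp only [h4]
      refine List.mem_map.2 ⟨0, List.mem_range.2 (by omega), ?_⟩
      rw [add_zero, h5 k le_rfl, hzx]
    · refine le_trans ?_ hle
      calc _ ≤ ENNReal.ofReal 1 * _ := by
            gcongr
            simp
        _ = _ := by simp
  · obtain ⟨i, σ, hσ, hσn, g1, g2, g3, g4⟩ := box_geom (ib_face (by omega) hbk) hm2 hz
    have hBelow : Below i σ (b k) S := by
      rintro y ⟨j, hj, rfl⟩ hne
      have hjk : j < k := by
        rcases hj.eq_or_lt with h | h
        · exact absurd (by rw [h]) hne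
        · exact h
      have h1 := hbn j hj i
      have h2 : |b j i| ≠ (n : ℤ) := fun h => hbi j hjk (ib_of (hbn j hj) h)
      simp only [Pi.zero_apply, sub_zero] at h1
      have h3 := abs_lt.1 (lt_of_le_of_ne h1 h2)
      unfold ht
      rcases hσ with rfl | rfl <;> omega
    have h1 := hcore μ hμ i σ hσ (b k) S hBelow m hm2 z g1 g2 g3 g4
    have h2 := hesc μ hμ n (by omega) D (hcub _ (by omega)) S
      (by rintro y ⟨j, hj, rfl⟩; exact hbn j hj) (b k) (hbn k le_rfl)
    have hG := meas_G0 S (cube (b k) (m - 1)) z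
    refine ⟨_, meas_EvU D b k hG, ?_, ?_⟩
    · filter_upwards [hnice] with ω hω hE
      obtain ⟨s, h3, h4⟩ := Set.mem_iUnion.1 hE
      exact dir2 hω (by omega) (hcub _ (by omega)) hbn hbk hbi h3 h4
    · have hP := Pm_prob hμ (b k)
      have h3 : ENNReal.ofReal (min (c / C) 1 * ((m : ℝ) ^ (d - 2))⁻¹) *
          (Pm μ (b k)) {ω | avoidBeforeExitPos D S ω} ≤
          (Pm μ (b k)) (G0 S (cube (b k) (m - 1)) z) := by
        rw [← ofReal_measureReal, ← ofReal_measureReal, ← ENNReal.ofReal_mul (by positivity)]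
        apply ENNReal.ofReal_le_ofReal
        refine le_trans ?_ h1
        calc _ ≤ c / C * ((m : ℝ) ^ (d - 2))⁻¹ * (C * avg (av μ S) (b k)) := by
              gcongr
              exact min_le_left _ _
          _ = _ := by field_simp
      rw [EvU_eq (by omega) hμ hG]
      · refine (mul_le_mul_right (hle.trans (EvU_le (by omega) hμ hAv)) _).trans ?_
        rw [← ENNReal.tsum_mul_left]
        refine ENNReal.tsum_le_tsum fun s => ?_
        rw [mul_left_comm]
        exact mul_le_mul_right h3 _
      · rintro ω ⟨s, _, h5, h6⟩ l hl he
        by_cases hls : l ≤ s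
        · exact (h5 l hl hls).1 ⟨k, le_rfl, he⟩
        · exact (h6 l (by omega)).1 ⟨k, le_rfl, he⟩

end

section
lemma hitCount_ge (F : Finset (V d)) (l : List (V d)) :
    (∑ z ∈ F, if z ∈ l then 1 else 0) ≤ hitCount (F : Set (V d)) l := by
  induction l with
  | nil => simp
  | cons v l ih =>
    have h1 : hitCount (F : Set (V d)) (v :: l) =
        (if v ∈ (F : Set (V d)) then 1 else 0) + hitCount (F : Set (V d)) l := by
      simp [hitCount]
    have h2 : (∑ z ∈ F, if z = v then 1 else 0) = if v ∈ (F : Set (V d)) then 1 else 0 := by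
      rw [Finset.sum_ite_eq']
      simp
    rw [h1, ← h2]
    refine le_trans ?_ (Nat.add_le_add_left ih _)
    rw [← Finset.sum_add_distrib]
    refine Finset.sum_le_sum fun z _ => ?_
    by_cases hz : z = v <;> by_cases hl : z ∈ l <;> simp [hz, hl]

lemma cond_ge {μ : Measure (ℕ → V d)} [IsProbabilityMeasure μ] {A E : Set (ℕ → V d)} {p : ℝ≥0∞}
    (hA : μ A ≠ 0) (hE : ∀ᵐ ω ∂μ, ω ∈ E → ω ∈ A) (h : p * μ A ≤ μ E) :
    p ≤ ProbabilityTheory.cond μ A E := by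
  have h1 : μ E ≤ μ (E ∩ A) := measure_mono_ae (by
    filter_upwards [hE] with ω h h' using ⟨h', h h'⟩)
  have h2 : ProbabilityTheory.cond μ A E = (μ A)⁻¹ * μ.restrict A E := rfl
  rw [h2]
  calc p = (μ A)⁻¹ * (p * μ A) := by
        rw [mul_comm p, ← mul_assoc, ENNReal.inv_mul_cancel hA (measure_ne_top _ _), one_mul]
    _ ≤ _ := mul_le_mul_right ((h.trans h1).trans (Measure.le_restrict_apply _ _)) _

end

/-- Lemma 3.8 (key estimate).  Let `d ≥ 5`, and adopt the shell setup (`Q_{4N} ⊆ D`,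
`16 ≤ n < n+m ≤ N`, `m ≤ n/8`, `L` the LERW stopped at its first exit from `D`, `α`
its initial segment up to the first hit of `∂ᵢQ_n` with endpoint `x₀`, `β` the segment
from `x₀` to the first hit of `∂ᵢQ(x₀,m)`, and `A = Q(x₀ + (m/2)e₁, m/4)` suitably
rotated).  There is `c = c(d) > 0` such that `P( z ∈ β | α ) ≥ c m^{2-d}` for every
`z ∈ A`, and consequently `E( H_A(β) | α ) ≥ c m²`. -/
theorem beta_point_and_moment_lower_bound :
    ∀ d : ℕ, 5 ≤ d → ∃ c : ℝ, 0 < c ∧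
      ∀ (N n m : ℕ) (D : Set (V d)),
        1 ≤ N → cube 0 (4 * N) ⊆ D → 16 ≤ n → n < n + m → n + m ≤ N → m ≤ n / 8 →
        ∀ μ : Measure (ℕ → V d), IsSRWLaw μ 0 →
        ∀ a : List (V d), μ { ω | alphaList D n ω = a } ≠ 0 →
          (∀ z ∈ boxA (endPt a) n m,
            c * (m : ℝ) ^ ((2 : ℤ) - (d : ℤ)) ≤
              (ProbabilityTheory.cond μ { ω | alphaList D n ω = a }
                { ω | z ∈ betaList D n m ω }).toReal) ∧
          ENNReal.ofReal (c * (m : ℝ) ^ 2) ≤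
            ∫⁻ ω, (hitCount (boxA (endPt a) n m) (betaList D n m ω) : ℝ≥0∞)
              ∂(ProbabilityTheory.cond μ { ω | alphaList D n ω = a }) := by
  intro d hd
  obtain ⟨c, hc, hkey⟩ := key_event hd
  refine ⟨c / 4 ^ d, by positivity, ?_⟩
  intro N n m D _ hD hn hm hN _ μ hμ a ha
  have hm1 : 1 ≤ m := by omega
  have hmR : (0 : ℝ) < m := by exact_mod_cast hm1
  have hP := hμ.1
  have hν : IsProbabilityMeasure (ProbabilityTheory.cond μ {ω | alphaList D n ω = a}) :=
    ProbabilityTheory.cond_isProbabilityMeasure ha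
  have hac : ProbabilityTheory.cond μ {ω | alphaList D n ω = a} ≪ μ :=
    ProbabilityTheory.cond_absolutelyContinuous
  have hE := hkey N n m D hD hn hm1 hN μ hμ a ha
  choose! E hE1 hE2 hE3 using hE
  have hp : ∀ z ∈ boxA (endPt a) n m, ENNReal.ofReal (c * ((m : ℝ) ^ (d - 2))⁻¹) ≤
      ProbabilityTheory.cond μ {ω | alphaList D n ω = a} (E z) := fun z hz =>
    cond_ge ha ((hE2 z hz).mono fun ω h h' => (h h').1) (hE3 z hz)
  have hzp : (m : ℝ) ^ ((2 : ℤ) - (d : ℤ)) = ((m : ℝ) ^ (d - 2))⁻¹ := by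
    rw [show (2 : ℤ) - (d : ℤ) = -((d - 2 : ℕ) : ℤ) by omega, zpow_neg, zpow_natCast]
  refine ⟨fun z hz => ?_, ?_⟩
  · have h1 : ENNReal.ofReal (c * ((m : ℝ) ^ (d - 2))⁻¹) ≤
        ProbabilityTheory.cond μ {ω | alphaList D n ω = a} {ω | z ∈ betaList D n m ω} :=
      (hp z hz).trans (measure_mono_ae (hac.ae_le ((hE2 z hz).mono fun ω h h' => (h h').2)))
    rw [ENNReal.ofReal_le_iff_le_toReal (measure_ne_top _ _)] at h1
    refine le_trans ?_ h1
    rw [hzp]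
    gcongr
    exact div_le_self hc.le (one_le_pow₀ (by norm_num))
  · have hbox : boxA (endPt a) n m = _ := cube_eq_Icc (x1pt (endPt a) n m) (m / 4)
    have hcard := cube_card (x1pt (endPt a) n m) (m / 4)
    generalize Finset.Icc (fun i => x1pt (endPt a) n m i - ((m / 4 : ℕ) : ℤ))
      (fun i => x1pt (endPt a) n m i + ((m / 4 : ℕ) : ℤ)) = F at hbox hcard
    rw [hbox] at hp hE1 hE2 ⊢
    have hae : ∀ᵐ ω ∂(ProbabilityTheory.cond μ {ω | alphaList D n ω = a}),
        ∀ z ∈ F, ω ∈ E z → z ∈ betaList D n m ω := by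
      refine (ae_ball_iff F.countable_toSet).2 fun z hz => ?_
      exact hac.ae_le ((hE2 z hz).mono fun ω h h' => (h h').2)
    calc ENNReal.ofReal (c / 4 ^ d * (m : ℝ) ^ 2)
        ≤ ∑ z ∈ F, ENNReal.ofReal (c * ((m : ℝ) ^ (d - 2))⁻¹) := by
          rw [Finset.sum_const, nsmul_eq_mul, hcard, ← ENNReal.ofReal_natCast,
            ← ENNReal.ofReal_mul (by positivity)]
          apply ENNReal.ofReal_le_ofReal
          have h4 : (m : ℝ) / 4 ≤ ((2 * (m / 4) + 1 : ℕ) : ℝ) := by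
            rw [div_le_iff₀ (by norm_num)]
            have : m ≤ (2 * (m / 4) + 1) * 4 := by omega
            exact_mod_cast this
          have h5 : (m : ℝ) ^ d = (m : ℝ) ^ (d - 2) * (m : ℝ) ^ 2 := by
            rw [← pow_add]; congr 1; omega
          calc c / 4 ^ d * (m : ℝ) ^ 2 = ((m : ℝ) / 4) ^ d * (c * ((m : ℝ) ^ (d - 2))⁻¹) := by
                rw [div_pow, h5]; field_simp
            _ ≤ _ := by
                rw [Nat.cast_pow]
                gcongr
      _ ≤ ∑ z ∈ F, ProbabilityTheory.cond μ {ω | alphaList D n ω = a} (E z) :=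
          Finset.sum_le_sum fun z hz => hp z hz
      _ = ∫⁻ ω, ∑ z ∈ F, (E z).indicator 1 ω
            ∂(ProbabilityTheory.cond μ {ω | alphaList D n ω = a}) := by
          rw [lintegral_finsetSum _ fun z hz => measurable_one.indicator (hE1 z hz)]
          exact Finset.sum_congr rfl fun z hz => (lintegral_indicator_one (hE1 z hz)).symm
      _ ≤ _ := by
          refine lintegral_mono_ae ?_
          filter_upwards [hae] with ω hω
          refine le_trans ?_ (Nat.cast_le.2 (hitCount_ge F (betaList D n m ω)))
          rw [Nat.cast_sum]
          refine Finset.sum_le_sum fun z hz => ?_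
          by_cases h : ω ∈ E z
          · simp [h, hω z hz h]
          · simp [h]

end USFPaper
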